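/- arXiv:1902.06577 — 2 statements merged into one kernel-verified Lean document; each statement's English description precedes it below -/
import Mathlib

section
/- For every field K and every n ≥ 4, the ring R/I^Sp_{(n−2,2)} is Gorenstein. -/
open MvPolynomial

/-- `T : Fin n → ℕ × ℕ` is a Young tableau of shape given by the list `parts` of row
lengths: `T` is a bijection from `{0, …, n-1}` onto the set of boxes `(r, c)`
(row `r`, column `c`, both 0-indexed) of the Young diagram of `parts`. -/
def IsTableau (parts : List ℕ) {n : ℕ} (T : Fin n → ℕ × ℕ) : Prop :=
  Function.Injective T ∧
  (∀ i : Fin n, (T i).1 < parts.length ∧ (T i).2 < parts.getD (T i).1 0) ∧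
  (∀ r c : ℕ, r < parts.length → c < parts.getD r 0 → ∃ i : Fin n, T i = (r, c))

/-- The Specht polynomial `f_T` of a tableau `T`: the product over all columns `j` of
`∏_{1 ≤ s < t ≤ m} (x_{j_s} - x_{j_t})`, where `j_1, …, j_m` are the entries of column `j`
from top to bottom; equivalently, the product of `X i - X j` over all pairs of entries
`i, j` lying in the same column with `i` strictly above `j`. -/
noncomputable def spechtPoly (K : Type*) [CommRing K] {n : ℕ} (T : Fin n → ℕ × ℕ) :
    MvPolynomial (Fin n) K :=
  ∏ p ∈ Finset.univ.filter
      (fun p : Fin n × Fin n => (T p.1).2 = (T p.2).2 ∧ (T p.1).1 < (T p.2).1),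
    (X p.1 - X p.2)

/-- The Specht ideal of shape `parts`: the ideal of `K[x_1, …, x_n]` generated by all
Specht polynomials of Young tableaux of shape `parts`. -/
noncomputable def spechtIdeal (K : Type*) [CommRing K] (n : ℕ) (parts : List ℕ) :
    Ideal (MvPolynomial (Fin n) K) :=
  Ideal.span {f | ∃ T : Fin n → ℕ × ℕ, IsTableau parts T ∧ f = spechtPoly K T}

/-- The depth of a (local) commutative ring: the supremum of the lengths of regular
sequences contained in the Jacobson radical (which is the maximal ideal when the ring
is local). -/
noncomputable def ringDepth (A : Type*) [CommRing A] : ℕ∞ :=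
  ⨆ rs : {rs : List A // (∀ r ∈ rs, r ∈ (⊥ : Ideal A).jacobson) ∧
      RingTheory.Sequence.IsRegular A rs}, (rs.1.length : ℕ∞)

/-- A commutative ring is Cohen–Macaulay if the localization at every prime ideal has
depth equal to its Krull dimension. -/
def IsCohenMacaulayRing (A : Type*) [CommRing A] : Prop :=
  ∀ (P : Ideal A) [P.IsPrime],
    (ringDepth (Localization.AtPrime P) : WithBot ℕ∞) = ringKrullDim (Localization.AtPrime P)

/-- An ideal is irreducible if it is proper and is not the intersection of two strictly
larger ideals. -/
def Ideal.IsIrreducible {A : Type*} [CommRing A] (I : Ideal A) : Prop :=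
  I ≠ ⊤ ∧ ∀ J₁ J₂ : Ideal A, I = J₁ ⊓ J₂ → I = J₁ ∨ I = J₂

/-- A (local) commutative ring is Gorenstein if it is Cohen–Macaulay (depth equals
Krull dimension) and some maximal regular sequence in the maximal ideal (= the Jacobson
radical), of length equal to the Krull dimension, generates an irreducible ideal.  For
Noetherian local Cohen–Macaulay rings this is equivalent to the canonical module being
free of rank one. -/
def IsGorensteinLocalRing (A : Type*) [CommRing A] : Prop :=
  (ringDepth A : WithBot ℕ∞) = ringKrullDim A ∧
    ∃ rs : List A, (∀ r ∈ rs, r ∈ (⊥ : Ideal A).jacobson) ∧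
      RingTheory.Sequence.IsRegular A rs ∧
      ((rs.length : ℕ∞) : WithBot ℕ∞) = ringKrullDim A ∧
      (Ideal.span {x | x ∈ rs}).IsIrreducible

/-- A commutative ring is Gorenstein if its localization at every prime is a Gorenstein
local ring. -/
def IsGorensteinRing (A : Type*) [CommRing A] : Prop :=
  ∀ (P : Ideal A) [P.IsPrime], IsGorensteinLocalRing (Localization.AtPrime P)

/-- In a Noetherian local ring, a weakly regular sequence in the maximal ideal such that the
quotient has an element lying in every nonzero ideal witnesses the Gorenstein property. -/
theorem IsGorensteinLocalRing.of_socle {L : Type*} [CommRing L] [IsLocalRing L]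
    [IsNoetherianRing L] (rs : List L) (hmem : ∀ r ∈ rs, r ∈ IsLocalRing.maximalIdeal L)
    (hreg : RingTheory.Sequence.IsWeaklyRegular L rs) (σ : L) (hσ : σ ∉ Ideal.ofList rs)
    (hsoc : ∀ x ∉ Ideal.ofList rs, ∃ h, h * x - σ ∈ Ideal.ofList rs) :
    IsGorensteinLocalRing L := by
  have hjac : (⊥ : Ideal L).jacobson = IsLocalRing.maximalIdeal L :=
    IsLocalRing.jacobson_eq_maximalIdeal ⊥ bot_ne_top
  have hIne : Ideal.ofList rs ≠ ⊤ := fun h => hσ (h ▸ Submodule.mem_top)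
  have hregular : RingTheory.Sequence.IsRegular L rs :=
    (IsLocalRing.isRegular_iff_isWeaklyRegular_of_subset_maximalIdeal hmem).mpr hreg
  have hdim0 : ringKrullDim (L ⧸ Ideal.ofList rs) = 0 := by
    have : Nontrivial (L ⧸ Ideal.ofList rs) := Ideal.Quotient.nontrivial_iff.mpr hIne
    have : IsLocalRing (L ⧸ Ideal.ofList rs) :=
      IsLocalRing.of_surjective' (Ideal.Quotient.mk _) Ideal.Quotient.mk_surjective
    set m := IsLocalRing.maximalIdeal (L ⧸ Ideal.ofList rs)
    have hσ0 : Ideal.Quotient.mk (Ideal.ofList rs) σ ≠ 0 := by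
      rwa [Ne, Ideal.Quotient.eq_zero_iff_mem]
    have hinter : (⨅ i : ℕ, m ^ i) = ⊥ :=
      Ideal.iInf_pow_eq_bot_of_isLocalRing m (Ideal.IsPrime.ne_top inferInstance)
    obtain ⟨k, hk⟩ : ∃ k : ℕ, Ideal.Quotient.mk (Ideal.ofList rs) σ ∉ m ^ k := by
      by_contra! hall
      refine hσ0 ?_
      rw [← Ideal.mem_bot, ← hinter]
      exact (Submodule.mem_iInf _).mpr hall
    have hbot : m ^ k = ⊥ := by
      rw [eq_bot_iff]
      intro x hx
      obtain ⟨x, rfl⟩ := Ideal.Quotient.mk_surjective x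
      by_contra hx0
      rw [Ideal.mem_bot, Ideal.Quotient.eq_zero_iff_mem] at hx0
      obtain ⟨h, hh⟩ := hsoc x hx0
      refine hk ?_
      rw [← (Ideal.Quotient.mk_eq_mk_iff_sub_mem _ _).mpr hh, map_mul]
      exact Ideal.mul_mem_left _ _ hx
    have : Ring.KrullDimLE 0 (L ⧸ Ideal.ofList rs) := by
      refine Ring.KrullDimLE.mk₀ fun I hI => ?_
      have : m ≤ I := hI.le_of_pow_le (hbot ▸ bot_le : m ^ k ≤ I)
      rw [← (IsLocalRing.maximalIdeal.isMaximal _).eq_of_le hI.ne_top this]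
      exact IsLocalRing.maximalIdeal.isMaximal _
    exact ringKrullDimZero_iff_ringKrullDim_eq_zero.mp this
  have hdim : ((rs.length : ℕ∞) : WithBot ℕ∞) = ringKrullDim L := by
    rw [← ringKrullDim_add_length_eq_ringKrullDim_of_isRegular rs hregular, hdim0, zero_add]
    rfl
  refine ⟨le_antisymm ?_ ?_, rs, hjac ▸ hmem, hregular, hdim, hIne, ?_⟩
  · rw [← hdim, WithBot.coe_le_coe]
    refine iSup_le fun ⟨ts, _, hts⟩ => ?_
    have h := ringKrullDim_add_length_eq_ringKrullDim_of_isRegular ts hts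
    have hne : Nontrivial (L ⧸ Ideal.ofList ts) := by
      refine Ideal.Quotient.nontrivial_iff.mpr fun h => hts.top_ne_smul ?_
      simp [h]
    rw [← WithBot.coe_le_coe, hdim, ← h]
    exact le_add_of_nonneg_left ringKrullDim_nonneg_of_nontrivial
  · rw [← hdim, WithBot.coe_le_coe]
    exact le_iSup (fun ts : {ts : List L // (∀ r ∈ ts, r ∈ (⊥ : Ideal L).jacobson) ∧
      RingTheory.Sequence.IsRegular L ts} => (ts.1.length : ℕ∞)) ⟨rs, hjac ▸ hmem, hregular⟩
  · intro J₁ J₂ hJ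
    have key : ∀ J : Ideal L, Ideal.ofList rs ≤ J → Ideal.ofList rs ≠ J → σ ∈ J := by
      intro J hle hne
      obtain ⟨x, hxJ, hx⟩ := SetLike.exists_of_lt (lt_of_le_of_ne hle hne)
      obtain ⟨h, hh⟩ := hsoc x hx
      exact (Submodule.sub_mem_iff_right J (J.mul_mem_left h hxJ)).mp (hle hh)
    by_contra! hcon
    refine hσ ?_
    change Ideal.ofList rs = _ at hJ
    rw [hJ]
    exact ⟨key J₁ (hJ ▸ inf_le_left) hcon.1, key J₂ (hJ ▸ inf_le_right) hcon.2⟩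

/-- Images in the localization at `P` form a weakly regular sequence. -/
def IsWeaklyRegularAt {A : Type*} [CommRing A] (P : Ideal A) [P.IsPrime] (rs : List A) : Prop :=
  RingTheory.Sequence.IsWeaklyRegular (Localization.AtPrime P)
    (rs.map (algebraMap A (Localization.AtPrime P)))

theorem IsWeaklyRegularAt.nil {A : Type*} [CommRing A] (P : Ideal A) [P.IsPrime] :
    IsWeaklyRegularAt P [] :=
  RingTheory.Sequence.IsWeaklyRegular.nil _ _

theorem IsWeaklyRegularAt.append_singleton {A : Type*} [CommRing A] {P : Ideal A} [P.IsPrime]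
    {rs : List A} (hrs : IsWeaklyRegularAt P rs) (r : A)
    (hr : ∀ x, r * x ∈ Ideal.ofList rs → ∃ u ∉ P, u * x ∈ Ideal.ofList rs) :
    IsWeaklyRegularAt P (rs ++ [r]) := by
  rw [IsWeaklyRegularAt, List.map_append, RingTheory.Sequence.isWeaklyRegular_append_iff]
  refine ⟨hrs, ?_⟩
  rw [List.map_singleton, RingTheory.Sequence.isWeaklyRegular_singleton_iff,
    ← Ideal.map_ofList, isSMulRegular_iff_right_eq_zero_of_smul]
  intro x hx
  obtain ⟨x, rfl⟩ := Submodule.mkQ_surjective _ x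
  obtain ⟨a, s, rfl⟩ := IsLocalization.exists_mk'_eq P.primeCompl x
  have hmem : ∀ b : A, IsLocalization.mk' (Localization.AtPrime P) b s ∈
      ((Ideal.ofList rs).map (algebraMap A (Localization.AtPrime P)) •
        (⊤ : Submodule (Localization.AtPrime P) (Localization.AtPrime P))) ↔
      ∃ u ∉ P, u * b ∈ Ideal.ofList rs := by
    intro b
    rw [smul_eq_mul, Ideal.mul_top, IsLocalization.mk'_mem_map_algebraMap_iff P.primeCompl]
    rfl
  rw [← map_smul, Submodule.mkQ_apply, Submodule.Quotient.mk_eq_zero,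
    smul_eq_mul (a := algebraMap A (Localization.AtPrime P) r),
    IsLocalization.mul_mk'_eq_mk'_of_mul, hmem] at hx
  rw [Submodule.mkQ_apply, Submodule.Quotient.mk_eq_zero, hmem]
  obtain ⟨u, hu, hux⟩ := hx
  obtain ⟨v, hv, hvx⟩ := hr (u * a) (by convert hux using 1; ring)
  exact ⟨v * u, fun h => (Ideal.IsPrime.mem_or_mem ‹_› h).elim hv hu, by rwa [mul_assoc]⟩

theorem isGorensteinLocalRing_atPrime {A : Type*} [CommRing A] [IsNoetherianRing A]
    (P : Ideal A) [P.IsPrime] (rs : List A) (hmem : ∀ r ∈ rs, r ∈ P)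
    (hreg : IsWeaklyRegularAt P rs) (σ : A) (hσ : ∀ u ∉ P, u * σ ∉ Ideal.ofList rs)
    (hsoc : ∀ g, (∃ u ∉ P, u * g ∈ Ideal.ofList rs) ∨
      ∃ h, ∃ u ∉ P, h * g - u * σ ∈ Ideal.ofList rs) :
    IsGorensteinLocalRing (Localization.AtPrime P) := by
  have : IsNoetherianRing (Localization.AtPrime P) :=
    IsLocalization.isNoetherianRing P.primeCompl _ inferInstance
  refine IsGorensteinLocalRing.of_socle (rs.map (algebraMap A (Localization.AtPrime P)))
    ?_ hreg (algebraMap A _ σ) ?_ ?_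
  · intro r hr
    obtain ⟨a, ha, rfl⟩ := List.mem_map.mp hr
    exact (IsLocalization.AtPrime.to_map_mem_maximal_iff _ P a).mpr (hmem a ha)
  · rw [← Ideal.map_ofList, IsLocalization.algebraMap_mem_map_algebraMap_iff P.primeCompl]
    rintro ⟨u, hu, h⟩
    exact hσ u hu h
  · intro x hx
    obtain ⟨a, s, rfl⟩ := IsLocalization.exists_mk'_eq P.primeCompl x
    rw [← Ideal.map_ofList] at hx ⊢
    rw [IsLocalization.mk'_mem_map_algebraMap_iff P.primeCompl] at hx
    obtain h | ⟨h, u, hu, hh⟩ := hsoc a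
    · exact absurd h hx
    · lift u to P.primeCompl using hu
      refine ⟨IsLocalization.mk' _ 1 u * algebraMap _ _ (h * s), ?_⟩
      convert Ideal.mul_mem_left _ (IsLocalization.mk' (Localization.AtPrime P) 1 u)
        (Ideal.mem_map_of_mem (algebraMap A (Localization.AtPrime P)) hh) using 1
      have h1 := IsLocalization.mk'_spec (Localization.AtPrime P) a s
      have h2 := IsLocalization.mk'_spec (Localization.AtPrime P) 1 u
      simp only [map_mul, map_sub, map_one] at h2 ⊢
      linear_combination IsLocalization.mk' (Localization.AtPrime P) 1 u *
        algebraMap A _ h * h1 + algebraMap A _ σ * h2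

namespace Polynomial

theorem degree_leadingCoeff_mul_sub_lt {D : Type*} [CommRing D] [IsDomain D] {f g : D[X]}
    (hf : f ≠ 0) (hg : g ≠ 0) (h : g.natDegree ≤ f.natDegree) :
    (C g.leadingCoeff * f - C f.leadingCoeff * X ^ (f.natDegree - g.natDegree) * g).degree <
      f.degree := by
  have hf' : f.leadingCoeff ≠ 0 := leadingCoeff_ne_zero.mpr hf
  have hg' : g.leadingCoeff ≠ 0 := leadingCoeff_ne_zero.mpr hg
  rw [← degree_C_mul hg' (p := f)]
  refine degree_sub_lt_left ?_ (mul_ne_zero (C_ne_zero.mpr hg') hf) ?_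
  · rw [degree_C_mul hg', mul_assoc, degree_C_mul hf', degree_mul, degree_X_pow,
      degree_eq_natDegree hf, degree_eq_natDegree hg]
    norm_cast
    omega
  · simp only [leadingCoeff_mul, leadingCoeff_C, leadingCoeff_X_pow]
    ring

/-- A ring `A` over `S` embedded, via the maps `π i`, in a product of polynomial rings `S[X]` as
the subring of all tuples with equal constant terms and with linear coefficients adding up to
zero. The element `e i` is `X ^ 2` in the `i`-th component, and `z i` is a lift of `X` there. -/
structure AxesEmbedding (S A ι : Type*) [CommRing S] [CommRing A] [Fintype ι]
    [DecidableEq ι] where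
  s : S →+* A
  π : ι → A →+* S[X]
  e : ι → A
  z : ι → A
  π_s : ∀ i a, π i (s a) = C a
  π_e : ∀ i j, π i (e j) = if i = j then X ^ 2 else 0
  π_z : ∀ i, π i (z i) = X
  mem_map : ∀ (q : Ideal S) (x : A), (∀ i k, (π i x).coeff k ∈ q) → x ∈ q.map s
  coeff_zero : ∀ x i j, (π i x).coeff 0 = (π j x).coeff 0
  sum_coeff_one : ∀ x, ∑ i, (π i x).coeff 1 = 0
  exists_linear : ∀ b : ι → S, ∑ i, b i = 0 → ∃ x, ∀ i, π i x = C (b i) * X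

namespace AxesEmbedding

variable {S A ι : Type*} [CommRing S] [CommRing A] [Fintype ι] [DecidableEq ι]
  (E : AxesEmbedding S A ι)

theorem coeff_mem {q : Ideal S} {x : A} (hx : x ∈ q.map E.s) (i : ι) (k : ℕ) :
    (E.π i x).coeff k ∈ q := by
  have h : (q.map E.s).map (E.π i) = q.map C := by
    rw [Ideal.map_map]
    congr 1
    ext a
    simp [E.π_s]
  exact Ideal.mem_map_C_iff.mp (h ▸ Ideal.mem_map_of_mem (E.π i) hx) k

theorem eq_of_π_eq {x y : A} (h : ∀ i, E.π i x = E.π i y) : x = y := by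
  have := E.mem_map ⊥ (x - y) fun i k => by simp [h]
  rwa [Ideal.map_bot, Ideal.mem_bot, sub_eq_zero] at this

/-- The lift of a polynomial along the `i`-th component. -/
noncomputable def lift (i : ι) (p : S[X]) : A := p.eval₂ E.s (E.z i)

theorem π_lift (i : ι) (p : S[X]) : E.π i (E.lift i p) = p := by
  rw [lift, hom_eval₂, E.π_z]
  have : (E.π i).comp E.s = C := RingHom.ext (E.π_s i)
  rw [this, eval₂_C_X]

theorem π_e_mul_lift (i j : ι) (p : S[X]) :
    E.π j (E.e i * E.lift i p) = if j = i then X ^ 2 * p else 0 := by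
  rw [map_mul, E.π_e]
  split_ifs with h
  · rw [h, E.π_lift]
  · rw [zero_mul]

theorem e_mul_mem {q : Ideal S} {i : ι} {x : A} (h : ∀ k, (E.π i x).coeff k ∈ q) :
    E.e i * x ∈ q.map E.s := by
  refine E.mem_map q _ fun j k => ?_
  rw [map_mul, E.π_e]
  split_ifs with hji
  · subst hji
    rw [coeff_X_pow_mul']
    split_ifs
    · exact h _
    · exact q.zero_mem
  · simp

/-- The contraction of a prime to the base is generated by a sequence regular at that prime. -/
theorem exists_ofList_eq_map_comap [IsDomain S] [IsPrincipalIdealRing S] (P : Ideal A)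
    [P.IsPrime] : ∃ rs : List A, (∀ r ∈ rs, r ∈ P) ∧ IsWeaklyRegularAt P rs ∧
      Ideal.ofList rs = (P.comap E.s).map E.s := by
  by_cases hq : P.comap E.s = ⊥
  · exact ⟨[], by simp, .nil P, by rw [hq, Ideal.map_bot, Ideal.ofList_nil]⟩
  · obtain ⟨f, hf⟩ := (IsPrincipalIdealRing.principal (P.comap E.s)).principal
    change _ = Ideal.span {f} at hf
    have hf0 : f ≠ 0 := by
      rintro rfl
      exact hq (by simpa using hf)
    have hfP : f ∈ P.comap E.s := hf ▸ Ideal.mem_span_singleton_self f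
    refine ⟨[] ++ [E.s f], by simpa using hfP, (IsWeaklyRegularAt.nil P).append_singleton _ ?_, ?_⟩
    · intro x hx
      rw [Ideal.ofList_nil, Ideal.mem_bot] at hx
      refine ⟨1, P.one_notMem, ?_⟩
      have : x = 0 := E.eq_of_π_eq fun i => by
        have := congrArg (E.π i) hx
        rw [map_mul, E.π_s, map_zero] at this
        rw [map_zero]
        exact (mul_eq_zero.mp this).resolve_left (by simpa using hf0)
      simp [this]
    · rw [hf, Ideal.map_span]
      simp

theorem isGorensteinLocalRing_of_e_notMem [IsDomain S] [IsPrincipalIdealRing S]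
    [IsNoetherianRing A] (P : Ideal A) [P.IsPrime] (i : ι) (hi : E.e i ∉ P) :
    IsGorensteinLocalRing (Localization.AtPrime P) := by
  obtain ⟨rs, hmem, hreg, hrs⟩ := E.exists_ofList_eq_map_comap P
  set q := P.comap E.s with hq
  have hqprime : q.IsPrime := inferInstance
  have of_forall : ∀ ts : List A, (∀ r ∈ ts, r ∈ P) → IsWeaklyRegularAt P ts →
      (∀ g ∈ P, ∃ u ∉ P, u * g ∈ Ideal.ofList ts) →
      IsGorensteinLocalRing (Localization.AtPrime P) := by
    intro ts hts htreg hall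
    refine isGorensteinLocalRing_atPrime P ts hts htreg 1 ?_ ?_
    · intro u hu hu'
      rw [mul_one] at hu'
      exact hu ((Ideal.span_le.mpr hts : Ideal.ofList ts ≤ P) hu')
    · intro g
      by_cases hg : g ∈ P
      · exact .inl (hall g hg)
      · exact .inr ⟨1, g, hg, by simp⟩
  -- the image of `x` on the `i`-th component modulo `q`
  let ρ : A →+* (S ⧸ q)[X] := (mapRingHom (Ideal.Quotient.mk q)).comp (E.π i)
  have hρ : ∀ x, ρ x = 0 → E.e i * x ∈ q.map E.s := by
    intro x hx
    refine E.e_mul_mem fun k => ?_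
    have := congrArg (coeff · k) hx
    simpa [ρ, Ideal.Quotient.eq_zero_iff_mem] using this
  have hρ0 : ∀ x ∈ q.map E.s, ρ x = 0 := by
    intro x hx
    ext k
    simpa [ρ, Ideal.Quotient.eq_zero_iff_mem] using E.coeff_mem hx i k
  by_cases hP : ∀ g ∈ P, ρ g = 0
  · exact of_forall rs hmem hreg fun g hg => ⟨_, hi, hrs ▸ hρ g (hP g hg)⟩
  · push Not at hP
    obtain ⟨g, ⟨hgP, hg0⟩, hmin⟩ := exists_minimalFor_of_wellFoundedLT
      (fun g => g ∈ P ∧ ρ g ≠ 0) (fun g => (ρ g).natDegree) hP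
    refine of_forall (rs ++ [g]) ?_ (hreg.append_singleton g ?_) ?_
    · simpa [or_imp, forall_and] using ⟨hmem, hgP⟩
    · intro x hx
      rw [hrs] at hx ⊢
      refine ⟨_, hi, hρ x ?_⟩
      have := hρ0 _ hx
      rw [map_mul] at this
      exact (mul_eq_zero.mp this).resolve_left hg0
    · have hJ : Ideal.ofList (rs ++ [g]) = q.map E.s ⊔ Ideal.span {g} := by
        rw [Ideal.ofList_append, hrs, Ideal.ofList_singleton]
      rw [hJ]
      have hgJ : g ∈ q.map E.s ⊔ Ideal.span {g} :=
        Ideal.mem_sup_right (Ideal.mem_span_singleton_self g)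
      suffices ∀ (n : ℕ) (x : A), x ∈ P → (ρ x).natDegree < n →
          ∃ u ∉ P, u * x ∈ q.map E.s ⊔ Ideal.span {g} from
        fun x hx => this _ x hx (Nat.lt_succ_self _)
      intro n
      induction n with
      | zero => intro x _ h; omega
      | succ n ih =>
        intro x hx hn
        by_cases hx0 : ρ x = 0
        · exact ⟨_, hi, Ideal.mem_sup_left (hρ x hx0)⟩
        have hle : (ρ g).natDegree ≤ (ρ x).natDegree := by
          by_contra! hlt
          exact absurd (hmin ⟨hx, hx0⟩ hlt.le) (by simpa using hlt)
        obtain ⟨c, hc⟩ := Ideal.Quotient.mk_surjective (ρ g).leadingCoeff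
        obtain ⟨d, hd⟩ := Ideal.Quotient.mk_surjective (ρ x).leadingCoeff
        have hcP : E.s c ∉ P := by
          intro h
          have : c ∈ q := h
          rw [← Ideal.Quotient.eq_zero_iff_mem, hc] at this
          exact hg0 (leadingCoeff_eq_zero.mp this)
        set y := E.s c * x - E.s d * E.z i ^ ((ρ x).natDegree - (ρ g).natDegree) * g with hy
        have hyP : y ∈ P := P.sub_mem (P.mul_mem_left _ hx) (P.mul_mem_left _ hgP)
        have hρs : ∀ a, ρ (E.s a) = C (Ideal.Quotient.mk q a) := by
          intro a; simp [ρ, E.π_s]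
        have hρz : ρ (E.z i) = X := by simp [ρ, E.π_z]
        have hρy : ρ y = C (ρ g).leadingCoeff * ρ x - C (ρ x).leadingCoeff *
            X ^ ((ρ x).natDegree - (ρ g).natDegree) * ρ g := by
          simp only [hy, map_sub, map_mul, map_pow, hρs, hρz, hc, hd]
        have hxy : ∃ u ∉ P, u * y ∈ q.map E.s ⊔ Ideal.span {g} := by
          by_cases hy0 : ρ y = 0
          · exact ⟨_, hi, Ideal.mem_sup_left (hρ y hy0)⟩
          refine ih y hyP (lt_of_lt_of_le (natDegree_lt_natDegree hy0 ?_) (Nat.lt_succ_iff.mp hn))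
          rw [hρy]
          exact degree_leadingCoeff_mul_sub_lt hx0 hg0 hle
        obtain ⟨u, hu, huy⟩ := hxy
        refine ⟨u * E.s c, fun h => (Ideal.IsPrime.mem_or_mem ‹_› h).elim hu hcP, ?_⟩
        have : u * E.s c * x = u * y +
            u * (E.s d * E.z i ^ ((ρ x).natDegree - (ρ g).natDegree)) * g := by
          rw [hy]; ring
        rw [this]
        exact Ideal.add_mem _ huy (Ideal.mul_mem_left _ _ hgJ)

theorem π_sum_e (j : ι) : E.π j (∑ i, E.e i) = X ^ 2 := by
  simp [E.π_e]

theorem coeff_π_sum_e_mul (j : ι) (x : A) (k : ℕ) :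
    (E.π j ((∑ i, E.e i) * x)).coeff k = if 2 ≤ k then (E.π j x).coeff (k - 2) else 0 := by
  rw [map_mul, E.π_sum_e, coeff_X_pow_mul']

/-- An element lies in the ideal generated by `q` and `∑ i, e i` as soon as its components agree,
modulo `q` and in degrees up to three, with those of a multiple of `∑ i, e i`. -/
theorem mem_map_sup_span {q : Ideal S} {x : A} (c : S) (h0 : ∀ i, (E.π i x).coeff 0 ∈ q)
    (h1 : ∀ i, (E.π i x).coeff 1 ∈ q) (h2 : ∀ i, (E.π i x).coeff 2 - c ∈ q)
    (h3 : ∑ i, (E.π i x).coeff 3 ∈ q) : x ∈ q.map E.s ⊔ Ideal.span {∑ i, E.e i} := by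
  rcases isEmpty_or_nonempty ι with hι | ⟨⟨i₀⟩⟩
  · exact Ideal.mem_sup_left (E.mem_map q x fun i => hι.elim i)
  set d := ∑ i, (E.π i x).coeff 3 with hd
  obtain ⟨l, hl⟩ := E.exists_linear
    (fun i => (E.π i x).coeff 3 - if i = i₀ then d else 0) (by simp [hd])
  set h := E.s c + l + ∑ i, E.e i * E.lift i ((E.π i x).divX.divX.divX.divX) with hh
  have hπ : ∀ i, E.π i h = C c + C ((E.π i x).coeff 3 - if i = i₀ then d else 0) * X +
      X ^ 2 * (E.π i x).divX.divX.divX.divX := by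
    intro i
    simp only [hh, map_add, map_sum, E.π_s, hl, E.π_e_mul_lift]
    simp
  have hsub : x - (∑ i, E.e i) * h ∈ q.map E.s := by
    refine E.mem_map q _ fun i k => ?_
    rw [map_sub, coeff_sub, E.coeff_π_sum_e_mul, hπ]
    match k with
    | 0 => simpa using h0 i
    | 1 => simpa using h1 i
    | 2 => simpa [coeff_X_pow_mul'] using h2 i
    | 3 =>
      simp only [coeff_add, coeff_C_mul, coeff_C, coeff_X_pow_mul', coeff_X]
      simp only [Nat.reduceLeDiff, if_true, Nat.reduceSub, if_false, one_ne_zero]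
      split_ifs <;> simp [h3]
    | k + 4 =>
      simp [coeff_X_pow_mul', coeff_divX]
  rw [← sub_add_cancel x ((∑ i, E.e i) * h)]
  exact Ideal.add_mem _ (Ideal.mem_sup_left hsub) (Ideal.mem_sup_right
    (Ideal.mul_mem_right _ _ (Ideal.mem_span_singleton_self _)))

theorem sum_coeff_three_mem {q : Ideal S} {x : A}
    (hx : x ∈ q.map E.s ⊔ Ideal.span {∑ i, E.e i}) : ∑ i, (E.π i x).coeff 3 ∈ q := by
  obtain ⟨a, ha, b, hb, rfl⟩ := Submodule.mem_sup.mp hx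
  obtain ⟨b, rfl⟩ := Ideal.mem_span_singleton.mp hb
  simp only [map_add, coeff_add, Finset.sum_add_distrib, E.coeff_π_sum_e_mul]
  refine q.add_mem (q.sum_mem fun i _ => E.coeff_mem ha i 3) ?_
  simp [E.sum_coeff_one]

theorem isGorensteinLocalRing_of_forall_e_mem [IsDomain S] [IsPrincipalIdealRing S]
    [IsNoetherianRing A] [Nonempty ι] (P : Ideal A) [P.IsPrime] (hP : ∀ i, E.e i ∈ P) :
    IsGorensteinLocalRing (Localization.AtPrime P) := by
  obtain ⟨rs, hmem, hreg, hrs⟩ := E.exists_ofList_eq_map_comap P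
  set q := P.comap E.s with hq
  obtain ⟨i₀⟩ := ‹Nonempty ι›
  have hP0 : ∀ x, (E.π i₀ x).coeff 0 = 0 → x ∈ P := by
    intro x hx
    refine Ideal.IsPrime.mem_of_pow_mem ‹_› 2 ?_
    have : x ^ 2 = ∑ i, E.e i * E.lift i ((E.π i x).divX ^ 2) := by
      refine E.eq_of_π_eq fun j => ?_
      have h := divX_mul_X_add (E.π j x)
      rw [E.coeff_zero x j i₀, hx, C_0, add_zero] at h
      simp only [map_sum, E.π_e_mul_lift, Finset.sum_ite_eq, Finset.mem_univ, if_true, map_pow]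
      nth_rw 1 [← h]
      ring
    rw [this]
    exact P.sum_mem fun i _ => P.mul_mem_right _ (hP i)
  have hqP : ∀ c, c ∉ q → E.s c ∉ P := fun c hc => hc
  set σ := E.e i₀ * E.z i₀ with hσ
  have hπσ : ∀ i, E.π i σ = if i = i₀ then X ^ 3 else 0 := by
    intro i
    rw [hσ, map_mul, E.π_e]
    split_ifs with h
    · rw [h, E.π_z]; ring
    · simp
  have hJ : Ideal.ofList (rs ++ [∑ i, E.e i]) = q.map E.s ⊔ Ideal.span {∑ i, E.e i} := by
    rw [Ideal.ofList_append, hrs, Ideal.ofList_singleton]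
  refine isGorensteinLocalRing_atPrime P (rs ++ [∑ i, E.e i]) ?_
    (hreg.append_singleton _ ?_) σ ?_ ?_
  · simpa [or_imp, forall_and] using ⟨hmem, P.sum_mem fun i _ => hP i⟩
  · intro x hx
    rw [hrs] at hx ⊢
    refine ⟨1, P.one_notMem, ?_⟩
    rw [one_mul]
    refine E.mem_map q x fun i k => ?_
    have := E.coeff_mem hx i (k + 2)
    rwa [E.coeff_π_sum_e_mul, if_pos (by omega), Nat.add_sub_cancel] at this
  · intro u hu h
    rw [hJ] at h
    have := E.sum_coeff_three_mem h
    have heq : ∀ i, (E.π i (u * σ)).coeff 3 = if i = i₀ then (E.π i₀ u).coeff 0 else 0 := by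
      intro i
      rw [map_mul, hπσ]
      split_ifs with h
      · rw [h, coeff_mul_X_pow', if_pos le_rfl]
      · simp
    simp only [heq, Finset.sum_ite_eq', Finset.mem_univ, if_true] at this
    refine hu ?_
    have h2 := P.add_mem (hP0 (u - E.s ((E.π i₀ u).coeff 0)) (by simp [E.π_s]))
      (show E.s ((E.π i₀ u).coeff 0) ∈ P from this)
    rwa [sub_add_cancel] at h2
  · intro g
    rw [hJ]
    -- it suffices to multiply `g` to the socle degree
    have key : ∀ (h : A) (a c : S), a ∉ q → (∀ i, (E.π i (h * g)).coeff 0 ∈ q) →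
        (∀ i, (E.π i (h * g)).coeff 1 ∈ q) → (∀ i, (E.π i (h * g)).coeff 2 - c ∈ q) →
        (∑ i, (E.π i (h * g)).coeff 3 - a ∈ q) →
        ∃ h, ∃ u ∉ P, h * g - u * σ ∈ q.map E.s ⊔ Ideal.span {∑ i, E.e i} := by
      intro h a c ha h0 h1 h2 h3
      refine ⟨h, E.s a, hqP a ha, E.mem_map_sup_span c ?_ ?_ ?_ ?_⟩
      · intro i
        have := h0 i
        rw [map_sub, map_mul _ (E.s a), hπσ, E.π_s]
        split_ifs <;> simpa [coeff_X_pow] using this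
      · intro i
        have := h1 i
        rw [map_sub, map_mul _ (E.s a), hπσ, E.π_s]
        split_ifs <;> simpa [coeff_X_pow] using this
      · intro i
        have := h2 i
        rw [map_sub, map_mul _ (E.s a), hπσ, E.π_s]
        split_ifs <;> simpa [coeff_X_pow] using this
      · convert h3 using 1
        simp only [map_sub, map_mul _ (E.s a), hπσ, E.π_s, coeff_sub, Finset.sum_sub_distrib]
        congr 1
        rw [Finset.sum_eq_single i₀ (by intro b _ hb; simp [hb]) (by simp)]
        simp
    by_cases ha : (E.π i₀ g).coeff 0 ∈ q
    swap
    · right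
      have : ∀ i, E.π i (σ * g) = if i = i₀ then X ^ 3 * E.π i g else 0 := by
        intro i
        rw [map_mul, hπσ, ite_mul, zero_mul]
      refine key σ _ 0 ha ?_ ?_ ?_ ?_
      · intro i; rw [this]; split_ifs <;> simp
      · intro i; rw [this]; split_ifs <;> simp [coeff_X_pow_mul']
      · intro i; rw [this]; split_ifs <;> simp [coeff_X_pow_mul']
      · simp only [this]
        rw [Finset.sum_eq_single i₀ (by intro b _ hb; simp [hb]) (by simp)]
        simp [coeff_X_pow_mul']
    have ha' : ∀ i, (E.π i g).coeff 0 ∈ q := fun i => E.coeff_zero g i₀ i ▸ ha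
    by_cases hb : ∀ i, (E.π i g).coeff 1 ∈ q
    swap
    · right
      push Not at hb
      obtain ⟨i, hi⟩ := hb
      have : ∀ j, E.π j (E.e i * g) = if j = i then X ^ 2 * E.π j g else 0 := by
        intro j
        rw [map_mul, E.π_e, ite_mul, zero_mul]
      refine key (E.e i) _ 0 hi ?_ ?_ ?_ ?_
      · intro i; rw [this]; split_ifs <;> simp
      · intro i; rw [this]; split_ifs <;> simp [coeff_X_pow_mul']
      · intro i; rw [this]; split_ifs <;> simp [coeff_X_pow_mul', ha']
      · simp only [this]
        rw [Finset.sum_eq_single i (by intro b _ hb; simp [hb]) (by simp)]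
        simp [coeff_X_pow_mul']
    by_cases hc : ∀ i, (E.π i g).coeff 2 - (E.π i₀ g).coeff 2 ∈ q
    swap
    · right
      push Not at hc
      obtain ⟨i, hi⟩ := hc
      obtain ⟨l, hl⟩ := E.exists_linear
        (fun j => (if j = i then 1 else 0) - if j = i₀ then 1 else 0) (by simp)
      have hcoeff : ∀ j k, (E.π j (l * g)).coeff (k + 1) =
          ((if j = i then 1 else 0) - if j = i₀ then 1 else 0) * (E.π j g).coeff k := by
        intro j k
        rw [map_mul, hl, mul_assoc, coeff_C_mul, coeff_X_mul]
      refine key l _ 0 hi ?_ ?_ ?_ ?_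
      · intro j; rw [map_mul, hl]; simp
      · intro j; rw [hcoeff j 0]; exact q.mul_mem_left _ (ha' j)
      · intro j; rw [hcoeff j 1, sub_zero]; exact q.mul_mem_left _ (hb j)
      · have h3 : ∀ j, (E.π j (l * g)).coeff 3 =
            ((if j = i then 1 else 0) - if j = i₀ then 1 else 0) * (E.π j g).coeff 2 :=
          fun j => hcoeff j 2
        simp only [h3]
        simp [sub_mul, Finset.sum_sub_distrib]
    by_cases hd : ∑ i, (E.π i g).coeff 3 ∈ q
    · exact .inl ⟨1, P.one_notMem, by rw [one_mul]; exact E.mem_map_sup_span _ ha' hb hc hd⟩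
    · refine .inr (key 1 _ ((E.π i₀ g).coeff 2) hd ?_ ?_ ?_ ?_) <;> simp only [one_mul]
      exacts [ha', hb, hc, by simp]

theorem isGorensteinRing [IsDomain S] [IsPrincipalIdealRing S] [IsNoetherianRing A]
    [Nonempty ι] (E : AxesEmbedding S A ι) : IsGorensteinRing A := by
  intro P _
  by_cases hP : ∀ i, E.e i ∈ P
  · exact E.isGorensteinLocalRing_of_forall_e_mem P hP
  · push Not at hP
    obtain ⟨i, hi⟩ := hP
    exact E.isGorensteinLocalRing_of_e_notMem P i hi

variable {i₀ : ι} {s : S →+* A} {y : ι → A}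

theorem exists_normalForm (hy₀ : y i₀ = 0) {e z : ι → A}
    (hyy : ∀ j c, j ≠ i₀ → c ≠ i₀ → y j * y c = if j = c then e c + e i₀ else e i₀)
    (hey : ∀ j c, c ≠ i₀ → e j * y c = if j = c then e j * z j else
      if j = i₀ then -(e j * z j) else 0)
    (hgen : Function.Surjective (MvPolynomial.eval₂Hom s y)) (x : A) :
    ∃ (a : S) (b : ι → S) (F : ι → S[X]),
      x = s a + ∑ j, s (b j) * y j + ∑ j, e j * (F j).eval₂ s (z j) := by
  let NF (x : A) : Prop := ∃ (a : S) (b : ι → S) (F : ι → S[X]),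
    x = s a + ∑ j, s (b j) * y j + ∑ j, e j * (F j).eval₂ s (z j)
  have nf_add : ∀ x x', NF x → NF x' → NF (x + x') := by
    rintro _ _ ⟨a, b, F, rfl⟩ ⟨a', b', F', rfl⟩
    refine ⟨a + a', b + b', F + F', ?_⟩
    simp only [map_add, Pi.add_apply, eval₂_add, add_mul, mul_add, Finset.sum_add_distrib]
    ring
  have nf_s_mul : ∀ c x, NF x → NF (s c * x) := by
    rintro c _ ⟨a, b, F, rfl⟩
    refine ⟨c * a, fun j => c * b j, fun j => C c * F j, ?_⟩
    simp only [map_mul, eval₂_mul, eval₂_C, mul_add, Finset.mul_sum]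
    congr 1
    · congr 1
      exact Finset.sum_congr rfl fun j _ => by ring
    · exact Finset.sum_congr rfl fun j _ => by ring
  have nf_s : ∀ a, NF (s a) := fun a => ⟨a, 0, 0, by simp⟩
  have nf_zero : NF 0 := by simpa using nf_s 0
  have nf_y : ∀ j, NF (y j) := fun j => ⟨0, Pi.single j 1, 0, by
    simp [Pi.single_apply, apply_ite s]⟩
  have nf_e : ∀ j p, NF (e j * eval₂ s (z j) p) := fun j p => ⟨0, 0, Pi.single j p, by
    simp only [map_zero, Pi.zero_apply, zero_mul, Finset.sum_const_zero, zero_add]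
    rw [Finset.sum_eq_single j (fun b _ hb => by simp [Pi.single_eq_of_ne hb]) (by simp),
      Pi.single_eq_same]⟩
  have nf_sum : ∀ f : ι → A, (∀ j, NF (f j)) → NF (∑ j, f j) := fun f hf =>
    Finset.sum_induction f NF nf_add nf_zero fun j _ => hf j
  have nf_e' : ∀ j, NF (e j) := fun j => by simpa using nf_e j 1
  have nf_mul_y : ∀ c x, NF x → NF (x * y c) := by
    rintro c _ ⟨a, b, F, rfl⟩
    by_cases hc : c = i₀
    · simpa [hc, hy₀] using nf_zero
    simp only [add_mul, Finset.sum_mul]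
    refine nf_add _ _ (nf_add _ _ (nf_s_mul _ _ (nf_y c)) (nf_sum _ fun j => ?_))
      (nf_sum _ fun j => ?_)
    · by_cases hj : j = i₀
      · simpa [hj, hy₀] using nf_zero
      rw [mul_assoc, hyy j c hj hc]
      refine nf_s_mul _ _ ?_
      split_ifs
      exacts [nf_add _ _ (nf_e' _) (nf_e' _), nf_e' _]
    · rw [mul_right_comm, hey j c hc]
      split_ifs
      · have := nf_e j (X * F j)
        rwa [eval₂_mul, eval₂_X, ← mul_assoc] at this
      · have := nf_e j (-(X * F j))
        rwa [eval₂_neg, eval₂_mul, eval₂_X, mul_neg, ← mul_assoc, ← neg_mul] at this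
      · simpa using nf_zero
  obtain ⟨p, rfl⟩ := hgen x
  change NF _
  induction p using MvPolynomial.induction_on with
  | C a => simpa using nf_s a
  | add p p' hp hp' => simpa only [map_add] using nf_add _ _ hp hp'
  | mul_X p c hp => simpa only [map_mul, MvPolynomial.eval₂Hom_X'] using nf_mul_y c _ hp


theorem exists_ne_ne_ne (hι : 4 ≤ Fintype.card ι) (a b c : ι) : ∃ d, d ≠ a ∧ d ≠ b ∧ d ≠ c := by
  by_contra! h
  have : (Finset.univ : Finset ι) ⊆ {a, b, c} := fun d _ => by
    have := h d
    simp only [Finset.mem_insert, Finset.mem_singleton]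
    tauto
  have := (Finset.card_le_card this).trans Finset.card_le_three
  rw [Finset.card_univ] at this
  omega

theorem nonempty_of_relations (hι : 4 ≤ Fintype.card ι) (hy₀ : y i₀ = 0) {w : A}
    (hyw : ∀ a c, a ≠ i₀ → c ≠ i₀ → a ≠ c → y a * y c = w)
    (hgen : Function.Surjective (MvPolynomial.eval₂Hom s y)) (π : ι → A →+* S[X])
    (hπs : ∀ i a, π i (s a) = C a)
    (hπy₀ : ∀ j, j ≠ i₀ → π i₀ (y j) = -X)
    (hπy : ∀ i j, i ≠ i₀ → π i (y j) = if j = i then X else 0) :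
    Nonempty (AxesEmbedding S A ι) := by
  obtain ⟨p, hp, -, -⟩ := exists_ne_ne_ne hι i₀ i₀ i₀
  obtain ⟨p', hp', hpp', -⟩ := exists_ne_ne_ne hι i₀ p p
  have hwy : ∀ a c, a ≠ i₀ → c ≠ i₀ → w * y a = w * y c := by
    intro a c ha hc
    by_cases hac : a = c
    · rw [hac]
    obtain ⟨b, hb, hba, hbc⟩ := exists_ne_ne_ne hι i₀ a c
    calc w * y a = y b * y c * y a := by rw [hyw b c hb hc hbc]
      _ = y b * y a * y c := by ring
      _ = w * y c := by rw [hyw b a hb ha hba]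
  let e : ι → A := fun j => if j = i₀ then w else y j * y j - w
  let z : ι → A := fun j => if j = i₀ then -y p else y j
  have he₀ : e i₀ = w := if_pos rfl
  have he : ∀ j, j ≠ i₀ → e j = y j * y j - w := fun j hj => if_neg hj
  have hz₀ : z i₀ = -y p := if_pos rfl
  have hz : ∀ j, j ≠ i₀ → z j = y j := fun j hj => if_neg hj
  have hπw₀ : π i₀ w = X ^ 2 := by
    rw [← hyw p' p hp' hp hpp', map_mul, hπy₀ _ hp, hπy₀ _ hp']
    ring
  have hπw : ∀ i, i ≠ i₀ → π i w = 0 := by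
    intro i hi
    rw [← hyw p' p hp' hp hpp', map_mul, hπy i _ hi, hπy i _ hi]
    by_cases h : p = i
    · rw [if_neg (h ▸ hpp'), zero_mul]
    · rw [if_neg h, mul_zero]
  have hπe : ∀ i j, π i (e j) = if i = j then X ^ 2 else 0 := by
    intro i j
    by_cases hj : j = i₀
    · subst hj
      rw [he₀]
      split_ifs with h
      exacts [h ▸ hπw₀, hπw i h]
    · rw [he j hj, map_sub, map_mul]
      by_cases hi : i = i₀
      · subst hi
        rw [hπw₀, hπy₀ j hj, if_neg (Ne.symm hj)]
        ring
      · rw [hπw i hi, hπy i j hi, sub_zero]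
        simp only [eq_comm (a := i)]
        split_ifs
        · ring
        · ring
  have hπz : ∀ i, π i (z i) = X := by
    intro i
    by_cases hi : i = i₀
    · subst hi
      rw [hz₀, map_neg, hπy₀ p hp, neg_neg]
    · rw [hz i hi, hπy i i hi, if_pos rfl]
  have hyy : ∀ j c, j ≠ i₀ → c ≠ i₀ → y j * y c = if j = c then e c + e i₀ else e i₀ := by
    intro j c hj hc
    split_ifs with h
    · rw [h, he c hc, he₀, sub_add_cancel]
    · rw [he₀, hyw j c hj hc h]
  have hey : ∀ j c, c ≠ i₀ → e j * y c = if j = c then e j * z j else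
      if j = i₀ then -(e j * z j) else 0 := by
    intro j c hc
    split_ifs with h h'
    · rw [h, hz c hc]
    · rw [h', he₀, hz₀, mul_neg, neg_neg, hwy c p hc hp]
    · rw [he j h', sub_mul, mul_assoc, hyw j c h' hc h, mul_comm, hwy j c h' hc, sub_self]
  have hπlift : ∀ i f, π i (eval₂ s (z i) f) = f := by
    intro i f
    rw [hom_eval₂, hπz, show (π i).comp s = C from RingHom.ext (hπs i), eval₂_C_X]
  have hπNF : ∀ i a (b : ι → S) (F : ι → S[X]),
      π i (s a + ∑ j, s (b j) * y j + ∑ j, e j * (F j).eval₂ s (z j)) =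
        C a + (∑ j, C (b j) * π i (y j)) + X ^ 2 * F i := by
    intro i a b F
    simp only [map_add, map_sum, map_mul, hπs, hπe]
    congr 1
    rw [Finset.sum_eq_single i (fun j _ hj => by rw [if_neg hj.symm, zero_mul]) (by simp),
      if_pos rfl, hπlift]
  have hπlin : ∀ i (b : ι → S), ∑ j, C (b j) * π i (y j) =
      C (if i = i₀ then -∑ j ∈ Finset.univ.erase i₀, b j else b i) * X := by
    intro i b
    split_ifs with hi
    · subst hi
      rw [← Finset.add_sum_erase _ _ (Finset.mem_univ i), hy₀, map_zero, mul_zero, zero_add,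
        map_neg, map_sum, neg_mul, Finset.sum_mul, ← Finset.sum_neg_distrib]
      exact Finset.sum_congr rfl fun j hj => by
        rw [hπy₀ j (Finset.ne_of_mem_erase hj), mul_neg]
    · simp [hπy i _ hi]
  have hNF := exists_normalForm hy₀ hyy hey hgen
  refine ⟨{
    s, π, e, z
    π_s := hπs
    π_e := hπe
    π_z := hπz
    mem_map := ?_
    coeff_zero := ?_
    sum_coeff_one := ?_
    exists_linear := ?_ }⟩
  · intro q x hx
    obtain ⟨a, b, F, rfl⟩ := hNF x
    simp only [hπNF, hπlin] at hx
    refine add_mem (add_mem ?_ (sum_mem fun j _ => ?_)) (sum_mem fun j _ => ?_)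
    · exact Ideal.mem_map_of_mem s (by simpa using hx i₀ 0)
    · by_cases hj : j = i₀
      · simp [hj, hy₀]
      · refine Ideal.mul_mem_right _ _ (Ideal.mem_map_of_mem s ?_)
        simpa [hj, coeff_X_pow_mul'] using hx j 1
    · refine Ideal.mul_mem_left _ _ ?_
      rw [eval₂_eq_sum]
      refine sum_mem fun k _ => Ideal.mul_mem_right _ _ (Ideal.mem_map_of_mem s ?_)
      simpa [coeff_X_pow_mul', coeff_C, coeff_X] using hx j (k + 2)
  · intro x i j
    obtain ⟨a, b, F, rfl⟩ := hNF x
    simp [hπNF, hπlin]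
  · intro x
    obtain ⟨a, b, F, rfl⟩ := hNF x
    have h : ∀ i, (C a + C (if i = i₀ then -∑ j ∈ Finset.univ.erase i₀, b j else b i) * X +
        X ^ 2 * F i).coeff 1 = if i = i₀ then -∑ j ∈ Finset.univ.erase i₀, b j else b i := by
      intro i
      rw [coeff_add, coeff_add, coeff_C_mul, coeff_X_one, coeff_C_succ, coeff_X_pow_mul']
      simp
    simp only [hπNF, hπlin, h]
    rw [← Finset.add_sum_erase _ _ (Finset.mem_univ i₀), if_pos rfl, neg_add_eq_zero]
    exact Finset.sum_congr rfl fun j hj => (if_neg (Finset.ne_of_mem_erase hj)).symm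
  · intro b hb
    refine ⟨s 0 + ∑ j, s (b j) * y j + ∑ j, e j * ((0 : ι → S[X]) j).eval₂ s (z j), fun i => ?_⟩
    rw [hπNF i 0 b 0, hπlin]
    rw [← Finset.add_sum_erase _ _ (Finset.mem_univ i₀), add_eq_zero_iff_eq_neg] at hb
    split_ifs with hi
    · simp only [hi, hb, C_0, zero_add, Pi.zero_apply, mul_zero, add_zero]
    · simp

end AxesEmbedding

end Polynomial

open Finset in
theorem mul_sub_mem_spechtIdeal (K : Type*) [CommRing K] {n : ℕ} {a b c d : Fin n}
    (hab : a ≠ b) (hac : a ≠ c) (had : a ≠ d) (hbc : b ≠ c) (hbd : b ≠ d) (hcd : c ≠ d) :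
    (X a - X b) * (X c - X d) ∈ spechtIdeal K n [n - 2, 2] := by
  let Q : Finset (Fin n) := {a, b, c, d}
  have hQ : #Q = 4 := by simp [Q, *]
  have hn : 4 ≤ n := hQ ▸ card_finset_fin_le Q
  have hcard : Fintype.card {j // j ∉ Q} = n - 4 := by
    rw [Fintype.card_subtype_compl, Fintype.card_fin, Fintype.card_coe, hQ]
  let e : {j // j ∉ Q} ≃ Fin (n - 4) := Fintype.equivFinOfCardEq hcard
  let T : Fin n → ℕ × ℕ := fun j => if j = a then (0, 0) else if j = b then (1, 0) else
    if j = c then (0, 1) else if j = d then (1, 1) else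
    if h : j ∉ Q then (0, 2 + (e ⟨j, h⟩ : ℕ)) else 0
  have hTa : T a = (0, 0) := by simp [T]
  have hTb : T b = (1, 0) := by simp [T, hab.symm]
  have hTc : T c = (0, 1) := by simp [T, hac.symm, hbc.symm]
  have hTd : T d = (1, 1) := by simp [T, had.symm, hbd.symm, hcd.symm]
  have hT : ∀ j (h : j ∉ Q), T j = (0, 2 + (e ⟨j, h⟩ : ℕ)) := by
    intro j h
    have h' := h
    simp only [Q, mem_insert, mem_singleton, not_or] at h'
    simp only [T, h'.1, h'.2.1, h'.2.2.1, h'.2.2.2, if_false, dif_pos h]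
  have hcases : ∀ j, j = a ∨ j = b ∨ j = c ∨ j = d ∨ ∃ h : j ∉ Q, True := by
    intro j
    simp only [Q, mem_insert, mem_singleton, exists_prop, and_true]
    tauto
  have hinj : Function.Injective T := by
    intro i j hij
    rcases hcases i with rfl | rfl | rfl | rfl | ⟨hi, -⟩ <;>
    rcases hcases j with rfl | rfl | rfl | rfl | ⟨hj, -⟩ <;>
    simp_all
    any_goals omega
    simpa using e.injective (Fin.ext hij)
  refine Ideal.subset_span ⟨T, ⟨hinj, fun i => ?_, fun r k hr hk => ?_⟩, ?_⟩
  · rcases hcases i with rfl | rfl | rfl | rfl | ⟨hi, -⟩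
    · simp [hTa]; omega
    · simp [hTb]
    · simp [hTc]; omega
    · simp [hTd]
    · have := (e ⟨i, hi⟩).2
      simp [hT i hi]; omega
  · simp only [List.length_cons, List.length_nil] at hr
    interval_cases r
    · simp only [List.getD_cons_zero] at hk
      match k, hk with
      | 0, _ => exact ⟨a, hTa⟩
      | 1, _ => exact ⟨c, hTc⟩
      | k + 2, hk =>
        obtain ⟨⟨j, hj⟩, hjk⟩ := e.surjective ⟨k, by omega⟩
        exact ⟨j, by rw [hT j hj, hjk, add_comm]⟩
    · simp only [List.getD_cons_succ, List.getD_cons_zero] at hk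
      interval_cases k
      exacts [⟨b, hTb⟩, ⟨d, hTd⟩]
  · have hfilter : univ.filter (fun p : Fin n × Fin n =>
        (T p.1).2 = (T p.2).2 ∧ (T p.1).1 < (T p.2).1) = {(a, b), (c, d)} := by
      ext ⟨i, j⟩
      simp only [mem_filter, mem_univ, true_and, mem_insert, mem_singleton, Prod.mk.injEq]
      constructor
      · rcases hcases i with rfl | rfl | rfl | rfl | ⟨hi, -⟩ <;>
        rcases hcases j with rfl | rfl | rfl | rfl | ⟨hj, -⟩ <;>
        simp_all
        omega
      · rintro (⟨rfl, rfl⟩ | ⟨rfl, rfl⟩) <;> simp [*]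
    rw [spechtPoly, hfilter, prod_pair (by simp [hac])]

theorem map_eq_zero_of_mem_spechtIdeal {K B : Type*} [CommRing K] [CommRing B] {n : ℕ}
    (hn : 4 ≤ n) (φ : MvPolynomial (Fin n) K →+* B) (i : Fin n)
    (hφ : ∀ a b, a ≠ i → b ≠ i → φ (X a) = φ (X b)) {f : MvPolynomial (Fin n) K}
    (hf : f ∈ spechtIdeal K n [n - 2, 2]) : φ f = 0 := by
  suffices spechtIdeal K n [n - 2, 2] ≤ RingHom.ker φ from this hf
  refine Ideal.span_le.mpr ?_
  rintro _ ⟨T, ⟨-, -, hT⟩, rfl⟩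
  obtain ⟨c, hc, hci⟩ : ∃ c < 2, c ≠ (T i).2 := by
    by_cases h : (T i).2 = 0
    exacts [⟨1, one_lt_two, by omega⟩, ⟨0, two_pos, by omega⟩]
  obtain ⟨a, ha⟩ := hT 0 c (by simp) (by simp; omega)
  obtain ⟨b, hb⟩ := hT 1 c (by simp) (by simpa using Nat.le_of_lt_succ hc)
  rw [SetLike.mem_coe, RingHom.mem_ker, spechtPoly, map_prod]
  refine Finset.prod_eq_zero (i := (a, b)) (by simp [ha, hb]) ?_
  rw [map_sub, hφ a b, sub_self]
  · rintro rfl; simp [ha] at hci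
  · rintro rfl; simp [hb] at hci

theorem nonempty_axesEmbedding_spechtIdeal (K : Type*) [CommRing K] {n : ℕ} (hn : 4 ≤ n) :
    Nonempty (Polynomial.AxesEmbedding (Polynomial K)
      (MvPolynomial (Fin n) K ⧸ spechtIdeal K n [n - 2, 2]) (Fin n)) := by
  let I := spechtIdeal K n [n - 2, 2]
  let i₀ : Fin n := ⟨0, by omega⟩
  let x : Fin n → MvPolynomial (Fin n) K ⧸ I := fun j => Ideal.Quotient.mk I (X j)
  let s : Polynomial K →+* MvPolynomial (Fin n) K ⧸ I :=
    Polynomial.eval₂RingHom ((Ideal.Quotient.mk I).comp C) (x i₀)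
  let y : Fin n → MvPolynomial (Fin n) K ⧸ I := fun j => x j - x i₀
  let v : Fin n → Fin n → Polynomial (Polynomial K) := fun i j =>
    if i = i₀ then if j = i₀ then 0 else -Polynomial.X else if j = i then Polynomial.X else 0
  let φ : Fin n → MvPolynomial (Fin n) K →+* Polynomial (Polynomial K) := fun i =>
    eval₂Hom (Polynomial.C.comp Polynomial.C) fun j => Polynomial.C Polynomial.X + v i j
  have hφ : ∀ i, ∀ f ∈ I, φ i f = 0 := by
    refine fun i f hf => map_eq_zero_of_mem_spechtIdeal hn (φ i) i (fun a b ha hb => ?_) hf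
    by_cases hi : i = i₀
    · subst hi
      simp [φ, v, ha, hb]
    · simp [φ, v, ha, hb, hi]
  let π : Fin n → (MvPolynomial (Fin n) K ⧸ I) →+* Polynomial (Polynomial K) := fun i =>
    Ideal.Quotient.lift I (φ i) (hφ i)
  have hπx : ∀ i j, π i (x j) = Polynomial.C Polynomial.X + v i j := by
    intro i j
    simp [π, x, φ]
  have hv : ∀ i, v i i₀ = 0 := by
    intro i
    by_cases hi : i = i₀
    · simp [v, hi]
    · simp [v, hi, Ne.symm hi]
  have hπy : ∀ i j, π i (y j) = v i j := by
    intro i j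
    rw [map_sub, hπx, hπx, hv]
    ring
  have hrel : ∀ a c d, a ≠ i₀ → c ≠ i₀ → d ≠ i₀ → a ≠ c → a ≠ d → y a * y c = y a * y d := by
    intro a c d ha hc hd hac had
    by_cases hcd : c = d
    · rw [hcd]
    rw [← sub_eq_zero]
    have := mul_sub_mem_spechtIdeal K ha hac had hc.symm hd.symm hcd
    rw [← Ideal.Quotient.eq_zero_iff_mem] at this
    rw [← this]
    simp only [map_mul, map_sub]
    ring
  let p : Fin n := ⟨1, by omega⟩
  let p' : Fin n := ⟨2, by omega⟩
  have hp : p ≠ i₀ := by simp [p, i₀]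
  have hp' : p' ≠ i₀ := by simp [p', i₀]
  have hpp' : p ≠ p' := by simp [p, p']
  refine Polynomial.AxesEmbedding.nonempty_of_relations (i₀ := i₀) (s := s) (y := y)
    (by simpa) (sub_self _) (w := y p * y p') ?_ ?_ π ?_ ?_ ?_
  · intro a c ha hc hac
    by_cases hap : a = p
    · subst hap
      exact hrel _ _ _ ha hc hp' hac hpp'
    · rw [hrel a c p ha hc hp hac hap, mul_comm]
      exact hrel _ _ _ hp ha hp' (Ne.symm hap) hpp'
  · intro f
    obtain ⟨f, rfl⟩ := Ideal.Quotient.mk_surjective f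
    induction f using MvPolynomial.induction_on with
    | C a => exact ⟨C (Polynomial.C a), by simp [s, I]⟩
    | add f g hf hg =>
      obtain ⟨f', hf⟩ := hf
      obtain ⟨g', hg⟩ := hg
      exact ⟨f' + g', by rw [map_add, map_add, hf, hg]⟩
    | mul_X f j hf =>
      obtain ⟨f', hf⟩ := hf
      exact ⟨f' * (X j + C Polynomial.X), by rw [map_mul, map_mul, hf]; simp [y, x, s, I]⟩
  · intro i f
    have : (π i).comp s = Polynomial.C := by
      refine Polynomial.ringHom_ext (fun a => ?_) ?_
      · simp [s, π, φ]
      · simp [s, hπx, hv]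
    exact RingHom.congr_fun this f
  · intro j hj
    simp [hπy, v, hj]
  · intro i j hi
    simp [hπy, v, hi]

/-- Proposition 5.2: for every field `K` and every `n ≥ 4`, the ring `R/I^Sp_{(n-2, 2)}`
is Gorenstein. -/
theorem specht_n22_Gorenstein {K : Type*} [Field K] (n : ℕ) (hn : 4 ≤ n) :
    IsGorensteinRing (MvPolynomial (Fin n) K ⧸ spechtIdeal K n [n - 2, 2]) := by
  have : Nonempty (Fin n) := ⟨⟨0, by omega⟩⟩
  obtain ⟨E⟩ := nonempty_axesEmbedding_spechtIdeal K hn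
  exact E.isGorensteinRing
end

section
/- For n ≥ 5, the ring R/I_{n,n−2} is Cohen–Macaulay if and only if char(K) ≠ 2. Consequently, for n ≥ 6 the ring R/I^Sp_{(n−3,3)} is Cohen–Macaulay if and only if char(K) ≠ 2, and the same holds for R/I^Sp_{(2,2,1)} (with n = 5). -/
open MvPolynomial

/-- The ideal `P_F = (x_i - x_j ∣ i, j ∈ F)`. -/
noncomputable def PFIdeal (K : Type*) [CommRing K] {n : ℕ} (F : Finset (Fin n)) :
    Ideal (MvPolynomial (Fin n) K) :=
  Ideal.span {f | ∃ i ∈ F, ∃ j ∈ F, f = X i - X j}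

/-- The ideal `I_{n,k} = ⋂_{F ⊆ [n], #F = k} P_F`. -/
noncomputable def InkIdeal (K : Type*) [CommRing K] (n k : ℕ) :
    Ideal (MvPolynomial (Fin n) K) :=
  ⨅ F ∈ {F : Finset (Fin n) | F.card = k}, PFIdeal K F

open RingTheory.Sequence in
theorem ringDepth_le_of_ringEquiv {A B : Type*} [CommRing A] [CommRing B] (e : A ≃+* B) :
    ringDepth A ≤ ringDepth B := by
  refine iSup_le fun ⟨rs, hrs, hreg⟩ => ?_
  have hmem : ∀ r ∈ rs.map e, r ∈ (⊥ : Ideal B).jacobson := by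
    intro r hr
    obtain ⟨s, hs, rfl⟩ := List.mem_map.mp hr
    rw [Ideal.mem_jacobson_bot]
    intro y
    have := (Ideal.mem_jacobson_bot.mp (hrs s hs) (e.symm y)).map e
    simpa using this
  have hreg' : IsRegular B (rs.map e) :=
    (AddEquiv.isRegular_congr (e := e.toAddEquiv) (List.forall₂_map_right_iff.mpr <|
      List.forall₂_same.mpr fun r _ x => by simp)).mp hreg
  refine le_iSup_of_le ⟨rs.map e, hmem, hreg'⟩ ?_
  simp

theorem ringDepth_congr {A B : Type*} [CommRing A] [CommRing B] (e : A ≃+* B) :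
    ringDepth A = ringDepth B :=
  (ringDepth_le_of_ringEquiv e).antisymm (ringDepth_le_of_ringEquiv e.symm)

open RingTheory.Sequence IsLocalRing in
theorem coe_ringDepth_eq_ringKrullDim {A : Type*} [CommRing A] [IsLocalRing A]
    [IsNoetherianRing A] {rs : List A} (hreg : IsRegular A rs)
    (hdim : ringKrullDim A ≤ rs.length) :
    (ringDepth A : WithBot ℕ∞) = ringKrullDim A := by
  have key : ∀ ts : List A, IsRegular A ts → (ts.length : WithBot ℕ∞) ≤ ringKrullDim A := by
    intro ts hts
    have hne := hts.quot_ofList_smul_nontrivial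
    have h := ringKrullDim_add_length_eq_ringKrullDim_of_isRegular ts hts
    have hn : Nontrivial (A ⧸ Ideal.ofList ts) := by
      rw [Ideal.Quotient.nontrivial_iff]
      intro h
      have := hts.2
      rw [h] at this
      simp at this
    rw [← h]
    exact le_add_of_nonneg_left ringKrullDim_nonneg_of_nontrivial
  have hmem : ∀ r ∈ rs, r ∈ (⊥ : Ideal A).jacobson := by
    rw [jacobson_eq_maximalIdeal _ bot_ne_top]
    intro r hr
    by_contra h
    refine hreg.2 ?_
    have hu : IsUnit r := by simpa using h
    have : Ideal.ofList rs = ⊤ :=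
      Ideal.eq_top_of_isUnit_mem _ (Ideal.subset_span hr) hu
    rw [this]
    simp
  apply le_antisymm
  · have hle : ringKrullDim A ≠ ⊥ := ringKrullDim_ne_bot
    obtain ⟨d, hd⟩ := WithBot.ne_bot_iff_exists.mp hle
    rw [← hd, WithBot.coe_le_coe]
    refine iSup_le fun ⟨ts, _, hts⟩ => ?_
    have := key ts hts
    rw [← hd] at this
    exact_mod_cast this
  · refine hdim.trans ?_
    have : (rs.length : ℕ∞) ≤ ringDepth A :=
      le_iSup_of_le (f := fun rs : {rs : List A // (∀ r ∈ rs, r ∈ (⊥ : Ideal A).jacobson) ∧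
        IsRegular A rs} => (rs.1.length : ℕ∞)) ⟨rs, hmem, hreg⟩ le_rfl
    exact_mod_cast this

theorem IsCohenMacaulayRing.of_ringEquiv {A B : Type*} [CommRing A] [CommRing B] (e : A ≃+* B)
    (h : IsCohenMacaulayRing A) : IsCohenMacaulayRing B := by
  intro P hP
  have hP' : (P.comap (e : A →+* B)).IsPrime := inferInstance
  have h1 := h (P.comap (e : A →+* B))
  let e' : Localization.AtPrime (P.comap (e : A →+* B)) ≃+* Localization.AtPrime P :=
    IsLocalization.ringEquivOfRingEquiv (M := (P.comap (e : A →+* B)).primeCompl)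
      (T := P.primeCompl) _ _ e (by
        ext x
        simp only [Submonoid.mem_map, Ideal.mem_primeCompl_iff, Ideal.mem_comap]
        constructor
        · rintro ⟨y, hy, rfl⟩
          exact hy
        · intro hx
          exact ⟨e.symm x, by simpa using hx, by simp⟩)
  rwa [ringDepth_congr e', ringKrullDim_eq_of_ringEquiv e'] at h1

theorem isCohenMacaulayRing_congr {A B : Type*} [CommRing A] [CommRing B] (e : A ≃+* B) :
    IsCohenMacaulayRing A ↔ IsCohenMacaulayRing B :=
  ⟨.of_ringEquiv e, .of_ringEquiv e.symm⟩

open RingTheory.Sequence IsLocalRing Polynomial in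
theorem exists_isWeaklyRegular_polynomial {L : Type*} [CommRing L] [IsLocalRing L]
    [IsNoetherianRing L] {rs : List L} (hmem : ∀ r ∈ rs, r ∈ maximalIdeal L)
    (hreg : IsWeaklyRegular L rs) (hdim : (maximalIdeal L).height ≤ rs.length)
    (P : Ideal L[X]) [P.IsPrime] (hP : P.comap Polynomial.C = maximalIdeal L) :
    ∃ ts : List L[X], (∀ t ∈ ts, t ∈ P) ∧ IsWeaklyRegular L[X] ts ∧ P.height ≤ ts.length := by
  have hreg' : IsWeaklyRegular L[X] (rs.map (algebraMap L L[X])) := hreg.of_flat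
  have hmem' : ∀ t ∈ rs.map (algebraMap L L[X]), t ∈ P := by
    intro t ht
    obtain ⟨r, hr, rfl⟩ := List.mem_map.mp ht
    have := hmem r hr
    rwa [← hP, Ideal.mem_comap] at this
  have hle : (maximalIdeal L).map Polynomial.C ≤ P := by
    rw [Ideal.map_le_iff_le_comap, hP]
  by_cases hPm : P ≤ (maximalIdeal L).map Polynomial.C
  · refine ⟨_, hmem', hreg', ?_⟩
    rw [le_antisymm hPm hle, height_map_C]
    simpa using hdim
  · obtain ⟨f, hfP, hf⟩ := SetLike.not_le_iff_exists.mp hPm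
    refine ⟨rs.map (algebraMap L L[X]) ++ [f], ?_, ?_, ?_⟩
    · intro t ht
      rcases List.mem_append.mp ht with h | h
      · exact hmem' t h
      · rw [List.mem_singleton.mp h]
        exact hfP
    · rw [isWeaklyRegular_append_iff]
      refine ⟨hreg', ?_⟩
      rw [isWeaklyRegular_singleton_iff, isSMulRegular_quotient_iff_mem_of_smul_mem]
      rw [← Ideal.map_ofList]
      intro x hx
      have hx : f * x ∈ (Ideal.ofList rs).map (Polynomial.C : L →+* L[X]) := by simpa using hx
      suffices x ∈ (Ideal.ofList rs).map (Polynomial.C : L →+* L[X]) by simpa using this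
      let φ : L[X] →+* (L ⧸ Ideal.ofList rs)[X] := mapRingHom (Ideal.Quotient.mk _)
      have hφ : ∀ g, g ∈ (Ideal.ofList rs).map (Polynomial.C : L →+* L[X]) ↔ φ g = 0 := by
        intro g
        rw [Ideal.mem_map_C_iff, Polynomial.ext_iff]
        simp [φ, Polynomial.coeff_map, Ideal.Quotient.eq_zero_iff_mem]
      rw [hφ] at hx ⊢
      rw [map_mul] at hx
      have hnz : φ f ∈ nonZeroDivisors _ := by
        rw [Polynomial.mem_nonZeroDivisors_iff]
        intro a ha
        rw [Ideal.mem_map_C_iff] at hf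
        push Not at hf
        obtain ⟨k, hk⟩ := hf
        have hu : IsUnit (f.coeff k) := by simpa using hk
        have h1 := congrArg (fun p => Polynomial.coeff p k) ha
        simp only [Polynomial.coeff_smul, Polynomial.coeff_zero, smul_eq_mul, φ, coe_mapRingHom, Polynomial.coeff_map] at h1
        exact (hu.map (Ideal.Quotient.mk (Ideal.ofList rs))).mul_left_eq_zero.mp h1
      exact (mul_right_mem_nonZeroDivisors_eq_zero_iff hnz).mp (by rwa [mul_comm])
    · have h1 : (P.height : WithBot ℕ∞) ≤ ringKrullDim L[X] :=
        Ideal.height_le_ringKrullDim_of_ne_top Ideal.IsPrime.ne_top'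
      rw [Polynomial.ringKrullDim_of_isNoetherianRing, ← maximalIdeal_height_eq_ringKrullDim] at h1
      have h2 : P.height ≤ (maximalIdeal L).height + 1 := by exact_mod_cast h1
      refine h2.trans ?_
      simp only [List.length_append, List.length_map, List.length_singleton, Nat.cast_add,
        Nat.cast_one]
      gcongr

attribute [local instance] Polynomial.algebra Polynomial.isLocalization in
open RingTheory.Sequence IsLocalRing Polynomial in
/-- If every prime of a Noetherian ring `S` contains a weakly regular sequence of length at least
its height, then `S[X]` is Cohen-Macaulay. -/
theorem isCohenMacaulayRing_polynomial {S : Type*} [CommRing S] [IsNoetherianRing S]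
    (H : ∀ q : Ideal S, q.IsPrime → ∃ rs : List S, (∀ r ∈ rs, r ∈ q) ∧ IsWeaklyRegular S rs ∧
      q.height ≤ rs.length) : IsCohenMacaulayRing S[X] := by
  intro p hp
  let q := p.comap Polynomial.C
  obtain ⟨rs, hmem, hreg, hht⟩ := H q inferInstance
  let L := Localization.AtPrime q
  let pc := Submonoid.map Polynomial.C.toMonoidHom q.primeCompl
  let _ : Algebra S[X] L[X] := Polynomial.algebra S L
  have : IsLocalization pc L[X] := Polynomial.isLocalization _ _
  let pS := p.map (algebraMap S[X] L[X])
  have disj : Disjoint (pc : Set S[X]) (p : Set S[X]) := by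
    simpa [pc, q] using! Set.disjoint_image_left.mpr
      (Set.disjoint_compl_left_iff_subset.mpr (fun _ a ↦ a))
  have : pS.IsPrime := IsLocalization.isPrime_of_isPrime_disjoint pc _ _ ‹_› disj
  have : IsLocalization.AtPrime (Localization.AtPrime pS) p := by
    convert IsLocalization.isLocalization_isLocalization_atPrime_isLocalization pc
      (Localization.AtPrime pS) pS
    exact (IsLocalization.under_map_of_isPrime_disjoint pc _ ‹_› disj).symm
  have eq : Ideal.comap Polynomial.C pS = maximalIdeal L := by
    rw [← IsLocalization.map_under q.primeCompl _ (Ideal.comap Polynomial.C pS),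
      ← IsLocalization.map_under q.primeCompl _ (maximalIdeal L)]
    simp only [Ideal.comap_comap, pS]
    rw [← Polynomial.algebraMap_eq (R := L),
      ← IsScalarTower.algebraMap_eq S L L[X],
      IsScalarTower.algebraMap_eq S S[X] L[X], ← Ideal.comap_comap,
      ← Ideal.under_def S[X], IsLocalization.under_map_of_isPrime_disjoint pc _ ‹_› disj]
    simp [q, L, IsLocalization.AtPrime.under_maximalIdeal L q]
  let e : Localization.AtPrime pS ≃+* Localization.AtPrime p := (IsLocalization.algEquiv p.primeCompl
    (Localization.AtPrime pS) (Localization.AtPrime p)).toRingEquiv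
  rw [← ringDepth_congr (A := Localization.AtPrime pS) (B := Localization.AtPrime p) e,
    ← ringKrullDim_eq_of_ringEquiv (R := Localization.AtPrime pS) (S := Localization.AtPrime p) e]
  have hL : IsWeaklyRegular L (rs.map (algebraMap S L)) := hreg.of_isLocalization L q.primeCompl
  have hmL : ∀ r ∈ rs.map (algebraMap S L), r ∈ maximalIdeal L := by
    intro t ht
    obtain ⟨r, hr, rfl⟩ := List.mem_map.mp ht
    rw [IsLocalization.AtPrime.to_map_mem_maximal_iff L q]
    exact hmem r hr
  have hd : (maximalIdeal L).height ≤ (rs.map (algebraMap S L)).length := by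
    have : ((maximalIdeal L).height : WithBot ℕ∞) = q.height := by
      rw [maximalIdeal_height_eq_ringKrullDim, IsLocalization.AtPrime.ringKrullDim_eq_height q L]
    have : (maximalIdeal L).height = q.height := by exact_mod_cast this
    rw [this]
    simpa using hht
  obtain ⟨ts, ht, hts, hlen⟩ := exists_isWeaklyRegular_polynomial hmL hL hd pS eq
  have hreg' := hts.isRegular_of_isLocalization_of_mem (Localization.AtPrime pS) pS ht
  refine coe_ringDepth_eq_ringKrullDim hreg' ?_
  rw [IsLocalization.AtPrime.ringKrullDim_eq_height pS (Localization.AtPrime pS)]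
  simp only [List.length_map]
  exact_mod_cast hlen

section Setup

variable (K : Type*) [Field K] {n : ℕ}

/-- The `K`-algebra endomorphism setting the variables outside `s` to zero. -/
noncomputable def restrictVars (s : Finset (Fin n)) :
    MvPolynomial (Fin n) K →ₐ[K] MvPolynomial (Fin n) K :=
  aeval fun k => if k ∈ s then X k else 0

@[simp]
theorem restrictVars_X (s : Finset (Fin n)) (k : Fin n) :
    restrictVars K s (X k) = if k ∈ s then X k else 0 := by
  simp [restrictVars]

theorem restrictVars_restrictVars (s t : Finset (Fin n)) (f : MvPolynomial (Fin n) K) :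
    restrictVars K s (restrictVars K t f) = restrictVars K (s ∩ t) f := by
  have : (restrictVars K s).comp (restrictVars K t) = restrictVars K (s ∩ t) := by
    ext k : 1
    by_cases h : k ∈ t <;> by_cases h' : k ∈ s <;> simp [h, h']
  exact DFunLike.congr_fun this f

theorem coeff_restrictVars (s : Finset (Fin n)) (m : Fin n →₀ ℕ) (f : MvPolynomial (Fin n) K) :
    coeff m (restrictVars K s f) = if m.support ⊆ s then coeff m f else 0 := by
  classical
  induction f using MvPolynomial.induction_on' with
  | monomial u a =>
    have h : restrictVars K s (monomial u a) = if u.support ⊆ s then monomial u a else 0 := by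
      rw [restrictVars, aeval_monomial]
      split_ifs with h
      · rw [monomial_eq]
        congr 1
        refine Finset.prod_congr rfl fun k hk => ?_
        simp [h hk]
      · obtain ⟨k, hk, hks⟩ := Finset.not_subset.mp h
        rw [Finsupp.prod, Finset.prod_eq_zero hk, mul_zero]
        rw [if_neg hks, zero_pow (Finsupp.mem_support_iff.mp hk)]
    rw [h]
    by_cases hum : u = m
    · subst hum
      split_ifs <;> simp
    · split_ifs <;> simp [coeff_monomial, hum]
  | add p q hp hq =>
    simp only [map_add, coeff_add, hp, hq]
    split_ifs <;> simp

variable (n) in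
/-- The polynomials vanishing on all coordinate planes. -/
noncomputable def planesIdeal : Ideal (MvPolynomial (Fin n) K) :=
  ⨅ e ∈ {e : Finset (Fin n) | e.card = 2}, RingHom.ker (restrictVars K e)

variable {K}

theorem mem_planesIdeal {f : MvPolynomial (Fin n) K} :
    f ∈ planesIdeal K n ↔ ∀ e : Finset (Fin n), e.card = 2 → restrictVars K e f = 0 := by
  simp [planesIdeal, Submodule.mem_iInf, RingHom.mem_ker]

theorem planesIdeal_le (hn : 2 ≤ n) {A : Ideal (MvPolynomial (Fin n) K)}
    (hA : ∀ a b c : Fin n, a ≠ b → a ≠ c → b ≠ c → X a * X b * X c ∈ A) :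
    planesIdeal K n ≤ A := by
  classical
  intro f hf
  rw [f.as_sum]
  refine Ideal.sum_mem _ fun m hm => ?_
  have hcard : 2 < m.support.card := by
    by_contra! h
    obtain ⟨e, he, hec⟩ := Finset.exists_superset_card_eq h (by simpa using hn)
    have h0 := congrArg (coeff m) (mem_planesIdeal.mp hf e hec)
    rw [coeff_restrictVars, if_pos he, coeff_zero] at h0
    exact (mem_support_iff.mp hm) h0
  obtain ⟨a, b, c, ha, hb, hc, hab, hac, hbc⟩ := Finset.two_lt_card_iff.mp hcard
  set t : Fin n →₀ ℕ := Finsupp.single a 1 + Finsupp.single b 1 + Finsupp.single c 1 with ht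
  have htm : t ≤ m := by
    intro k
    have ha' := Finsupp.mem_support_iff.mp ha
    have hb' := Finsupp.mem_support_iff.mp hb
    have hc' := Finsupp.mem_support_iff.mp hc
    simp only [ht, Finsupp.coe_add, Pi.add_apply, Finsupp.single_apply]
    by_cases h1 : a = k
    · subst h1; simp [hab.symm, hac.symm]; omega
    by_cases h2 : b = k
    · subst h2; simp [h1, hbc.symm]; omega
    by_cases h3 : c = k
    · subst h3; simp [h1, h2]; omega
    simp [h1, h2, h3]
  have : monomial m (coeff m f) = monomial (m - t) (coeff m f) * (X a * X b * X c) := by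
    simp only [X, monomial_mul, mul_one]
    rw [← ht, tsub_add_cancel_of_le htm]
  rw [this]
  exact Ideal.mul_mem_left _ _ (hA a b c hab hac hbc)

theorem X_mul_X_mul_X_mem_planesIdeal {a b c : Fin n} (hab : a ≠ b) (hac : a ≠ c) (hbc : b ≠ c) :
    (X a * X b * X c : MvPolynomial (Fin n) K) ∈ planesIdeal K n := by
  classical
  rw [mem_planesIdeal]
  intro e he
  by_contra h
  simp only [map_mul, restrictVars_X, mul_eq_zero, ite_eq_right_iff, X_ne_zero, imp_false,
    not_or, not_not] at h
  have : ({a, b, c} : Finset (Fin n)) ⊆ e := by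
    intro k hk
    simp only [Finset.mem_insert, Finset.mem_singleton] at hk
    rcases hk with rfl | rfl | rfl
    exacts [h.1.1, h.1.2, h.2]
  have := Finset.card_le_card this
  rw [Finset.card_eq_three.mpr ⟨a, b, c, hab, hac, hbc, rfl⟩] at this
  omega

variable (K)

/-- Subtract the variable indexed by `o` from all variables. -/
noncomputable def subVar (o : Fin n) : MvPolynomial (Fin n) K →ₐ[K] MvPolynomial (Fin n) K :=
  aeval fun k => X k - X o

@[simp]
theorem subVar_X (o k : Fin n) : subVar K o (X k) = X k - X o := by
  simp [subVar]

/-- Translate the differences with the variable indexed by `o` by a new variable. -/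
noncomputable def shiftVar (o : Fin n) :
    MvPolynomial (Fin n) K →ₐ[K] Polynomial (MvPolynomial (Fin n) K) :=
  aeval fun k => Polynomial.C (X k - X o) + Polynomial.X

@[simp]
theorem shiftVar_X (o k : Fin n) :
    shiftVar K o (X k) = Polynomial.C (X k - X o) + Polynomial.X := by
  simp [shiftVar]

theorem shiftVar_sub (o a b : Fin n) :
    shiftVar K o (X a - X b) = Polynomial.C (X a - X b) := by
  rw [map_sub, shiftVar_X, shiftVar_X, add_sub_add_right_eq_sub, ← map_sub, sub_sub_sub_cancel_right]

/-- Identify all the variables indexed by `F` with the one indexed by `f`. -/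
noncomputable def collapseVars (F : Finset (Fin n)) (f : Fin n) :
    MvPolynomial (Fin n) K →ₐ[K] MvPolynomial (Fin n) K :=
  aeval fun k => if k ∈ F then X f else X k

@[simp]
theorem collapseVars_X (F : Finset (Fin n)) (f k : Fin n) :
    collapseVars K F f (X k) = if k ∈ F then X f else X k := by
  simp [collapseVars]

variable {K}

theorem sub_mem_PFIdeal {F : Finset (Fin n)} {a b : Fin n} (ha : a ∈ F) (hb : b ∈ F) :
    (X a - X b : MvPolynomial (Fin n) K) ∈ PFIdeal K F :=
  Ideal.subset_span ⟨a, ha, b, hb, rfl⟩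

theorem mem_PFIdeal_iff {F : Finset (Fin n)} {f : Fin n} (hf : f ∈ F)
    {p : MvPolynomial (Fin n) K} : p ∈ PFIdeal K F ↔ collapseVars K F f p = 0 := by
  constructor
  · intro hp
    have : PFIdeal K F ≤ RingHom.ker (collapseVars K F f) := by
      refine Ideal.span_le.mpr ?_
      rintro _ ⟨i, hi, j, hj, rfl⟩
      simp [RingHom.mem_ker, hi, hj]
    exact this hp
  · intro hp
    have : (Ideal.Quotient.mkₐ K (PFIdeal K F)).comp (collapseVars K F f) =
        Ideal.Quotient.mkₐ K (PFIdeal K F) := by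
      ext k : 1
      simp only [AlgHom.comp_apply, collapseVars_X, Ideal.Quotient.mkₐ_eq_mk]
      split_ifs with h
      · exact Ideal.Quotient.eq.mpr (sub_mem_PFIdeal hf h)
      · rfl
    have h := DFunLike.congr_fun this p
    rw [AlgHom.comp_apply, hp, map_zero] at h
    exact Ideal.Quotient.eq_zero_iff_mem.mp h.symm

theorem PFIdeal_eq_ker {F : Finset (Fin n)} {f : Fin n} (hf : f ∈ F) :
    PFIdeal K F = RingHom.ker (collapseVars K F f) := by
  ext p
  rw [mem_PFIdeal_iff hf, RingHom.mem_ker]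

theorem PFIdeal_isPrime {F : Finset (Fin n)} (hF : F.Nonempty) : (PFIdeal K F).IsPrime := by
  obtain ⟨f, hf⟩ := hF
  rw [PFIdeal_eq_ker hf]
  exact RingHom.ker_isPrime _

theorem sub_mem_PFIdeal_iff {F : Finset (Fin n)} (hF : F.Nonempty) {a b : Fin n} (hab : a ≠ b) :
    (X a - X b : MvPolynomial (Fin n) K) ∈ PFIdeal K F ↔ a ∈ F ∧ b ∈ F := by
  obtain ⟨f, hf⟩ := hF
  refine ⟨fun h => ?_, fun h => sub_mem_PFIdeal h.1 h.2⟩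
  rw [mem_PFIdeal_iff hf] at h
  by_contra hc
  simp only [map_sub, collapseVars_X, sub_eq_zero] at h
  split_ifs at h with h1 h2 h2
  · exact hc ⟨h1, h2⟩
  · exact h2 (X_injective h ▸ hf)
  · exact h1 (X_injective h ▸ hf)
  · exact hab (X_injective h)

theorem mem_PFIdeal_compl_iff (o : Fin n) {e : Finset (Fin n)} (he : eᶜ.Nonempty)
    {p : MvPolynomial (Fin n) K} :
    p ∈ PFIdeal K eᶜ ↔
      (shiftVar K o p).map
        (restrictVars K e : MvPolynomial (Fin n) K →+* MvPolynomial (Fin n) K) = 0 := by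
  classical
  obtain ⟨f, hf⟩ := he
  have hfe : f ∉ e := by simpa using hf
  constructor
  · intro hp
    have : PFIdeal K eᶜ ≤ RingHom.ker ((Polynomial.mapRingHom
        (restrictVars K e : MvPolynomial (Fin n) K →+* MvPolynomial (Fin n) K)).comp
        (shiftVar K o : MvPolynomial (Fin n) K →+* _)) := by
      refine Ideal.span_le.mpr ?_
      rintro _ ⟨i, hi, j, hj, rfl⟩
      rw [Finset.mem_compl] at hi hj
      simp [RingHom.mem_ker, hi, hj]
    exact this hp
  · intro hp
    rw [mem_PFIdeal_iff hf]
    let ψ : Polynomial (MvPolynomial (Fin n) K) →ₐ[K] MvPolynomial (Fin n) K :=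
      Polynomial.eval₂AlgHom (aeval fun k => X k - X f) (if o ∈ e then X o else X f)
        (fun _ => Commute.all _ _)
    have : (ψ.comp (Polynomial.mapAlgHom (restrictVars K e))).comp (shiftVar K o) =
        collapseVars K eᶜ f := by
      ext k : 1
      simp only [AlgHom.comp_apply, shiftVar_X, Polynomial.coe_mapAlgHom,
        Polynomial.map_X, Polynomial.map_C, map_add, ψ, Polynomial.eval₂AlgHom_apply,
        Polynomial.eval₂_C, Polynomial.eval₂_X, RingHom.coe_coe, map_sub,
        restrictVars_X, collapseVars_X, Finset.mem_compl]
      by_cases h1 : k ∈ e <;> by_cases h2 : o ∈ e <;> simp [h1, h2]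
    rw [← this]
    simp only [AlgHom.comp_apply, Polynomial.coe_mapAlgHom]
    erw [hp]
    simp

theorem mem_InkIdeal_iff (hn : 2 ≤ n) {p : MvPolynomial (Fin n) K} :
    p ∈ InkIdeal K n (n - 2) ↔ ∀ e : Finset (Fin n), e.card = 2 → p ∈ PFIdeal K eᶜ := by
  simp only [InkIdeal, Submodule.mem_iInf, Set.mem_ofPred_eq]
  constructor
  · intro h e he
    exact h _ (by simp [Finset.card_compl, he])
  · intro h F hF
    rw [← compl_compl F]
    refine h _ ?_
    rw [Finset.card_compl, hF, Fintype.card_fin]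
    omega

theorem mem_InkIdeal_iff_coeff (hn : 3 ≤ n) (o : Fin n) {p : MvPolynomial (Fin n) K} :
    p ∈ InkIdeal K n (n - 2) ↔ ∀ d, (shiftVar K o p).coeff d ∈ planesIdeal K n := by
  rw [mem_InkIdeal_iff (by omega)]
  have he : ∀ e : Finset (Fin n), e.card = 2 → eᶜ.Nonempty := by
    intro e he
    rw [← Finset.card_pos, Finset.card_compl, he, Fintype.card_fin]
    omega
  constructor
  · intro h d
    rw [mem_planesIdeal]
    intro e hec
    have := (mem_PFIdeal_compl_iff o (he e hec)).mp (h e hec)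
    have := congrArg (fun q => Polynomial.coeff q d) this
    simpa using this
  · intro h e hec
    rw [mem_PFIdeal_compl_iff o (he e hec)]
    ext1 d
    simpa using mem_planesIdeal.mp (h d) e hec

end Setup

theorem exists_fin_notMem {n : ℕ} {s : Finset (Fin n)} (h : s.card < n) : ∃ l, l ∉ s := by
  by_contra! hc
  rw [Finset.eq_univ_iff_forall.mpr hc, Finset.card_univ, Fintype.card_fin] at h
  exact lt_irrefl _ h

theorem exists_fin_ne_two {n : ℕ} (hn : 3 ≤ n) (a b : Fin n) : ∃ l, l ≠ a ∧ l ≠ b := by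
  obtain ⟨l, hl⟩ := exists_fin_notMem (s := {a, b}) (Finset.card_le_two.trans_lt hn)
  simp only [Finset.mem_insert, Finset.mem_singleton, not_or] at hl
  exact ⟨l, hl⟩

theorem exists_fin_ne_three {n : ℕ} (hn : 4 ≤ n) (a b c : Fin n) :
    ∃ l, l ≠ a ∧ l ≠ b ∧ l ≠ c := by
  obtain ⟨l, hl⟩ := exists_fin_notMem (s := {a, b, c}) (Finset.card_le_three.trans_lt hn)
  simp only [Finset.mem_insert, Finset.mem_singleton, not_or] at hl
  exact ⟨l, hl⟩

theorem exists_fin_ne_four {n : ℕ} (hn : 5 ≤ n) (a b c d : Fin n) :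
    ∃ l, l ≠ a ∧ l ≠ b ∧ l ≠ c ∧ l ≠ d := by
  obtain ⟨l, hl⟩ := exists_fin_notMem (s := {a, b, c, d}) (Finset.card_le_four.trans_lt hn)
  simp only [Finset.mem_insert, Finset.mem_singleton, not_or] at hl
  exact ⟨l, hl⟩

section DifferenceSubalgebra

variable {K : Type*} [Field K] {n : ℕ} {A : Type*} [CommRing A] [Algebra K A] {y : Fin n → A}
  {T : Subalgebra K A}

theorem sq_mul_sub_mem (hn : 5 ≤ n) (hy : ∀ a b c, a ≠ b → a ≠ c → b ≠ c → y a * y b * y c = 0)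
    (hT : ∀ i j, y i - y j ∈ T) {i m m' : Fin n} (hm : m ≠ i) (hm' : m' ≠ i) :
    y i ^ 2 * (y m - y m') ∈ T := by
  rcases eq_or_ne m m' with rfl | hmm
  · simp
  obtain ⟨k, hki, hkm, hkm'⟩ := exists_fin_ne_three (by omega) i m m'
  obtain ⟨l, hli, hlm, hlm', hlk⟩ := exists_fin_ne_four hn i m m' k
  have h : y i ^ 2 * (y m - y m') = (y i - y k) * (y i - y l) * (y i - y m') -
      (y i - y k) * (y i - y l) * (y i - y m) := by
    linear_combination hy i k m' hki.symm hm'.symm hkm' * (-1) + hy i l m' hli.symm hm'.symm hlm' * (-1)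
      + hy k l m' hlk.symm hkm' hlm' + hy i k m hki.symm hm.symm hkm + hy i l m hli.symm hm.symm hlm
      - hy k l m hlk.symm hkm hlm
  rw [h]
  exact T.sub_mem (T.mul_mem (T.mul_mem (hT _ _) (hT _ _)) (hT _ _))
    (T.mul_mem (T.mul_mem (hT _ _) (hT _ _)) (hT _ _))

theorem pow_mul_sub_mem (hn : 5 ≤ n) (hy : ∀ a b c, a ≠ b → a ≠ c → b ≠ c → y a * y b * y c = 0)
    (hT : ∀ i j, y i - y j ∈ T) {i m m' : Fin n} (hm : m ≠ i) (hm' : m' ≠ i) (a : ℕ) :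
    y i ^ (a + 2) * (y m - y m') ∈ T := by
  induction a with
  | zero => exact sq_mul_sub_mem hn hy hT hm hm'
  | succ a ih =>
    obtain ⟨l, hli, hlm, hlm'⟩ := exists_fin_ne_three (by omega) i m m'
    have h : y i ^ (a + 1 + 2) * (y m - y m') = y i ^ (a + 2) * (y m - y m') * (y i - y l) := by
      linear_combination y i ^ (a + 1) * (hy i m l hm.symm hli.symm hlm.symm -
        hy i m' l hm'.symm hli.symm hlm'.symm)
    rw [h]
    exact T.mul_mem ih (hT _ _)

theorem pow_mul_pow_mem (hn : 5 ≤ n) (hy : ∀ a b c, a ≠ b → a ≠ c → b ≠ c → y a * y b * y c = 0)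
    (hT : ∀ i j, y i - y j ∈ T) {i k : Fin n} (hik : i ≠ k) (a b : ℕ) :
    y i ^ (a + 2) * y k ^ (b + 2) ∈ T := by
  induction a with
  | zero =>
    induction b with
    | zero =>
      obtain ⟨l, hli, hlk⟩ := exists_fin_ne_two (by omega) i k
      obtain ⟨m, hmi, hmk, hml⟩ := exists_fin_ne_three (by omega) i k l
      have h : y i ^ (0 + 2) * y k ^ (0 + 2) = y i ^ 2 * (y k - y m) * (y k - y l) := by
        linear_combination y i * (hy i k l hik hli.symm hlk.symm + hy i k m hik hmi.symm hmk.symm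
          - hy i l m hli.symm hmi.symm hml.symm)
      rw [h]
      exact T.mul_mem (sq_mul_sub_mem hn hy hT hik.symm hmi) (hT _ _)
    | succ b ih =>
      obtain ⟨l, hli, hlk⟩ := exists_fin_ne_two (by omega) i k
      have h : y i ^ (0 + 2) * y k ^ (b + 1 + 2) =
          y i ^ (0 + 2) * y k ^ (b + 2) * (y k - y l) := by
        linear_combination y i * y k ^ (b + 1) * hy i k l hik hli.symm hlk.symm
      rw [h]
      exact T.mul_mem ih (hT _ _)
  | succ a ih =>
    obtain ⟨l, hli, hlk⟩ := exists_fin_ne_two (by omega) i k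
    have h : y i ^ (a + 1 + 2) * y k ^ (b + 2) =
        y i ^ (a + 2) * y k ^ (b + 2) * (y i - y l) := by
      linear_combination y i ^ (a + 1) * y k ^ (b + 1) * hy i k l hik hli.symm hlk.symm
    rw [h]
    exact T.mul_mem ih (hT _ _)

theorem pow_sub_mem (hn : 5 ≤ n) (hy : ∀ a b c, a ≠ b → a ≠ c → b ≠ c → y a * y b * y c = 0)
    (hT : ∀ i j, y i - y j ∈ T) {i k : Fin n} (hik : i ≠ k) (d : ℕ) :
    y i ^ (d + 3) - (d + 3 : ℕ) * (y i ^ (d + 2) * y k) ∈ T := by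
  induction d with
  | zero =>
    obtain ⟨l, hli, hlk⟩ := exists_fin_ne_two (by omega) i k
    obtain ⟨m, hmi, hmk, hml⟩ := exists_fin_ne_three (by omega) i k l
    have h : y i ^ (0 + 3) - (0 + 3 : ℕ) * (y i ^ (0 + 2) * y k) =
        (y i - y k) * (y i - y l) * (y i - y m) + y i ^ 2 * (y l - y k) +
        y i ^ 2 * (y m - y k) := by
      push_cast
      linear_combination hy k l m hlk.symm hmk.symm hml.symm - hy i k l hik hli.symm hlk.symm
        - hy i k m hik hmi.symm hmk.symm - hy i l m hli.symm hmi.symm hml.symm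
    rw [h]
    exact T.add_mem (T.add_mem (T.mul_mem (T.mul_mem (hT _ _) (hT _ _)) (hT _ _))
      (sq_mul_sub_mem hn hy hT hli hik.symm)) (sq_mul_sub_mem hn hy hT hmi hik.symm)
  | succ d ih =>
    have h : y i ^ (d + 1 + 3) - (d + 1 + 3 : ℕ) * (y i ^ (d + 1 + 2) * y k) =
        (y i ^ (d + 3) - (d + 3 : ℕ) * (y i ^ (d + 2) * y k)) * (y i - y k) -
        (d + 3 : ℕ) * (y i ^ (d + 2) * y k ^ (0 + 2)) := by
      push_cast
      ring
    rw [h]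
    exact T.sub_mem (T.mul_mem ih (hT _ _))
      (T.mul_mem (natCast_mem T _) (pow_mul_pow_mem hn hy hT hik d 0))

/-- The complement of the subalgebra generated by the differences of the axes' coordinates. -/
noncomputable def axisPart (K : Type*) [Field K] {n : ℕ} {A : Type*} [CommRing A] [Algebra K A]
    (y : Fin n → A) (o : Fin n) (κ : Fin n → Fin n) :
    K × (Fin n → K) × (Fin n → Polynomial K) →ₗ[K] A where
  toFun p := p.1 • y o + ∑ i, (p.2.1 i • y i ^ 2 +
    Polynomial.aeval (y i) (p.2.2 i) * y i ^ 2 * y (κ i))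
  map_add' p q := by
    simp only [Prod.fst_add, Prod.snd_add, Pi.add_apply, map_add, add_smul, add_mul,
      Finset.sum_add_distrib]
    abel
  map_smul' c p := by
    simp only [Prod.smul_fst, Prod.smul_snd, Pi.smul_apply, map_smul, smul_eq_mul, mul_smul,
      smul_mul_assoc, smul_add, Finset.smul_sum, RingHom.id_apply]

theorem axisPart_apply (y : Fin n → A) (o : Fin n) (κ : Fin n → Fin n)
    (p : K × (Fin n → K) × (Fin n → Polynomial K)) :
    axisPart K y o κ p = p.1 • y o + ∑ i, (p.2.1 i • y i ^ 2 +
      Polynomial.aeval (y i) (p.2.2 i) * y i ^ 2 * y (κ i)) := rfl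

theorem pow_mul_pow_mem_sup (h2 : (2 : K) ≠ 0) (hn : 5 ≤ n)
    (hy : ∀ a b c, a ≠ b → a ≠ c → b ≠ c → y a * y b * y c = 0)
    (hT : ∀ i j, y i - y j ∈ T) (o : Fin n) {κ : Fin n → Fin n} (hκ : ∀ i, κ i ≠ i)
    {i j : Fin n} (hij : i ≠ j) (a b : ℕ) :
    y i ^ a * y j ^ b ∈
      Subalgebra.toSubmodule T ⊔ LinearMap.range (axisPart K y o κ) := by
  set N := Subalgebra.toSubmodule T ⊔ LinearMap.range (axisPart K y o κ)
  have hTN : ∀ {x}, x ∈ T → x ∈ N := fun hx => Submodule.mem_sup_left hx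
  have ho : y o ∈ N := Submodule.mem_sup_right ⟨(1, 0, 0), by simp [axisPart_apply]⟩
  have hsq : ∀ i, y i ^ 2 ∈ N := fun i =>
    Submodule.mem_sup_right ⟨(0, Pi.single i 1, 0), by
      simp [axisPart_apply, Pi.single_apply, ite_smul]⟩
  have hax : ∀ i d, y i ^ (d + 2) * y (κ i) ∈ N := fun i d =>
    Submodule.mem_sup_right ⟨(0, 0, Pi.single i (Polynomial.X ^ d)), by
      simp only [axisPart_apply, Pi.zero_apply, zero_smul, zero_add]
      rw [Finset.sum_eq_single i]
      · simp [pow_add]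
      · intro j _ hj
        simp [Pi.single_eq_of_ne hj]
      · simp⟩
  have hax' : ∀ {i k} d, i ≠ k → y i ^ (d + 2) * y k ∈ N := by
    intro i k d hik
    have := N.add_mem (hTN (pow_mul_sub_mem hn hy hT hik.symm (hκ i) d)) (hax i d)
    convert this using 1
    ring
  have hpow : ∀ i d, y i ^ d ∈ N := by
    intro i d
    match d with
    | 0 => simpa using hTN T.one_mem
    | 1 =>
      have := N.add_mem (hTN (hT i o)) ho
      simpa using this
    | 2 => exact hsq i
    | d + 3 =>
      have := N.add_mem (hTN (pow_sub_mem hn hy hT (hκ i).symm d))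
        (N.smul_mem ((d + 3 : ℕ) : K) (hax i d))
      convert this using 1
      rw [Algebra.smul_def, map_natCast]
      ring
  match a, b with
  | 0, b => simpa using hpow j b
  | a, 0 => simpa using hpow i a
  | 1, 1 =>
    have := N.smul_mem (2 : K)⁻¹ (N.sub_mem (N.add_mem (hsq i) (hsq j))
      (hTN (T.pow_mem (hT i j) 2)))
    convert this using 1
    rw [show y i ^ 2 + y j ^ 2 - (y i - y j) ^ 2 = (2 : K) • (y i * y j) by
      rw [Algebra.smul_def, map_ofNat]; ring, smul_smul, inv_mul_cancel₀ h2]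
    simp
  | a + 2, 1 => simpa using hax' a hij
  | 1, b + 2 => simpa [mul_comm] using hax' b hij.symm
  | a + 2, b + 2 => exact hTN (pow_mul_pow_mem hn hy hT hij a b)

end DifferenceSubalgebra

section Descent

variable {K : Type*} [Field K] {n : ℕ}

theorem exists_subVar_add_axisPart (h2 : (2 : K) ≠ 0) (hn : 5 ≤ n) (o : Fin n)
    {κ : Fin n → Fin n} (hκ : ∀ i, κ i ≠ i) (a : MvPolynomial (Fin n) K) :
    ∃ f p, subVar K o f + axisPart K X o κ p - a ∈ planesIdeal K n := by
  classical
  let mk := Ideal.Quotient.mkₐ K (planesIdeal K n)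
  let y : Fin n → MvPolynomial (Fin n) K ⧸ planesIdeal K n := fun i => mk (X i)
  let T := (mk.comp (subVar K o)).range
  have hy : ∀ a b c, a ≠ b → a ≠ c → b ≠ c → y a * y b * y c = 0 := by
    intro a b c hab hac hbc
    simp only [y, ← map_mul]
    exact Ideal.Quotient.eq_zero_iff_mem.mpr (X_mul_X_mul_X_mem_planesIdeal hab hac hbc)
  have hT : ∀ i j, y i - y j ∈ T := by
    intro i j
    refine ⟨X i - X j, ?_⟩
    simp [y]
  have hpart : ∀ p, axisPart K y o κ p = mk (axisPart K X o κ p) := by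
    intro p
    simp [axisPart_apply, y, ← Polynomial.aeval_algHom_apply]
  have key : mk a ∈ Subalgebra.toSubmodule T ⊔ LinearMap.range (axisPart K y o κ) := by
    induction a using MvPolynomial.induction_on' with
    | add p q hp hq => rw [map_add]; exact Submodule.add_mem _ hp hq
    | monomial m c =>
      by_cases hm : m.support.card ≤ 2
      · obtain ⟨e, he, hec⟩ := Finset.exists_superset_card_eq hm (by simp; omega)
        obtain ⟨i, j, hij, rfl⟩ := Finset.card_eq_two.mp hec
        have : mk (monomial m c) = c • (y i ^ m i * y j ^ m j) := by
          rw [monomial_eq, Finsupp.prod_of_support_subset _ he _ (by simp), Finset.prod_pair hij]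
          simp only [y, map_mul, map_pow]
          rw [C_eq_smul_one, map_smul, map_one, smul_mul_assoc, one_mul]
        rw [this]
        exact Submodule.smul_mem _ _ (pow_mul_pow_mem_sup h2 hn hy hT o hκ hij _ _)
      · have : mk (monomial m c) = 0 := by
          refine Ideal.Quotient.eq_zero_iff_mem.mpr (mem_planesIdeal.mpr fun e he => ?_)
          ext m'
          rw [coeff_restrictVars, coeff_monomial, coeff_zero]
          split_ifs with h1 h3
          · subst h3
            exact absurd ((Finset.card_le_card h1).trans he.le) hm
          · rfl
          · rfl
        rw [this]
        exact Submodule.zero_mem _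
  obtain ⟨_, ⟨f, rfl⟩, _, ⟨p, rfl⟩, h⟩ := Submodule.mem_sup.mp key
  refine ⟨f, p, Ideal.Quotient.eq.mp ?_⟩
  rw [hpart] at h
  rw [map_add]
  exact h

variable (K) in
/-- First order expansion along the `i`-th axis, in the diagonal direction. -/
noncomputable def axisJet (i : Fin n) : MvPolynomial (Fin n) K →ₐ[K] DualNumber (Polynomial K) :=
  aeval fun k => (if k = i then TrivSqZeroExt.inl Polynomial.X else 0) + DualNumber.eps

theorem axisJet_X (i k : Fin n) : axisJet K i (X k) =
    (if k = i then TrivSqZeroExt.inl Polynomial.X else 0) + DualNumber.eps := by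
  simp [axisJet]

theorem axisJet_eq_zero (hn : 2 ≤ n) (i : Fin n) {f : MvPolynomial (Fin n) K}
    (hf : f ∈ planesIdeal K n) : axisJet K i f = 0 := by
  have h : planesIdeal K n ≤ RingHom.ker (axisJet K i) := by
    refine planesIdeal_le hn fun a b c hab hac hbc => ?_
    rw [RingHom.mem_ker, map_mul, map_mul, axisJet_X, axisJet_X, axisJet_X]
    by_cases ha : a = i
    · subst ha
      simp [hab.symm, hac.symm, mul_assoc]
    by_cases hb : b = i
    · subst hb
      simp [hab, hbc.symm, mul_right_comm _ _ DualNumber.eps]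
    · simp [ha, hb]
  exact h hf

theorem snd_axisJet_subVar (o i : Fin n) (f : MvPolynomial (Fin n) K) :
    (axisJet K i (subVar K o f)).snd = 0 := by
  have : (axisJet K i).comp (subVar K o) = (TrivSqZeroExt.inlAlgHom K (Polynomial K)
      (Polynomial K)).comp (aeval fun k => (if k = i then Polynomial.X else 0) -
        (if o = i then Polynomial.X else 0)) := by
    ext k : 1
    simp only [AlgHom.comp_apply, subVar_X, map_sub, axisJet_X, aeval_X,
      TrivSqZeroExt.inlAlgHom_apply]
    split_ifs <;> simp
  have h := congrArg TrivSqZeroExt.snd (DFunLike.congr_fun this f)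
  simpa using h

theorem snd_axisJet_axisPart (i o : Fin n) {κ : Fin n → Fin n} (hκ : ∀ i, κ i ≠ i)
    (p : K × (Fin n → K) × (Fin n → Polynomial K)) :
    (axisJet K i (axisPart K X o κ p)).snd =
      Polynomial.C p.1 + 2 * Polynomial.C (p.2.1 i) * Polynomial.X +
        p.2.2 i * Polynomial.X ^ 2 := by
  rw [axisPart_apply]
  simp only [map_add, map_smul, map_sum, map_mul, map_pow, TrivSqZeroExt.snd_add,
    TrivSqZeroExt.snd_smul, TrivSqZeroExt.snd_sum]
  rw [Finset.sum_eq_single i]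
  · have h1 : (axisJet K i (X o)).snd = 1 := by
      rw [axisJet_X]; split_ifs <;> simp
    have h2 : axisJet K i (X i) ^ 2 = TrivSqZeroExt.inl (Polynomial.X ^ 2) +
        TrivSqZeroExt.inr (2 * Polynomial.X) := by
      rw [axisJet_X, if_pos rfl]
      ext <;> simp [pow_two, two_mul]
    have h3 : axisJet K i (X (κ i)) = DualNumber.eps := by
      rw [axisJet_X, if_neg (hκ i), zero_add]
    have h4 : (axisJet K i (Polynomial.aeval (X i) (p.2.2 i))).fst = p.2.2 i := by
      have : (((TrivSqZeroExt.fstHom K (Polynomial K) (Polynomial K)).comp (axisJet K i)).comp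
          (Polynomial.aeval (X i))) = AlgHom.id K _ := by
        ext
        simp [axisJet_X]
      exact DFunLike.congr_fun this (p.2.2 i)
    rw [h1, h2, h3]
    simp [h4, Polynomial.smul_eq_C_mul]
    ring
  · intro k _ hk
    have h2 : axisJet K i (X k) ^ 2 = 0 := by
      rw [axisJet_X, if_neg hk, zero_add, DualNumber.eps_pow_two]
    simp [h2]
  · simp

/-- A polynomial whose diagonal derivative vanishes along all axes is, on the union of the
coordinate planes, a polynomial in the differences of the coordinates. -/
theorem exists_subVar_sub_mem (h2 : (2 : K) ≠ 0) (hn : 5 ≤ n) (o : Fin n)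
    {a : MvPolynomial (Fin n) K} (ha : ∀ i, (axisJet K i a).snd = 0) :
    ∃ f, subVar K o f - a ∈ planesIdeal K n := by
  have hκ : ∀ i : Fin n, ∃ k, k ≠ i := fun i =>
    let ⟨l, hl, _⟩ := exists_fin_ne_two (by omega) i i
    ⟨l, hl⟩
  choose κ hκ using hκ
  obtain ⟨f, p, h⟩ := exists_subVar_add_axisPart h2 hn o hκ a
  have hp : ∀ i, Polynomial.C p.1 + 2 * Polynomial.C (p.2.1 i) * Polynomial.X +
        p.2.2 i * Polynomial.X ^ 2 = 0 := by
    intro i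
    have := congrArg TrivSqZeroExt.snd (axisJet_eq_zero (by omega) i h)
    rw [map_sub, map_add, TrivSqZeroExt.snd_sub, TrivSqZeroExt.snd_add, snd_axisJet_subVar,
      snd_axisJet_axisPart i o hκ, ha i] at this
    simpa using this
  have hc : p.1 = 0 := by
    have := congrArg (fun q => Polynomial.coeff q 0) (hp o)
    simpa [Polynomial.mul_coeff_zero] using this
  have hb : ∀ i, p.2.1 i = 0 := by
    intro i
    have := congrArg (fun q => Polynomial.coeff q 1) (hp i)
    rw [hc] at this
    simp only [map_zero, zero_add, Polynomial.coeff_add, Polynomial.coeff_mul_X,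
      Polynomial.coeff_zero] at this
    rw [Polynomial.coeff_mul_X_pow', if_neg (by norm_num), add_zero] at this
    rw [show (2 : Polynomial K) = Polynomial.C 2 from rfl, ← Polynomial.C_mul,
      Polynomial.coeff_C_zero] at this
    simpa [h2] using this
  have hq : ∀ i, p.2.2 i = 0 := by
    intro i
    have := hp i
    rw [hc, hb] at this
    simpa using this
  refine ⟨f, ?_⟩
  have h0 : axisPart K (X : Fin n → MvPolynomial (Fin n) K) o κ p = 0 := by
    rw [axisPart_apply]
    simp [hc, hb, hq]
  simpa [h0] using h

end Descent

section Gluing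

variable {K : Type*} [Field K] {n : ℕ}

/-- Polynomials on the coordinate planes that agree on the intersections of distinct planes come
from a global polynomial. -/
theorem exists_restrictVars_eq (hn : 2 ≤ n) (a : Finset (Fin n) → MvPolynomial (Fin n) K)
    (h : ∀ e e' : Finset (Fin n), e.card = 2 → e'.card = 2 → (e ∩ e').Nonempty →
      restrictVars K (e ∩ e') (a e) = restrictVars K (e ∩ e') (a e')) :
    ∃ g, ∀ e : Finset (Fin n), e.card = 2 → restrictVars K e g = restrictVars K e (a e) := by
  classical
  have hcoeff : ∀ (e e' : Finset (Fin n)) (m : Fin n →₀ ℕ), e.card = 2 → e'.card = 2 →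
      m.support ⊆ e → m.support ⊆ e' → coeff m (a e) = coeff m (a e') := by
    have key : ∀ (e e' : Finset (Fin n)) (m : Fin n →₀ ℕ), e.card = 2 → e'.card = 2 →
        m.support ⊆ e → m.support ⊆ e' → (e ∩ e').Nonempty → coeff m (a e) = coeff m (a e') := by
      intro e e' m he he' hm hm' hne
      have := congrArg (coeff m) (h e e' he he' hne)
      rwa [coeff_restrictVars, coeff_restrictVars, if_pos (Finset.subset_inter hm hm'),
        if_pos (Finset.subset_inter hm hm')] at this
    intro e e' m he he' hm hm'
    by_cases hne : (e ∩ e').Nonempty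
    · exact key e e' m he he' hm hm' hne
    · rw [Finset.not_nonempty_iff_eq_empty] at hne
      obtain ⟨i, hi⟩ : e.Nonempty := Finset.card_pos.mp (by omega)
      obtain ⟨j, hj⟩ : e'.Nonempty := Finset.card_pos.mp (by omega)
      have hij : i ≠ j := by
        rintro rfl
        exact Finset.notMem_empty i (hne ▸ Finset.mem_inter.mpr ⟨hi, hj⟩)
      have hm0 : m.support ⊆ ∅ := hne ▸ Finset.subset_inter hm hm'
      have hm1 : m.support ⊆ {i, j} := hm0.trans (Finset.empty_subset _)
      exact (key e {i, j} m he (Finset.card_pair hij) hm hm1 ⟨i, by simp [hi]⟩).trans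
        (key {i, j} e' m (Finset.card_pair hij) he' hm1 hm' ⟨j, by simp [hj]⟩)
  have hex : ∀ m : Fin n →₀ ℕ, ∃ e : Finset (Fin n), e.card = 2 ∧
      (m.support.card ≤ 2 → m.support ⊆ e) := by
    intro m
    by_cases hm : m.support.card ≤ 2
    · obtain ⟨e, he, hec⟩ := Finset.exists_superset_card_eq hm (by simpa using hn)
      exact ⟨e, hec, fun _ => he⟩
    · obtain ⟨e, -, hec⟩ := Finset.exists_superset_card_eq (s := (∅ : Finset (Fin n))) (n := 2)
        (by simp) (by simpa using hn)
      exact ⟨e, hec, fun h => absurd h hm⟩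
  choose c hc hcs using hex
  refine ⟨∑ m ∈ Finset.univ.biUnion (fun e => (a e).support), monomial m (coeff m (a (c m))),
    fun e he => ?_⟩
  ext m
  rw [coeff_restrictVars, coeff_restrictVars]
  split_ifs with hm
  · rw [hcoeff e (c m) m he (hc m) hm (hcs m ((Finset.card_le_card hm).trans he.le)),
      coeff_sum]
    simp only [coeff_monomial, Finset.sum_ite_eq', Finset.mem_biUnion, Finset.mem_univ, true_and,
      mem_support_iff]
    by_cases h0 : coeff m (a (c m)) = 0
    · simp [h0]
    · rw [if_pos ⟨_, h0⟩]
  · rfl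

end Gluing

section Planes

variable (K : Type*) [Field K] {n : ℕ}

/-- Restriction to the plane of the `i`-th and `j`-th coordinates. -/
noncomputable def planeRes (i j : Fin n) :
    MvPolynomial (Fin n) K →ₐ[K] Polynomial (Polynomial K) :=
  aeval fun k => if k = i then Polynomial.C Polynomial.X else if k = j then Polynomial.X else 0

/-- The section of `planeRes` given by a choice of images of the two coordinates. -/
noncomputable def planeLift {A : Type*} [CommRing A] [Algebra K A] (a b : A) :
    Polynomial (Polynomial K) →ₐ[K] A :=
  Polynomial.eval₂AlgHom (Polynomial.aeval a) b (fun _ => Commute.all _ _)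

theorem planeRes_X (i j k : Fin n) : planeRes K i j (X k) =
    if k = i then Polynomial.C Polynomial.X else if k = j then Polynomial.X else 0 := by
  simp [planeRes]

variable {K}

theorem planeLift_planeRes {i j : Fin n} (f : MvPolynomial (Fin n) K) :
    planeLift K (X i) (X j) (planeRes K i j f) = restrictVars K {i, j} f := by
  have : (planeLift K (X i) (X j)).comp (planeRes K i j) = restrictVars K {i, j} := by
    ext k : 1
    rw [AlgHom.comp_apply, planeRes_X, restrictVars_X]
    by_cases h1 : k = i
    · simp [h1, planeLift]
    · by_cases h2 : k = j
      · subst h2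
        simp [h1, planeLift]
      · simp [h1, h2]
  exact DFunLike.congr_fun this f

theorem planeRes_restrictVars {i j : Fin n} (f : MvPolynomial (Fin n) K) :
    planeRes K i j (restrictVars K {i, j} f) = planeRes K i j f := by
  have : (planeRes K i j).comp (restrictVars K {i, j}) = planeRes K i j := by
    ext k : 1
    rw [AlgHom.comp_apply, restrictVars_X]
    by_cases h : k ∈ ({i, j} : Finset (Fin n))
    · rw [if_pos h]
    · rw [if_neg h, planeRes_X]
      simp only [Finset.mem_insert, Finset.mem_singleton, not_or] at h
      simp [h]
  exact DFunLike.congr_fun this f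

theorem planeRes_eq_zero_iff {i j : Fin n} (f : MvPolynomial (Fin n) K) :
    planeRes K i j f = 0 ↔ restrictVars K {i, j} f = 0 := by
  constructor <;> intro h
  · rw [← planeLift_planeRes, h, map_zero]
  · rw [← planeRes_restrictVars, h, map_zero]

theorem mem_planesIdeal_iff_planeRes {f : MvPolynomial (Fin n) K} :
    f ∈ planesIdeal K n ↔ ∀ i j, i ≠ j → planeRes K i j f = 0 := by
  simp only [mem_planesIdeal, Finset.card_eq_two, planeRes_eq_zero_iff]
  exact ⟨fun h i j hij => h _ ⟨i, j, hij, rfl⟩, fun h e ⟨i, j, hij, he⟩ => he ▸ h i j hij⟩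

theorem planeRes_subVar_surjective (hn : 3 ≤ n) (o : Fin n) {i j : Fin n} (hij : i ≠ j) :
    Function.Surjective ((planeRes K i j).comp (subVar K o)) := by
  obtain ⟨l, hli, hlj⟩ := exists_fin_ne_two hn i j
  have : ((planeRes K i j).comp (subVar K o)).comp
      (planeLift K (X i - X l) (X j - X l)) = AlgHom.id K _ := by
    refine Polynomial.algHom_ext' ?_ ?_
    · ext
      simp [planeLift, planeRes_X, hli, hlj]
    · simp [planeLift, planeRes_X, hli, hlj, hij.symm]
  exact fun b => ⟨_, DFunLike.congr_fun this b⟩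

theorem fst_axisJet_restrictVars {i : Fin n} {s : Finset (Fin n)} (hi : i ∈ s)
    (f : MvPolynomial (Fin n) K) :
    (axisJet K i (restrictVars K s f)).fst = (axisJet K i f).fst := by
  have : ((TrivSqZeroExt.fstHom K (Polynomial K) (Polynomial K)).comp (axisJet K i)).comp
      (restrictVars K s) = (TrivSqZeroExt.fstHom K (Polynomial K) (Polynomial K)).comp
        (axisJet K i) := by
    ext k : 1
    rw [AlgHom.comp_apply, restrictVars_X]
    split_ifs with h
    · rfl
    · have : k ≠ i := fun h' => h (h' ▸ hi)
      simp [axisJet_X, this]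
  exact DFunLike.congr_fun this f

end Planes

section DifferenceQuotient

variable (K : Type*) [Field K] {n : ℕ}

/-- The ideal of the polynomials in the differences of the coordinates that vanish on the coordinate
planes. -/
noncomputable def diffIdeal (o : Fin n) : Ideal (MvPolynomial (Fin n) K) :=
  (planesIdeal K n).comap (subVar K o)

variable {K}

/-- The restriction of a polynomial in the differences to a coordinate plane. -/
noncomputable def diffPlane (o : Fin n) {i j : Fin n} (hij : i ≠ j) :
    MvPolynomial (Fin n) K ⧸ diffIdeal K o →+* Polynomial (Polynomial K) :=
  Ideal.Quotient.lift _ ((planeRes K i j).comp (subVar K o)).toRingHom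
    fun _ hf => mem_planesIdeal_iff_planeRes.mp hf i j hij

theorem diffPlane_mk (o : Fin n) {i j : Fin n} (hij : i ≠ j) (f : MvPolynomial (Fin n) K) :
    diffPlane o hij (Ideal.Quotient.mk _ f) = planeRes K i j (subVar K o f) := rfl

theorem diffPlane_surjective (hn : 3 ≤ n) (o : Fin n) {i j : Fin n} (hij : i ≠ j) :
    Function.Surjective (diffPlane (K := K) o hij) := fun b =>
  let ⟨f, hf⟩ := planeRes_subVar_surjective hn o hij b
  ⟨Ideal.Quotient.mk _ f, hf⟩

theorem eq_zero_of_diffPlane (o : Fin n) {s : MvPolynomial (Fin n) K ⧸ diffIdeal K o}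
    (hs : ∀ i j, ∀ hij : i ≠ j, diffPlane o hij s = 0) : s = 0 := by
  obtain ⟨f, rfl⟩ := Ideal.Quotient.mk_surjective s
  exact Ideal.Quotient.eq_zero_iff_mem.mpr (mem_planesIdeal_iff_planeRes.mpr hs)

/-- The restriction of a polynomial in the differences to a coordinate axis. -/
noncomputable def diffAxis (hn : 2 ≤ n) (o i : Fin n) :
    MvPolynomial (Fin n) K ⧸ diffIdeal K o →+* Polynomial K :=
  Ideal.Quotient.lift _ (((TrivSqZeroExt.fstHom K (Polynomial K) (Polynomial K)).comp
    (axisJet K i)).comp (subVar K o)).toRingHom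
    fun f hf => by
      have := axisJet_eq_zero hn i hf
      simp [this]

theorem diffAxis_mk (hn : 2 ≤ n) (o i : Fin n) (f : MvPolynomial (Fin n) K) :
    diffAxis hn o i (Ideal.Quotient.mk _ f) = (axisJet K i (subVar K o f)).fst := rfl

theorem diffPlane_ne_zero (hn : 2 ≤ n) (o : Fin n) {i j : Fin n} (hij : i ≠ j)
    {s : MvPolynomial (Fin n) K ⧸ diffIdeal K o} (hs : diffAxis hn o i s ≠ 0) :
    diffPlane o hij s ≠ 0 := by
  obtain ⟨f, rfl⟩ := Ideal.Quotient.mk_surjective s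
  rw [diffPlane_mk, Ne, planeRes_eq_zero_iff]
  intro h
  rw [diffAxis_mk, ← fst_axisJet_restrictVars (s := {i, j}) (by simp), h] at hs
  simp at hs

theorem dvd_of_forall_diffPlane_dvd (h2 : (2 : K) ≠ 0) (hn : 5 ≤ n) (o : Fin n)
    {θ s : MvPolynomial (Fin n) K ⧸ diffIdeal K o}
    (hθ : ∀ i, diffAxis (by omega) o i θ ≠ 0)
    (h : ∀ i j, ∀ hij : i ≠ j, diffPlane o hij θ ∣ diffPlane o hij s) : θ ∣ s := by
  obtain ⟨t, rfl⟩ := Ideal.Quotient.mk_surjective θ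
  obtain ⟨f, rfl⟩ := Ideal.Quotient.mk_surjective s
  have hex : ∀ e : Finset (Fin n), ∃ a, e.card = 2 → restrictVars K e (subVar K o f) =
      restrictVars K e (subVar K o t) * a := by
    intro e
    by_cases he : e.card = 2
    · obtain ⟨i, j, hij, rfl⟩ := Finset.card_eq_two.mp he
      obtain ⟨b, hb⟩ := h i j hij
      refine ⟨planeLift K (X i) (X j) b, fun _ => ?_⟩
      rw [diffPlane_mk, diffPlane_mk] at hb
      rw [← planeLift_planeRes, hb, map_mul, planeLift_planeRes]
    · exact ⟨0, fun h => absurd h he⟩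
  choose a ha using hex
  have hcomp : ∀ e s : Finset (Fin n), e.card = 2 → s ⊆ e →
      restrictVars K s (subVar K o f) = restrictVars K s (subVar K o t) *
        restrictVars K s (a e) := by
    intro e s he hs
    have := congrArg (restrictVars K s) (ha e he)
    rwa [map_mul, restrictVars_restrictVars, restrictVars_restrictVars,
      Finset.inter_eq_left.mpr hs] at this
  obtain ⟨g, hg⟩ := exists_restrictVars_eq (by omega) a (by
    rintro e e' he he' ⟨i, hi⟩
    have h1 := hcomp e (e ∩ e') he Finset.inter_subset_left
    rw [hcomp e' (e ∩ e') he' Finset.inter_subset_right] at h1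
    refine (mul_left_cancel₀ ?_ h1).symm
    intro h0
    refine hθ i ?_
    rw [diffAxis_mk, ← fst_axisJet_restrictVars hi, h0]
    simp)
  have hJ : subVar K o f - subVar K o t * g ∈ planesIdeal K n := by
    rw [mem_planesIdeal]
    intro e he
    rw [map_sub, map_mul, hg e he, ← hcomp e e he subset_rfl, sub_self]
  obtain ⟨q, hq⟩ := exists_subVar_sub_mem (a := g) h2 hn o (by
    intro i
    have := congrArg TrivSqZeroExt.snd (axisJet_eq_zero (by omega) i hJ)
    rw [map_sub, map_mul, TrivSqZeroExt.snd_sub, TrivSqZeroExt.snd_mul, snd_axisJet_subVar,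
      snd_axisJet_subVar] at this
    simp only [smul_zero, add_zero, zero_sub, TrivSqZeroExt.snd_zero, neg_eq_zero,
      smul_eq_mul, mul_eq_zero] at this
    exact this.resolve_left (hθ i))
  refine ⟨Ideal.Quotient.mk _ q, ?_⟩
  rw [← map_mul, Ideal.Quotient.eq]
  change subVar K o (f - t * q) ∈ planesIdeal K n
  have : subVar K o (f - t * q) = (subVar K o f - subVar K o t * g) -
      subVar K o t * (subVar K o q - g) := by
    rw [map_sub, map_mul]
    ring
  rw [this]
  exact Ideal.sub_mem _ hJ (Ideal.mul_mem_left _ _ hq)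

theorem isWeaklyRegular_pair (h2 : (2 : K) ≠ 0) (hn : 5 ≤ n) (o : Fin n)
    {θ₁ θ₂ : MvPolynomial (Fin n) K ⧸ diffIdeal K o}
    (h₁ : ∀ i, diffAxis (by omega) o i θ₁ ≠ 0)
    (h₂ : ∀ i j, ∀ hij : i ≠ j, IsRelPrime (diffPlane o hij θ₁) (diffPlane o hij θ₂)) :
    RingTheory.Sequence.IsWeaklyRegular (MvPolynomial (Fin n) K ⧸ diffIdeal K o) [θ₁, θ₂] := by
  rw [RingTheory.Sequence.isWeaklyRegular_cons_iff,
    RingTheory.Sequence.isWeaklyRegular_singleton_iff]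
  constructor
  · rw [isSMulRegular_iff_right_eq_zero_of_smul]
    intro s hs
    refine eq_zero_of_diffPlane o fun i j hij => ?_
    have := congrArg (diffPlane o hij) hs
    rw [smul_eq_mul, map_mul, map_zero, mul_eq_zero] at this
    exact this.resolve_left (diffPlane_ne_zero (by omega) o hij (h₁ i))
  · open scoped Pointwise in
    refine (isSMulRegular_quotient_iff_mem_of_smul_mem
      (θ₁ • (⊤ : Submodule (MvPolynomial (Fin n) K ⧸ diffIdeal K o) _)) θ₂).mpr ?_
    intro s hs
    simp only [Submodule.mem_smul_pointwise_iff_exists, Submodule.mem_top, true_and] at hs ⊢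
    obtain ⟨b, hb⟩ := hs
    obtain ⟨c, hc⟩ := dvd_of_forall_diffPlane_dvd h2 hn o h₁ (s := s) fun i j hij => by
      refine (h₂ i j hij).dvd_of_dvd_mul_left (z := diffPlane o hij s)
        ⟨diffPlane o hij b, ?_⟩
      rw [← map_mul, ← map_mul]
      exact congrArg (diffPlane o hij) hb.symm
    exact ⟨c, hc.symm⟩

end DifferenceQuotient

theorem exists_isPrime_span_singleton_lt {K : Type*} [Field K] {p : Polynomial (Polynomial K)}
    (hp : Prime p) : ∃ M : Ideal (Polynomial (Polynomial K)), M.IsPrime ∧ Ideal.span {p} < M := by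
  obtain ⟨M, hM, hle⟩ := Ideal.exists_le_maximal (Ideal.span {p})
    (Ideal.span_singleton_ne_top hp.not_isUnit)
  refine ⟨M, hM.isPrime, lt_of_le_of_ne hle ?_⟩
  rintro rfl
  have h1 := Ideal.height_span_singleton_le_one hp.not_isUnit
  set m := (Ideal.span {p}).comap (Polynomial.C : Polynomial K →+* _) with hm
  have : m.IsMaximal := Polynomial.isMaximal_comap_C_of_isJacobsonRing _
  have : (Ideal.span {p}).LiesOver m := ⟨rfl⟩
  have : m.LiesOver (m.comap (Polynomial.C : K →+* _)) := ⟨rfl⟩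
  have : (m.comap (Polynomial.C : K →+* _)).IsMaximal :=
    Polynomial.isMaximal_comap_C_of_isJacobsonRing _
  rw [Polynomial.height_eq_height_add_one m, Polynomial.height_eq_height_add_one
    (m.comap (Polynomial.C : K →+* _)), add_assoc, one_add_one_eq_two] at h1
  have h2 : (2 : ℕ∞) ≤ 1 := le_add_self.trans h1
  exact absurd h2 (by decide)

section Dimension

variable {S : Type*} [CommRing S]

/-- If finitely many surjections out of `S` are jointly injective, then the dimension of `S` is
bounded by those of their targets. -/
theorem ringKrullDim_le_of_iInf_ker {B ι : Type*} [CommRing B] [Finite ι] (f : ι → S →+* B)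
    (hf : ∀ i, Function.Surjective (f i)) (h : ∀ s, (∀ i, f i s = 0) → s = 0) :
    ringKrullDim S ≤ ringKrullDim B := by
  have := Fintype.ofFinite ι
  refine iSup_le fun l => ?_
  have hinf : Finset.univ.inf (fun i => RingHom.ker (f i)) ≤ l.head.asIdeal := by
    intro s hs
    rw [Submodule.mem_finsetInf] at hs
    rw [h s fun i => hs i (Finset.mem_univ i)]
    exact Ideal.zero_mem _
  obtain ⟨i, -, hi⟩ := (Ideal.IsPrime.inf_le' l.head.isPrime).mp hinf
  let l' : LTSeries (PrimeSpectrum.zeroLocus (RingHom.ker (f i) : Set S)) :=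
    { length := l.length
      toFun := fun k => ⟨l k, hi.trans (LTSeries.head_le l k)⟩
      step := fun k => l.step k }
  have h1 : (l'.length : WithBot ℕ∞) ≤ ringKrullDim (S ⧸ RingHom.ker (f i)) := by
    rw [ringKrullDim_quotient]
    exact Order.LTSeries.length_le_krullDim l'
  rwa [ringKrullDim_eq_of_ringEquiv (RingHom.quotientKerEquivOfSurjective (hf i))] at h1

theorem height_le_one_of_le_of_lt (hdim : ringKrullDim S ≤ 2) {q Q Q' : Ideal S} [Q.IsPrime]
    [Q'.IsPrime] (h : q ≤ Q) (h' : Q < Q') : q.height ≤ 1 := by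
  have h1 : (Q'.height : WithBot ℕ∞) ≤ 2 :=
    (Ideal.height_le_ringKrullDim_of_ne_top Ideal.IsPrime.ne_top').trans hdim
  have h2 : Q'.height ≤ 2 := WithBot.coe_le_coe.mp h1
  have h3 : q.height + 1 ≤ 1 + 1 :=
    (add_le_add_left (Ideal.height_mono h) 1).trans
      ((Ideal.height_add_one_le_of_lt_of_isPrime h').trans h2)
  exact (ENat.add_le_add_iff_right (by decide)).mp h3

end Dimension

section CohenMacaulay

variable {K : Type*} [Field K] {n : ℕ}

theorem ringKrullDim_diffQuotient_le (hn : 3 ≤ n) (o : Fin n) :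
    ringKrullDim (MvPolynomial (Fin n) K ⧸ diffIdeal K o) ≤ 2 := by
  refine (ringKrullDim_le_of_iInf_ker
    (fun p : {p : Fin n × Fin n // p.1 ≠ p.2} => diffPlane (K := K) o p.2)
    (fun p => diffPlane_surjective hn o p.2)
    (fun s hs => eq_zero_of_diffPlane o fun i j hij => hs ⟨(i, j), hij⟩)).trans ?_
  rw [Polynomial.ringKrullDim_of_isNoetherianRing, Polynomial.ringKrullDim_of_isNoetherianRing,
    ringKrullDim_eq_zero_of_field]
  norm_num

theorem exists_isPrime_ker_diffAxis_lt (hn : 2 ≤ n) (o i : Fin n) :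
    ∃ Q : Ideal (MvPolynomial (Fin n) K ⧸ diffIdeal K o), Q.IsPrime ∧
      RingHom.ker (diffAxis hn o i) < Q := by
  obtain ⟨l, hl⟩ : ∃ l, l ≠ i := by
    obtain ⟨l, hl⟩ := exists_fin_notMem (s := {i}) (by rw [Finset.card_singleton]; omega)
    exact ⟨l, by simpa using hl⟩
  refine ⟨RingHom.ker ((Polynomial.evalRingHom 0).comp (diffAxis hn o i)),
    RingHom.ker_isPrime _, lt_of_le_not_ge ?_ ?_⟩
  · intro s hs
    rw [RingHom.mem_ker] at hs
    simp [RingHom.mem_ker, hs]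
  · intro h
    have hx : diffAxis hn o i (Ideal.Quotient.mk _ (X i - X l)) = (Polynomial.X : Polynomial K) := by
      rw [diffAxis_mk]
      simp [axisJet_X, hl]
    have := h (x := Ideal.Quotient.mk _ (X i - X l)) (by
      rw [RingHom.mem_ker, RingHom.comp_apply, hx]
      simp)
    rw [RingHom.mem_ker, hx] at this
    exact Polynomial.X_ne_zero this

open UniqueFactorizationMonoid in
theorem exists_isWeaklyRegular_of_isPrime (h2 : (2 : K) ≠ 0) (hn : 5 ≤ n) (o : Fin n)
    (q : Ideal (MvPolynomial (Fin n) K ⧸ diffIdeal K o)) (hq : q.IsPrime) :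
    ∃ rs : List (MvPolynomial (Fin n) K ⧸ diffIdeal K o), (∀ r ∈ rs, r ∈ q) ∧
      RingTheory.Sequence.IsWeaklyRegular (MvPolynomial (Fin n) K ⧸ diffIdeal K o) rs ∧
      q.height ≤ rs.length := by
  classical
  have hdim := ringKrullDim_diffQuotient_le (K := K) (by omega : 3 ≤ n) o
  by_cases h0 : q.height = 0
  · exact ⟨[], by simp, .nil _ _, by simp [h0]⟩
  by_cases h1 : q.height ≤ 1
  · have hred : IsReduced (MvPolynomial (Fin n) K ⧸ diffIdeal K o) :=
      ⟨fun s ⟨k, hk⟩ => eq_zero_of_diffPlane o fun i j hij => by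
        have := congrArg (diffPlane o hij) hk
        rw [map_pow, map_zero] at this
        exact eq_zero_of_pow_eq_zero this⟩
    obtain ⟨θ, hθq, hθ⟩ : ∃ θ ∈ q, ∀ p ∈ minimalPrimes (MvPolynomial (Fin n) K ⧸ diffIdeal K o),
        θ ∉ p := by
      by_contra! hc
      obtain ⟨p, hp, hle⟩ := (Ideal.subset_union_prime_finite
        (minimalPrimes.finite_of_isNoetherianRing (MvPolynomial (Fin n) K ⧸ diffIdeal K o))
        (f := id) ⊥ ⊥ (fun p hp _ _ => hp.1.1) (I := q)).mp fun θ hθ => by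
          simpa using hc θ hθ
      have hp' : p.IsPrime := hp.1.1
      exact h0 (nonpos_iff_eq_zero.mp ((Ideal.height_mono hle).trans
        (Ideal.height_eq_zero_iff.mpr hp).le))
    refine ⟨[θ], by simpa, ?_, by simpa⟩
    rw [RingTheory.Sequence.isWeaklyRegular_singleton_iff,
      isSMulRegular_iff_right_eq_zero_of_smul]
    intro s hs
    have : s ∈ sInf (⊥ : Ideal (MvPolynomial (Fin n) K ⧸ diffIdeal K o)).minimalPrimes := by
      refine Submodule.mem_sInf.mpr fun p hp => ?_
      refine (hp.1.1.mem_or_mem (x := θ) (y := s) ?_).resolve_left (hθ p hp)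
      rw [← smul_eq_mul, hs]
      exact p.zero_mem
    rw [Ideal.sInf_minimalPrimes] at this
    obtain ⟨k, hk⟩ := this
    exact eq_zero_of_pow_eq_zero hk
  · obtain ⟨θ₁, hθ₁q, hθ₁⟩ : ∃ θ ∈ q, ∀ i, diffAxis (by omega) o i θ ≠ 0 := by
      by_contra! hc
      obtain ⟨i, -, hle⟩ := (Ideal.subset_union_prime (s := Finset.univ)
        (f := fun i => RingHom.ker (diffAxis (K := K) (by omega : 2 ≤ n) o i)) o o
        (fun i _ _ _ => RingHom.ker_isPrime _) (I := q)).mp fun θ hθ => by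
          simpa using hc θ hθ
      obtain ⟨Q, hQ, hlt⟩ := exists_isPrime_ker_diffAxis_lt (K := K) (by omega : 2 ≤ n) o i
      have := RingHom.ker_isPrime (diffAxis (K := K) (by omega : 2 ≤ n) o i)
      exact h1 (height_le_one_of_le_of_lt hdim hle hlt)
    let F : {p : Fin n × Fin n // p.1 ≠ p.2} → Finset (Polynomial (Polynomial K)) :=
      fun p => (factors (diffPlane o p.2 θ₁)).toFinset
    obtain ⟨θ₂, hθ₂q, hθ₂⟩ : ∃ θ ∈ q, ∀ e, ∀ p ∈ F e, ¬ p ∣ diffPlane o e.2 θ := by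
      by_contra! hc
      obtain ⟨e₀, -⟩ := hc 0 q.zero_mem
      obtain ⟨⟨e, p⟩, hp, hle⟩ := (Ideal.subset_union_prime (s := Finset.univ.sigma F)
        (f := fun x => (Ideal.span {x.2}).comap (diffPlane (K := K) o x.1.2))
        ⟨e₀, 0⟩ ⟨e₀, 0⟩
        (fun x hx _ _ => by
          have hx' := prime_of_factor _
            (Multiset.mem_toFinset.mp (Finset.mem_sigma.mp hx).2)
          have := (Ideal.span_singleton_prime hx'.ne_zero).mpr hx'
          exact Ideal.comap_isPrime _ _) (I := q)).mp fun θ hθ => by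
          obtain ⟨e, p, hp, hpd⟩ := hc θ hθ
          simp only [Set.mem_iUnion]
          exact ⟨⟨e, p⟩, by simpa using hp, Ideal.mem_span_singleton.mpr hpd⟩
      simp only [Finset.mem_sigma, Finset.mem_univ, true_and, F, Multiset.mem_toFinset] at hp
      obtain ⟨M, hM, hlt⟩ := exists_isPrime_span_singleton_lt (prime_of_factor _ hp)
      have hpp := (Ideal.span_singleton_prime (prime_of_factor _ hp).ne_zero).mpr
        (prime_of_factor _ hp)
      refine h1 (height_le_one_of_le_of_lt hdim hle (Q' := M.comap (diffPlane o e.2)) ?_)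
      exact lt_of_le_not_ge (Ideal.comap_mono hlt.le) fun h => hlt.not_ge
        ((Ideal.comap_le_comap_iff_of_surjective _ (diffPlane_surjective (by omega) o e.2) _ _).mp h)
    refine ⟨[θ₁, θ₂], by simp [hθ₁q, hθ₂q], isWeaklyRegular_pair h2 hn o hθ₁ fun i j hij => ?_, ?_⟩
    · have hne := diffPlane_ne_zero (by omega) o hij (hθ₁ i)
      refine WfDvdMonoid.isRelPrime_of_no_irreducible_factors (fun h => hne h.1) fun p hp hd hd2 => ?_
      obtain ⟨p', hp', ha⟩ := exists_mem_factors_of_dvd hne hp hd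
      exact hθ₂ ⟨(i, j), hij⟩ p' (by simpa [F] using hp') (ha.symm.dvd.trans hd2)
    · have : (q.height : WithBot ℕ∞) ≤ 2 :=
        (Ideal.height_le_ringKrullDim_of_ne_top hq.ne_top).trans hdim
      exact WithBot.coe_le_coe.mp this

/-- The quotient by `InkIdeal K n (n - 2)` is a polynomial ring over the ring of the polynomials in
the differences of the coordinates on the coordinate planes. -/
theorem nonempty_quotient_InkIdeal_ringEquiv (hn : 3 ≤ n) (o : Fin n) :
    Nonempty ((MvPolynomial (Fin n) K ⧸ InkIdeal K n (n - 2)) ≃+*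
      Polynomial (MvPolynomial (Fin n) K ⧸ diffIdeal K o)) := by
  let Θ : MvPolynomial (Fin n) K →ₐ[K] Polynomial (MvPolynomial (Fin n) K) :=
    aeval fun k => Polynomial.C (X k) + Polynomial.X
  let Φ : MvPolynomial (Fin n) K →+* Polynomial (MvPolynomial (Fin n) K ⧸ diffIdeal K o) :=
    (Polynomial.mapRingHom (Ideal.Quotient.mk (diffIdeal K o))).comp Θ.toRingHom
  have hΦX : ∀ k, Φ (X k) = Polynomial.C (Ideal.Quotient.mk _ (X k)) + Polynomial.X := by
    intro k
    simp [Φ, Θ]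
  have hΘ : ∀ f, shiftVar K o f = (Θ f).map (subVar K o).toRingHom := by
    have : shiftVar K o = (Polynomial.mapAlgHom (subVar K o)).comp Θ := by
      ext k : 1
      simp [Θ]
    exact fun f => DFunLike.congr_fun this f
  have hker : RingHom.ker Φ = InkIdeal K n (n - 2) := by
    ext f
    rw [mem_InkIdeal_iff_coeff hn o, RingHom.mem_ker, Polynomial.ext_iff]
    refine forall_congr' fun d => ?_
    rw [hΘ, Polynomial.coeff_map, Polynomial.coeff_zero]
    change ((Θ f).map (Ideal.Quotient.mk (diffIdeal K o))).coeff d = 0 ↔ _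
    rw [Polynomial.coeff_map, Ideal.Quotient.eq_zero_iff_mem]
    rfl
  have ho : Ideal.Quotient.mk (diffIdeal K o) (X o) = 0 := by
    refine Ideal.Quotient.eq_zero_iff_mem.mpr ?_
    change subVar K o (X o) ∈ planesIdeal K n
    rw [subVar_X, sub_self]
    exact Ideal.zero_mem _
  have hX : Φ (X o) = Polynomial.X := by rw [hΦX, ho, map_zero, zero_add]
  have hC : ∀ s, Polynomial.C s ∈ Φ.range := by
    intro s
    obtain ⟨f, rfl⟩ := Ideal.Quotient.mk_surjective s
    induction f using MvPolynomial.induction_on with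
    | C c => exact ⟨C c, by simp [Φ, Θ, ← MvPolynomial.algebraMap_eq]⟩
    | add p q hp hq => simpa using add_mem hp hq
    | mul_X p k hp =>
      have hk : Polynomial.C (Ideal.Quotient.mk (diffIdeal K o) (X k)) ∈ Φ.range :=
        ⟨X k - X o, by rw [map_sub, hX, hΦX, add_sub_cancel_right]⟩
      simpa using mul_mem hp hk
  have hsurj : Function.Surjective Φ := by
    intro p
    change p ∈ Φ.range
    induction p using Polynomial.induction_on' with
    | add p q hp hq => exact add_mem hp hq
    | monomial d a =>
      rw [← Polynomial.C_mul_X_pow_eq_monomial]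
      exact mul_mem (hC a) (pow_mem (show Polynomial.X ∈ Φ.range from ⟨X o, hX⟩) d)
  exact ⟨(Ideal.quotEquivOfEq hker.symm).trans (RingHom.quotientKerEquivOfSurjective hsurj)⟩

theorem isCohenMacaulayRing_quotient_InkIdeal (h2 : (2 : K) ≠ 0) (hn : 5 ≤ n) :
    IsCohenMacaulayRing (MvPolynomial (Fin n) K ⧸ InkIdeal K n (n - 2)) := by
  let o : Fin n := ⟨0, by omega⟩
  obtain ⟨e⟩ := nonempty_quotient_InkIdeal_ringEquiv (K := K) (by omega : 3 ≤ n) o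
  exact (isCohenMacaulayRing_congr e).mpr
    (isCohenMacaulayRing_polynomial (exists_isWeaklyRegular_of_isPrime h2 hn o))

end CohenMacaulay

section LocalDepth

open RingTheory.Sequence

theorem mem_map_algebraMap_of_mem_jacobson {T : Type*} [CommRing T] (P : Ideal T) [P.IsPrime]
    {x : Localization.AtPrime P} (hx : x ∈ (⊥ : Ideal (Localization.AtPrime P)).jacobson) :
    x ∈ P.map (algebraMap T (Localization.AtPrime P)) := by
  rwa [IsLocalRing.jacobson_eq_maximalIdeal _ bot_ne_top,
    ← Localization.AtPrime.map_eq_maximalIdeal] at hx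

theorem exists_isWeaklyRegular_pair_of_two_le_ringDepth {A : Type*} [CommRing A]
    (h : 2 ≤ ringDepth A) : ∃ a ∈ (⊥ : Ideal A).jacobson, ∃ b ∈ (⊥ : Ideal A).jacobson,
      (∀ x, a * x = 0 → x = 0) ∧ ∀ x y, b * x = a * y → ∃ w, x = a * w := by
  have : ∃ rs : List A, (∀ r ∈ rs, r ∈ (⊥ : Ideal A).jacobson) ∧ IsRegular A rs ∧
      2 ≤ rs.length := by
    by_contra! hc
    have hle : ringDepth A ≤ 1 := iSup_le fun ⟨rs, hmem, hreg⟩ => by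
      have := hc rs hmem hreg
      exact_mod_cast Nat.le_of_lt_succ this
    exact absurd (h.trans hle) (by decide)
  obtain ⟨rs, hmem, hreg, hlen⟩ := this
  match rs, hlen with
  | a :: b :: ts, _ =>
    have hw := hreg.toIsWeaklyRegular
    rw [isWeaklyRegular_cons_iff, isWeaklyRegular_cons_iff] at hw
    refine ⟨a, hmem a (by simp), b, hmem b (by simp), fun x hx => ?_, fun x y hxy => ?_⟩
    · exact (isSMulRegular_iff_right_eq_zero_of_smul.mp hw.1) x hx
    · open scoped Pointwise in
      have h2 := (isSMulRegular_quotient_iff_mem_of_smul_mem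
        (a • (⊤ : Submodule A A)) b).mp hw.2.1 x
      simp only [Submodule.mem_smul_pointwise_iff_exists, Submodule.mem_top, true_and] at h2
      obtain ⟨w, hw⟩ := h2 ⟨y, hxy.symm⟩
      exact ⟨w, hw.symm⟩

theorem exists_mul_sub_mul_eq_zero_of_localization {S T ι : Type*} [CommRing S] [CommRing T]
    {g : S →+* T} (hg : Function.Surjective g) (P : Ideal T) [P.IsPrime] {c ℓ : ι → S}
    {w : Localization.AtPrime P}
    (hw : ∀ k, algebraMap T (Localization.AtPrime P) (g (c k)) =
      w * algebraMap T (Localization.AtPrime P) (g (ℓ k))) :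
    ∃ s t, g s ∉ P ∧ ∀ k, ∃ u, g u ∉ P ∧ g (u * (s * c k - t * ℓ k)) = 0 := by
  obtain ⟨⟨t', s'⟩, hst⟩ := IsLocalization.surj P.primeCompl w
  obtain ⟨t, rfl⟩ := hg t'
  obtain ⟨s, hs⟩ := hg (s' : T)
  refine ⟨s, t, hs ▸ s'.2, fun k => ?_⟩
  have h : algebraMap T (Localization.AtPrime P) (g s * g (c k)) =
      algebraMap T (Localization.AtPrime P) (g t * g (ℓ k)) := by
    rw [map_mul, map_mul, hw k, ← hst, hs]
    ring
  obtain ⟨u', hu'⟩ := (IsLocalization.eq_iff_exists P.primeCompl _).mp h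
  obtain ⟨u, hu⟩ := hg (u' : T)
  exact ⟨u, hu ▸ u'.2, by rw [map_mul, map_sub, map_mul, map_mul, hu, mul_sub, hu', sub_self]⟩

/-- A vector proportional to a system of generators of an ideal of grade at least two is a multiple
of it. -/
theorem exists_eq_mul_of_mul_eq_mul {A ι : Type*} [CommRing A] [Fintype ι] {ℓ c : ι → A}
    (hc : ∀ i j, ℓ i * c j = ℓ j * c i) {a b : A} (ha : a ∈ Ideal.span (Set.range ℓ))
    (hb : b ∈ Ideal.span (Set.range ℓ)) (hreg : ∀ x, a * x = 0 → x = 0)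
    (hreg' : ∀ x y, b * x = a * y → ∃ w, x = a * w) : ∃ w, ∀ j, c j = w * ℓ j := by
  obtain ⟨α, rfl⟩ := Ideal.mem_span_range_iff_exists_fun.mp ha
  obtain ⟨β, rfl⟩ := Ideal.mem_span_range_iff_exists_fun.mp hb
  have key : ∀ (γ : ι → A) (j : ι), ℓ j * ∑ i, γ i * c i = c j * ∑ i, γ i * ℓ i := by
    intro γ j
    rw [Finset.mul_sum, Finset.mul_sum]
    refine Finset.sum_congr rfl fun i _ => ?_
    linear_combination γ i * hc j i
  obtain ⟨w, hw⟩ := hreg' (∑ i, α i * c i) (∑ i, β i * c i) (by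
    rw [Finset.sum_mul, Finset.mul_sum]
    refine Finset.sum_congr rfl fun i _ => ?_
    linear_combination β i * key α i)
  refine ⟨w, fun j => sub_eq_zero.mp (hreg _ ?_)⟩
  linear_combination ℓ j * hw - key α j

end LocalDepth

section CharTwo

variable {K : Type*} [Field K] {n : ℕ}

theorem PFIdeal_mono {F F' : Finset (Fin n)} (h : F ⊆ F') : PFIdeal K F ≤ PFIdeal K F' :=
  Ideal.span_mono fun _ ⟨i, hi, j, hj, hf⟩ => ⟨i, h hi, j, h hj, hf⟩

theorem InkIdeal_le_PFIdeal (hn : 2 ≤ n) {e : Finset (Fin n)} (he : e.card = 2) :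
    InkIdeal K n (n - 2) ≤ PFIdeal K eᶜ := fun _ hf => (mem_InkIdeal_iff hn).mp hf e he

theorem PFIdeal_univ_eq_span (i : Fin n) : PFIdeal K (Finset.univ : Finset (Fin n)) =
    Ideal.span (Set.range fun j => (X i - X j : MvPolynomial (Fin n) K)) := by
  refine le_antisymm (Ideal.span_le.mpr ?_) (Ideal.span_le.mpr ?_)
  · rintro _ ⟨a, -, b, -, rfl⟩
    rw [← sub_sub_sub_cancel_left _ _ (X i)]
    exact Ideal.sub_mem _ (Ideal.subset_span ⟨b, rfl⟩) (Ideal.subset_span ⟨a, rfl⟩)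
  · rintro _ ⟨j, rfl⟩
    exact sub_mem_PFIdeal (Finset.mem_univ i) (Finset.mem_univ j)

theorem mem_PFIdeal_univ_of_aeval_eq_zero {i : Fin n} {s : MvPolynomial (Fin n) K}
    (h : aeval (fun _ => (Polynomial.X : Polynomial K)) s = 0) :
    s ∈ PFIdeal K (Finset.univ : Finset (Fin n)) := by
  rw [mem_PFIdeal_iff (Finset.mem_univ i)]
  have : (Polynomial.aeval (X i : MvPolynomial (Fin n) K)).comp
      (aeval (fun _ => (Polynomial.X : Polynomial K))) = collapseVars K Finset.univ i := by
    ext k : 1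
    simp
  rw [← this, AlgHom.comp_apply, h, map_zero]

theorem map_mk_lt_map_mk {R : Type*} [CommRing R] {I Q Q' : Ideal R} (hI : I ≤ Q) (h : Q < Q') :
    Q.map (Ideal.Quotient.mk I) < Q'.map (Ideal.Quotient.mk I) := by
  refine lt_of_le_not_ge (Ideal.map_mono h.le) fun h' => h.not_ge ?_
  rw [← Ideal.comap_map_mk hI]
  exact Ideal.map_le_iff_le_comap.mp h'

theorem map_mk_isPrime {R : Type*} [CommRing R] {I Q : Ideal R} (hI : I ≤ Q) [Q.IsPrime] :
    (Q.map (Ideal.Quotient.mk I)).IsPrime :=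
  Ideal.map_isPrime_of_surjective Ideal.Quotient.mk_surjective (by simpa using hI)

theorem two_le_height_map_mk {R : Type*} [CommRing R] {I Q₀ Q₁ Q₂ : Ideal R} [Q₀.IsPrime]
    [Q₁.IsPrime] [Q₂.IsPrime] (hI : I ≤ Q₀) (h₁ : Q₀ < Q₁) (h₂ : Q₁ < Q₂) :
    2 ≤ (Q₂.map (Ideal.Quotient.mk I)).height := by
  have := map_mk_isPrime hI
  have := map_mk_isPrime (hI.trans h₁.le)
  have := map_mk_isPrime (hI.trans (h₁.le.trans h₂.le))
  have h3 := Ideal.height_add_one_le_of_lt_of_isPrime (map_mk_lt_map_mk hI h₁)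
  have h4 := Ideal.height_add_one_le_of_lt_of_isPrime (map_mk_lt_map_mk (hI.trans h₁.le) h₂)
  refine le_trans ?_ h4
  rw [← one_add_one_eq_two]
  exact add_le_add_left (le_add_self.trans h3) 1

/-- In characteristic two, the multiples by `X i ^ 2` of the differences of the coordinates are,
on the coordinate planes, polynomials in the differences of the coordinates. -/
theorem exists_sub_sq_mul_mem (h2 : (2 : K) = 0) (hn : 5 ≤ n) (o i j : Fin n) :
    ∃ c : MvPolynomial (Fin n) K, shiftVar K o c = Polynomial.C c ∧
      c - X i ^ 2 * (X i - X j) ∈ planesIdeal K n := by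
  rcases eq_or_ne j i with rfl | hji
  · exact ⟨0, by simp⟩
  obtain ⟨l, hli, hlj⟩ := exists_fin_ne_two (by omega) i j
  obtain ⟨m, hmi, hmj, hml⟩ := exists_fin_ne_three (by omega) i j l
  obtain ⟨p, hpi, hpj, hpl, hpm⟩ := exists_fin_ne_four hn i j l m
  refine ⟨(X i - X j) * ((X i - X l) * (X i - X m) + (X i - X p) * (X l - X m)), ?_, ?_⟩
  · simp only [map_mul, map_add, shiftVar_sub]
  · have h2' : (2 : MvPolynomial (Fin n) K) = 0 := by
      rw [show (2 : MvPolynomial (Fin n) K) = C 2 from (map_ofNat C 2).symm, h2, map_zero]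
    have h : (X i - X j) * ((X i - X l) * (X i - X m) + (X i - X p) * (X l - X m)) -
        X i ^ 2 * (X i - X j) = X i * X l * X m - X i * X p * X l + X i * X p * X m -
        X j * X l * X m + X j * X p * X l - (X j * X p * X m : MvPolynomial (Fin n) K) := by
      linear_combination (-(X i - X j) * X i * X m) * h2'
    rw [h]
    have hm := fun {a b c : Fin n} => X_mul_X_mul_X_mem_planesIdeal (K := K) (a := a) (b := b) (c := c)
    exact sub_mem (add_mem (sub_mem (add_mem (sub_mem (hm hli.symm hmi.symm hml.symm)
      (hm hpi.symm hli.symm hpl)) (hm hpi.symm hmi.symm hpm)) (hm hlj.symm hmj.symm hml.symm))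
      (hm hpj.symm hlj.symm hpl)) (hm hpj.symm hmj.symm hpm)

theorem mem_PFIdeal_univ_of_coeff_mem (o i : Fin n) (hn : 2 ≤ n) {s t : MvPolynomial (Fin n) K}
    (h : ∀ d, (shiftVar K o s * Polynomial.C (X i ^ 2) - shiftVar K o t).coeff d ∈
      planesIdeal K n) : s ∈ PFIdeal K (Finset.univ : Finset (Fin n)) := by
  refine mem_PFIdeal_univ_of_aeval_eq_zero (i := i) ?_
  let ev : MvPolynomial (Fin n) K →ₐ[K] Polynomial K := aeval fun _ => Polynomial.X
  have hJ : planesIdeal K n ≤ (Ideal.span {(Polynomial.X : Polynomial K) ^ 3}).comap ev := by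
    refine planesIdeal_le hn fun a b c _ _ _ => ?_
    rw [Ideal.mem_comap, Ideal.mem_span_singleton]
    simp only [map_mul, ev, aeval_X]
    exact ⟨1, by ring⟩
  have hev : ∀ f d, ev ((shiftVar K o f).coeff d) = Polynomial.C ((ev f).coeff d) := by
    intro f d
    have : (Polynomial.mapAlgHom ev).comp (shiftVar K o) =
        (Polynomial.mapAlgHom (Algebra.ofId K (Polynomial K))).comp ev := by
      ext k : 1
      simp [ev]
    have := congrArg (fun p => Polynomial.coeff p d) (DFunLike.congr_fun this f)
    simpa [Algebra.ofId_apply] using this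
  ext d
  have h1 := hJ (h d)
  rw [Ideal.mem_comap, Ideal.mem_span_singleton, Polynomial.X_pow_dvd_iff] at h1
  have h2 := h1 2 (by norm_num)
  rw [Polynomial.coeff_sub, Polynomial.coeff_mul_C, map_sub, map_mul, hev, hev] at h2
  simpa [ev] using h2

theorem not_isCohenMacaulayRing_quotient_InkIdeal (h2 : (2 : K) = 0) (hn : 5 ≤ n) :
    ¬ IsCohenMacaulayRing (MvPolynomial (Fin n) K ⧸ InkIdeal K n (n - 2)) := by
  classical
  intro hCM
  set I := InkIdeal K n (n - 2) with hI
  let i : Fin n := ⟨0, by omega⟩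
  obtain ⟨j, hji, -⟩ := exists_fin_ne_two (by omega) i i
  obtain ⟨l, hli, hlj⟩ := exists_fin_ne_two (by omega) i j
  have hne₀ : ({i, j}ᶜ : Finset (Fin n)).Nonempty := ⟨l, by simp [hli, hlj]⟩
  have hne₁ : ({i}ᶜ : Finset (Fin n)).Nonempty := ⟨l, by simp [hli]⟩
  have hne₂ : (Finset.univ : Finset (Fin n)).Nonempty := ⟨l, by simp⟩
  have hP₀ := PFIdeal_isPrime (K := K) hne₀
  have hP₁ := PFIdeal_isPrime (K := K) hne₁
  have hP₂ := PFIdeal_isPrime (K := K) hne₂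
  have hle₀ : I ≤ PFIdeal K {i, j}ᶜ := InkIdeal_le_PFIdeal (by omega) (Finset.card_pair hji.symm)
  have hle : I ≤ PFIdeal K Finset.univ := hle₀.trans (PFIdeal_mono (Finset.subset_univ _))
  have hlt₁ : PFIdeal K ({i, j}ᶜ : Finset (Fin n)) < PFIdeal K {i}ᶜ :=
    lt_of_le_not_ge (PFIdeal_mono (by simp)) fun h => by
      have := h (sub_mem_PFIdeal (a := j) (b := l) (by simpa using hji) (by simpa using hli))
      exact absurd ((sub_mem_PFIdeal_iff hne₀ hlj.symm).mp this).1 (by simp)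
  have hlt₂ : PFIdeal K ({i}ᶜ : Finset (Fin n)) < PFIdeal K Finset.univ :=
    lt_of_le_not_ge (PFIdeal_mono (Finset.subset_univ _)) fun h => by
      have := h (sub_mem_PFIdeal (Finset.mem_univ i) (Finset.mem_univ j))
      exact absurd ((sub_mem_PFIdeal_iff hne₁ hji.symm).mp this).1 (by simp)
  set P := (PFIdeal K (Finset.univ : Finset (Fin n))).map (Ideal.Quotient.mk I) with hP
  have hPp : P.IsPrime := map_mk_isPrime hle
  have hmemP : ∀ f, Ideal.Quotient.mk I f ∈ P ↔ f ∈ PFIdeal K (Finset.univ : Finset (Fin n)) := by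
    intro f
    rw [← Ideal.mem_comap, hP, Ideal.comap_map_mk hle]
  let A := Localization.AtPrime P
  let φ : MvPolynomial (Fin n) K →+* A :=
    (algebraMap (MvPolynomial (Fin n) K ⧸ I) A).comp (Ideal.Quotient.mk I)
  have hdepth : 2 ≤ ringDepth A := by
    have h := hCM P
    rw [IsLocalization.AtPrime.ringKrullDim_eq_height P (Localization.AtPrime P)] at h
    have h' : ringDepth A = P.height := WithBot.coe_injective h
    rw [h']
    exact two_le_height_map_mk hle₀ hlt₁ hlt₂
  have hjac : ∀ x ∈ (⊥ : Ideal A).jacobson, x ∈ Ideal.span (Set.range fun k => φ (X i - X k)) := by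
    intro x hx
    have hx' := mem_map_algebraMap_of_mem_jacobson P hx
    have hspan : P.map (algebraMap _ A) = Ideal.span (Set.range fun k => φ (X i - X k)) := by
      refine (Ideal.map_map _ _).trans ?_
      rw [PFIdeal_univ_eq_span i, Ideal.map_span, ← Set.range_comp]
      rfl
    rwa [← hspan]
  obtain ⟨a, ha, b, hb, hreg, hreg'⟩ := exists_isWeaklyRegular_pair_of_two_le_ringDepth hdepth
  choose c hcC hcJ using exists_sub_sq_mul_mem h2 hn i i
  have hcc : ∀ k m, φ (X i - X k) * φ (c m) = φ (X i - X m) * φ (c k) := by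
    intro k m
    rw [← sub_eq_zero, ← map_mul φ, ← map_mul φ, ← map_sub φ]
    have : (X i - X k) * c m - (X i - X m) * c k ∈ I := by
      rw [hI, mem_InkIdeal_iff_coeff (by omega) i]
      intro d
      rw [map_sub, map_mul, map_mul, shiftVar_sub, shiftVar_sub, hcC, hcC, ← map_mul, ← map_mul,
        ← map_sub, Polynomial.coeff_C]
      split_ifs
      · have : (X i - X k) * c m - (X i - X m) * c k = (X i - X k) * (c m - X i ^ 2 * (X i - X m)) -
            (X i - X m) * (c k - X i ^ 2 * (X i - X k)) := by ring
        rw [this]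
        exact sub_mem (Ideal.mul_mem_left _ _ (hcJ m)) (Ideal.mul_mem_left _ _ (hcJ k))
      · exact Ideal.zero_mem _
    rw [RingHom.comp_apply, Ideal.Quotient.eq_zero_iff_mem.mpr this, map_zero]
  obtain ⟨w, hw⟩ := exists_eq_mul_of_mul_eq_mul hcc (hjac a ha) (hjac b hb) hreg hreg'
  obtain ⟨s, t, hsP, hu⟩ :=
    exists_mul_sub_mul_eq_zero_of_localization Ideal.Quotient.mk_surjective P hw
  rw [hmemP] at hsP
  simp only [hmemP, Ideal.Quotient.eq_zero_iff_mem] at hu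
  refine hsP (mem_PFIdeal_univ_of_coeff_mem i i (by omega) (t := t) fun d => ?_)
  rw [mem_planesIdeal]
  intro e he
  obtain ⟨k, hk⟩ : ∃ k, restrictVars K e (X i - X k) ≠ 0 := by
    by_cases hie : i ∈ e
    · obtain ⟨k, hk⟩ := exists_fin_notMem (s := e) (by omega)
      exact ⟨k, by simp [hie, hk]⟩
    · obtain ⟨k, hk⟩ : e.Nonempty := Finset.card_pos.mp (by omega)
      exact ⟨k, by simp [hie, hk]⟩
  obtain ⟨u, huP, hu⟩ := hu k
  have hene : eᶜ.Nonempty := by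
    rw [← Finset.card_pos, Finset.card_compl, he, Fintype.card_fin]
    omega
  have h1 := (mem_PFIdeal_compl_iff i hene).mp ((mem_InkIdeal_iff (by omega)).mp hu e he)
  have hu0 : (shiftVar K i u).map
      (restrictVars K e : MvPolynomial (Fin n) K →+* MvPolynomial (Fin n) K) ≠ 0 := fun h0 =>
    huP (PFIdeal_mono (Finset.subset_univ _) ((mem_PFIdeal_compl_iff i hene).mpr h0))
  have hck : restrictVars K e (c k) = restrictVars K e (X i ^ 2) * restrictVars K e (X i - X k) := by
    rw [← map_mul, ← sub_eq_zero, ← map_sub]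
    exact mem_planesIdeal.mp (hcJ k) e he
  rw [map_mul, Polynomial.map_mul] at h1
  have h3 := (mul_eq_zero.mp h1).resolve_left hu0
  have h4 : (shiftVar K i s * Polynomial.C (X i ^ 2) - shiftVar K i t).map
      (restrictVars K e : MvPolynomial (Fin n) K →+* MvPolynomial (Fin n) K) *
      Polynomial.C (restrictVars K e (X i - X k)) = 0 := by
    rw [← h3, map_sub (shiftVar K i), map_mul (shiftVar K i), map_mul (shiftVar K i), hcC,
      shiftVar_sub]
    simp only [Polynomial.map_sub, Polynomial.map_mul, Polynomial.map_C, RingHom.coe_coe, hck]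
    rw [Polynomial.C_mul]
    ring
  have h5 := (mul_eq_zero.mp h4).resolve_right (by simpa only [Ne, Polynomial.C_eq_zero] using hk)
  have h6 := congrArg (fun q => Polynomial.coeff q d) h5
  rwa [Polynomial.coeff_map, Polynomial.coeff_zero] at h6

end CharTwo

section Connectivity

variable {α : Type*}

theorem pair_induction_of_replace {P : α → α → Prop}
    (hswap : ∀ a b, a ≠ b → P a b → P b a)
    (hrep : ∀ a b c, [a, b, c].Nodup → P a b → P a c)
    {a b a' b' : α} (hab : a ≠ b) (hab' : a' ≠ b') (h : P a b) : P a' b' := by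
  have h1 : ∃ c, a' ≠ c ∧ P a' c := by
    by_cases haa : a' = a
    · exact ⟨b, haa ▸ hab, haa ▸ h⟩
    by_cases hb : a' = b
    · exact ⟨a, haa, hb ▸ hswap a b hab h⟩
    · exact ⟨a, haa, hswap a a' (Ne.symm haa) (hrep a b a' (by grind) h)⟩
  obtain ⟨c, hc, h2⟩ := h1
  by_cases hbc : b' = c
  · exact hbc ▸ h2
  · exact hrep a' c b' (by grind) h2

theorem triple_induction_of_replace {P : α → α → α → Prop}
    (hswap : ∀ a b c, [a, b, c].Nodup → P a b c → P b a c)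
    (hswap' : ∀ a b c, [a, b, c].Nodup → P a b c → P a c b)
    (hrep : ∀ a b c d, [a, b, c, d].Nodup → P a b c → P a b d)
    {a b c a' b' c' : α} (habc : [a, b, c].Nodup) (habc' : [a', b', c'].Nodup)
    (h : P a b c) : P a' b' c' := by
  have h1 : ∃ d e, [a', d, e].Nodup ∧ P a' d e := by
    by_cases ha : a' = a
    · exact ⟨b, c, ha ▸ habc, ha ▸ h⟩
    by_cases hb : a' = b
    · exact ⟨a, c, by grind, hb ▸ hswap a b c habc h⟩
    have h2 : P a b a' := by
      by_cases hc : a' = c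
      · exact hc ▸ h
      · exact hrep a b c a' (by grind) h
    exact ⟨a, b, by grind, hswap a a' b (by grind) (hswap' a b a' (by grind) h2)⟩
  obtain ⟨d, e, hde, h2⟩ := h1
  have hmem : ∀ x y z : {x // x ≠ a'}, [x, y, z].Nodup → [a', x.1, y.1, z.1].Nodup := by
    intro x y z h
    have := x.2
    have := y.2
    have := z.2
    simp only [List.nodup_cons, List.mem_cons, List.not_mem_nil, Subtype.ext_iff] at h ⊢
    grind
  exact pair_induction_of_replace (α := {x // x ≠ a'}) (P := fun x y => P a' x.1 y.1)
    (fun x y hxy => hswap' a' x y (by grind))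
    (fun x y z hxyz => hrep a' x y z (hmem x y z hxyz)) (a := ⟨d, by grind⟩) (b := ⟨e, by grind⟩)
    (a' := ⟨b', by grind⟩) (b' := ⟨c', by grind⟩) (by grind) (by grind) h2

end Connectivity

section SpechtProducts

theorem nodup_six_iff {α : Type*} {a b c d e f : α} : [a, b, c, d, e, f].Nodup ↔
    (a ≠ b ∧ a ≠ c ∧ a ≠ d ∧ a ≠ e ∧ a ≠ f) ∧ (b ≠ c ∧ b ≠ d ∧ b ≠ e ∧ b ≠ f) ∧
      (c ≠ d ∧ c ≠ e ∧ c ≠ f) ∧ (d ≠ e ∧ d ≠ f) ∧ e ≠ f := by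
  simp

theorem nodup_five_iff {α : Type*} {a b c d e : α} : [a, b, c, d, e].Nodup ↔
    (a ≠ b ∧ a ≠ c ∧ a ≠ d ∧ a ≠ e) ∧ (b ≠ c ∧ b ≠ d ∧ b ≠ e) ∧ (c ≠ d ∧ c ≠ e) ∧ d ≠ e := by
  simp

variable {ι A : Type*} [CommRing A] {y : ι → A} {S U V : Ideal A}

/-- The ideal `S` contains the products of differences of the entries of `y` attached to the
partitions `(n - 3, 3)` and `(2, 2, 1)`. -/
structure ContainsSpechtProducts (y : ι → A) (S : Ideal A) : Prop where
  three_pairs_mem : ∀ a b c d e f, [a, b, c, d, e, f].Nodup →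
    (y a - y b) * (y c - y d) * (y e - y f) ∈ S
  triple_pair_mem : ∀ a b c d e, [a, b, c, d, e].Nodup →
    (y a - y b) * (y a - y c) * (y b - y c) * (y d - y e) ∈ S

/-- A product of four differences, of which two involve `i` and two involve `j`. -/
def quarticProd (y : ι → A) (i j k l m : ι) : A :=
  (y i - y k) * (y i - y l) * (y j - y m) * (y j - y l)

/-- A product of three differences, of which two involve `i`. -/
def cubicProd (y : ι → A) (i j k l m : ι) : A :=
  (y i - y l) * (y i - y m) * (y j - y k)

theorem ContainsSpechtProducts.sub_mul_quarticProd_mem (hS : ContainsSpechtProducts y S)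
    {i j k l m : ι} (h : [i, j, k, l, m].Nodup) {a b : ι} (ha : a ≠ i ∧ a ≠ j) (hb : b ≠ i ∧ b ≠ j) :
    (y a - y b) * quarticProd y i j k l m ∈ S := by
  have key : ∀ b, b ≠ i ∧ b ≠ j → (y l - y b) * quarticProd y i j k l m ∈ S := by
    rintro b ⟨hbi, hbj⟩
    by_cases hbl : b = l
    · simp [hbl]
    by_cases hbk : b = k
    · have : (y l - y b) * quarticProd y i j k l m =
          -(y j - y l) * ((y i - y k) * (y i - y l) * (y k - y l) * (y j - y m)) := by
        rw [hbk, quarticProd]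
        ring
      rw [this]
      exact S.mul_mem_left _ (hS.triple_pair_mem _ _ _ _ _ (by grind))
    by_cases hbm : b = m
    · have : (y l - y b) * quarticProd y i j k l m =
          (y i - y l) * ((y j - y l) * (y j - y m) * (y l - y m) * (y i - y k)) := by
        rw [hbm, quarticProd]
        ring
      rw [this]
      exact S.mul_mem_left _ (hS.triple_pair_mem _ _ _ _ _ (by grind))
    · have : (y l - y b) * quarticProd y i j k l m =
          (y i - y l) * (y j - y l) * ((y l - y b) * (y i - y k) * (y j - y m)) := by
        rw [quarticProd]
        ring
      rw [this]
      exact S.mul_mem_left _ (hS.three_pairs_mem _ _ _ _ _ _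
        (by grind only [nodup_six_iff, nodup_five_iff]))
  have : (y a - y b) * quarticProd y i j k l m =
      (y l - y b) * quarticProd y i j k l m - (y l - y a) * quarticProd y i j k l m := by ring
  rw [this]
  exact sub_mem (key b hb) (key a ha)

theorem ContainsSpechtProducts.quarticProd_sub_mem (hS : ContainsSpechtProducts y S)
    {i j k l m k' l' m' : ι} (h : [i, j, k, l, m].Nodup) (h' : [i, j, k', l', m'].Nodup) :
    quarticProd y i j k' l' m' - quarticProd y i j k l m ∈ S := by
  have hmem : ∀ a b c : {x // x ≠ i ∧ x ≠ j}, [a, b, c].Nodup → [i, j, a.1, b.1, c.1].Nodup := by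
    intro a b c habc
    have := a.2
    have := b.2
    have := c.2
    simp only [List.nodup_cons, List.mem_cons, List.not_mem_nil, Subtype.ext_iff] at habc ⊢
    grind
  have hmem' : ∀ a b c d : {x // x ≠ i ∧ x ≠ j}, [a, b, c, d].Nodup →
      [i, j, a.1, b.1, c.1, d.1].Nodup := by
    intro a b c d habc
    have := a.2
    have := b.2
    have := c.2
    have := d.2
    simp only [List.nodup_cons, List.mem_cons, List.not_mem_nil, Subtype.ext_iff] at habc ⊢
    grind
  refine triple_induction_of_replace (α := {x // x ≠ i ∧ x ≠ j})
    (P := fun a b c => quarticProd y i j a b c - quarticProd y i j k l m ∈ S)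
    (a := ⟨k, by grind⟩) (b := ⟨l, by grind⟩) (c := ⟨m, by grind⟩) (a' := ⟨k', by grind⟩)
    (b' := ⟨l', by grind⟩) (c' := ⟨m', by grind⟩) ?_ ?_ ?_ (by grind) (by grind) (by simp)
  · intro a b c habc hP
    have habc := hmem a b c habc
    have : quarticProd y i j b a c - quarticProd y i j k l m =
        (quarticProd y i j a b c - quarticProd y i j k l m) -
        (y i - y a) * (y i - y b) * (y a - y b) * (y j - y c) := by
      simp only [quarticProd]
      ring
    rw [this]
    exact sub_mem hP (hS.triple_pair_mem _ _ _ _ _ (by grind))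
  · intro a b c habc hP
    have habc := hmem a b c habc
    have : quarticProd y i j a c b - quarticProd y i j k l m =
        (quarticProd y i j a b c - quarticProd y i j k l m) +
        (y j - y b) * (y j - y c) * (y b - y c) * (y i - y a) := by
      simp only [quarticProd]
      ring
    rw [this]
    exact add_mem hP (hS.triple_pair_mem _ _ _ _ _ (by grind))
  · intro a b c d habc hP
    have habc := hmem' a b c d habc
    have : quarticProd y i j a b d - quarticProd y i j k l m =
        (quarticProd y i j a b c - quarticProd y i j k l m) +
        (y i - y b) * ((y i - y a) * (y j - y b) * (y c - y d)) := by
      simp only [quarticProd]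
      ring
    rw [this]
    exact add_mem hP (S.mul_mem_left _ (hS.three_pairs_mem _ _ _ _ _ _ (by grind)))

theorem quarticProd_swap (i j k l m : ι) : quarticProd y j i m l k = quarticProd y i j k l m := by
  simp only [quarticProd]
  ring

theorem ContainsSpechtProducts.sub_mul_cubicProd_mem (hS : ContainsSpechtProducts y S)
    (hSU : S ≤ U) (hU : ∀ i j k l m, [i, j, k, l, m].Nodup → quarticProd y i j k l m ∈ U)
    {i j k l m : ι} (h : [i, j, k, l, m].Nodup) {a b : ι} (ha : a ≠ i) (hb : b ≠ i) :
    (y a - y b) * cubicProd y i j k l m ∈ U := by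
  have key : ∀ b, b ≠ i → (y m - y b) * cubicProd y i j k l m ∈ U := by
    intro b hbi
    by_cases hbm : b = m
    · simp [hbm]
    by_cases hbj : b = j
    · have : (y m - y b) * cubicProd y i j k l m = -quarticProd y i j l m k := by
        rw [hbj, quarticProd, cubicProd]
        ring
      rw [this]
      exact neg_mem (hU _ _ _ _ _ (by grind))
    by_cases hbk : b = k
    · have : (y m - y b) * cubicProd y i j k l m = quarticProd y i k l m j := by
        rw [hbk, quarticProd, cubicProd]
        ring
      rw [this]
      exact hU _ _ _ _ _ (by grind)
    by_cases hbl : b = l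
    · have : (y m - y b) * cubicProd y i j k l m =
          -((y i - y l) * (y i - y m) * (y l - y m) * (y j - y k)) := by
        rw [hbl, cubicProd]
        ring
      rw [this]
      exact neg_mem (hSU (hS.triple_pair_mem _ _ _ _ _ (by grind)))
    · have : (y m - y b) * cubicProd y i j k l m =
          (y i - y m) * ((y m - y b) * (y i - y l) * (y j - y k)) := by
        rw [cubicProd]
        ring
      rw [this]
      exact U.mul_mem_left _ (hSU (hS.three_pairs_mem _ _ _ _ _ _ (by grind)))
  have : (y a - y b) * cubicProd y i j k l m =
      (y m - y b) * cubicProd y i j k l m - (y m - y a) * cubicProd y i j k l m := by ring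
  rw [this]
  exact sub_mem (key b hb) (key a ha)

theorem ContainsSpechtProducts.cubicProd_sub_mem (hS : ContainsSpechtProducts y S)
    {i j k l m l' m' : ι} (h : [i, j, k, l, m].Nodup) (h' : [i, j, k, l', m'].Nodup) :
    cubicProd y i j k l' m' - cubicProd y i j k l m ∈ S := by
  refine pair_induction_of_replace (α := {x // x ≠ i ∧ x ≠ j ∧ x ≠ k})
    (P := fun a b => cubicProd y i j k a b - cubicProd y i j k l m ∈ S)
    (a := ⟨l, by grind⟩) (b := ⟨m, by grind⟩) (a' := ⟨l', by grind⟩) (b' := ⟨m', by grind⟩)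
    ?_ ?_ (by grind) (by grind) (by simp)
  · intro a b _ hP
    have : cubicProd y i j k b a = cubicProd y i j k a b := by
      simp only [cubicProd]
      ring
    rwa [this]
  · rintro ⟨a, ha⟩ ⟨b, hb⟩ ⟨c, hc⟩ habc hP
    simp only [List.nodup_cons, List.mem_cons, List.not_mem_nil, Subtype.ext_iff] at habc
    have : cubicProd y i j k a c - cubicProd y i j k l m =
        (cubicProd y i j k a b - cubicProd y i j k l m) +
        (y i - y a) * (y j - y k) * (y b - y c) := by
      simp only [cubicProd]
      ring
    rw [this]
    exact add_mem hP (hS.three_pairs_mem _ _ _ _ _ _ (by grind))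

theorem ContainsSpechtProducts.cubicProd_mem (hS : ContainsSpechtProducts y S) (hSV : S ≤ V)
    {κ : ι → ι} (hκ : ∀ i, κ i ≠ i)
    (hV : ∀ i j, j ≠ i → j ≠ κ i → ∃ l m, [i, j, κ i, l, m].Nodup ∧ cubicProd y i j (κ i) l m ∈ V)
    {i j k l m : ι} (h : [i, j, k, l, m].Nodup) : cubicProd y i j k l m ∈ V := by
  have h1 : ∀ {j l m}, [i, j, κ i, l, m].Nodup → cubicProd y i j (κ i) l m ∈ V := by
    intro j l m h
    obtain ⟨l', m', h', hmem⟩ := hV i j (by grind) (by grind)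
    rw [← sub_add_cancel (cubicProd y i j (κ i) l m) (cubicProd y i j (κ i) l' m')]
    exact add_mem (hSV (hS.cubicProd_sub_mem h' h)) hmem
  have hi := hκ i
  by_cases hk : k = κ i
  · subst hk
    exact h1 h
  by_cases hj : j = κ i
  · have : cubicProd y i j k l m = -cubicProd y i k (κ i) l m := by
      rw [hj, cubicProd, cubicProd]
      ring
    rw [this]
    exact neg_mem (h1 (by grind))
  have h2 : ∃ p, [i, j, k, κ i, p].Nodup := by
    by_cases hl : l = κ i
    · exact ⟨m, by grind⟩
    · exact ⟨l, by grind⟩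
  obtain ⟨p, hp⟩ := h2
  have : cubicProd y i j k l m = (cubicProd y i j k l m - cubicProd y i j k (κ i) p) +
      (cubicProd y i j (κ i) k p - cubicProd y i k (κ i) j p) := by
    simp only [cubicProd]
    ring
  rw [this]
  exact add_mem (hSV (hS.cubicProd_sub_mem hp h)) (sub_mem (h1 (by grind)) (h1 (by grind)))

theorem sub_mul_prod_mem_of_cubicProd_mem
    (hV : ∀ i j k l m, [i, j, k, l, m].Nodup → cubicProd y i j k l m ∈ V)
    {i k l m p : ι} (h : [i, k, l, m, p].Nodup) {a b : ι} (ha : a ≠ i) (hb : b ≠ i) :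
    (y a - y b) * ((y i - y k) * (y i - y l) * (y i - y m)) ∈ V := by
  have key : ∀ b, b ≠ i → (y p - y b) * ((y i - y k) * (y i - y l) * (y i - y m)) ∈ V := by
    intro b hbi
    by_cases hbp : b = p
    · simp [hbp]
    by_cases hbl : b = k ∨ b = l
    · have : ∃ c, (c = k ∨ c = l) ∧ c ≠ b ∧
          (y p - y b) * ((y i - y k) * (y i - y l) * (y i - y m)) =
          (y i - y b) * cubicProd y i p b c m := by
        rcases hbl with rfl | rfl
        · exact ⟨l, by grind, by grind, by rw [cubicProd]; ring⟩
        · exact ⟨k, by grind, by grind, by rw [cubicProd]; ring⟩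
      obtain ⟨c, hc, hcb, this⟩ := this
      rw [this]
      exact V.mul_mem_left _ (hV _ _ _ _ _ (by grind))
    · have : (y p - y b) * ((y i - y k) * (y i - y l) * (y i - y m)) =
          (y i - y m) * cubicProd y i p b k l := by
        rw [cubicProd]
        ring
      rw [this]
      exact V.mul_mem_left _ (hV _ _ _ _ _ (by grind))
  have : (y a - y b) * ((y i - y k) * (y i - y l) * (y i - y m)) =
      (y p - y b) * ((y i - y k) * (y i - y l) * (y i - y m)) -
      (y p - y a) * ((y i - y k) * (y i - y l) * (y i - y m)) := by ring
  rw [this]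
  exact sub_mem (key b hb) (key a ha)

theorem prod_sub_mem_of_cubicProd_mem
    (hV : ∀ i j k l m, [i, j, k, l, m].Nodup → cubicProd y i j k l m ∈ V)
    {i k l m k' l' m' : ι} (h : [i, k, l, m].Nodup) (h' : [i, k', l', m'].Nodup) :
    (y i - y k') * (y i - y l') * (y i - y m') - (y i - y k) * (y i - y l) * (y i - y m) ∈ V := by
  refine triple_induction_of_replace (α := {x // x ≠ i})
    (P := fun a b c => (y i - y a) * (y i - y b) * (y i - y c) -
      (y i - y k) * (y i - y l) * (y i - y m) ∈ V)
    (a := ⟨k, by grind⟩) (b := ⟨l, by grind⟩) (c := ⟨m, by grind⟩) (a' := ⟨k', by grind⟩)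
    (b' := ⟨l', by grind⟩) (c' := ⟨m', by grind⟩) ?_ ?_ ?_ (by grind) (by grind) (by simp)
  · intro a b c _ hP
    rwa [mul_comm (y i - y b)]
  · intro a b c _ hP
    rwa [mul_right_comm]
  · rintro ⟨a, ha⟩ ⟨b, hb⟩ ⟨c, hc⟩ ⟨d, hd⟩ habc hP
    simp only [List.nodup_cons, List.mem_cons, List.not_mem_nil, Subtype.ext_iff] at habc
    have : (y i - y a) * (y i - y b) * (y i - y d) - (y i - y k) * (y i - y l) * (y i - y m) =
        ((y i - y a) * (y i - y b) * (y i - y c) - (y i - y k) * (y i - y l) * (y i - y m)) +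
        cubicProd y i c d a b := by
      simp only [cubicProd]
      ring
    rw [this]
    exact add_mem hP (hV _ _ _ _ _ (by grind))

/-- Remove the generators `g` from an ideal by testing membership in the ideals `N`. -/
theorem le_of_le_sup_span_range {τ : Type*} [Fintype τ] [DecidableEq τ] {I : Ideal A} {g : τ → A}
    {N : τ → Ideal A} (hI : ∀ t, I ≤ N t) (hS : ∀ t, S ≤ N t) (hg : ∀ t t', t' ≠ t → g t' ∈ N t)
    (hNS : ∀ t r, r * g t ∈ N t → r * g t ∈ S) (h : I ≤ S ⊔ Ideal.span (Set.range g)) : I ≤ S := by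
  intro f hf
  obtain ⟨s, hs, f', hf', rfl⟩ := Submodule.mem_sup.mp (h hf)
  obtain ⟨r, rfl⟩ := Ideal.mem_span_range_iff_exists_fun.mp hf'
  refine add_mem hs (sum_mem fun t _ => hNS t _ ?_)
  have h1 : s + ∑ t', r t' * g t' ∈ N t := hI t hf
  rw [← Finset.add_sum_erase _ _ (Finset.mem_univ t)] at h1
  have h2 : ∑ t' ∈ Finset.univ.erase t, r t' * g t' ∈ N t :=
    sum_mem fun t' ht' => (N t).mul_mem_left _ (hg t t' (Finset.ne_of_mem_erase ht'))
  have h3 : r t * g t =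
      s + (r t * g t + ∑ t' ∈ Finset.univ.erase t, r t' * g t') - s -
        ∑ t' ∈ Finset.univ.erase t, r t' * g t' := by ring
  rw [h3]
  exact sub_mem (sub_mem h1 (hS t hs)) h2

end SpechtProducts

section InkIdealGenerators

variable {K : Type*} [Field K] {n : ℕ}

theorem mul_mem_of_mem_PFIdeal {F : Finset (Fin n)} {S : Ideal (MvPolynomial (Fin n) K)}
    {g : MvPolynomial (Fin n) K} (h : ∀ a ∈ F, ∀ b ∈ F, (X a - X b) * g ∈ S)
    {r : MvPolynomial (Fin n) K} (hr : r ∈ PFIdeal K F) : r * g ∈ S := by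
  induction hr using Submodule.span_induction with
  | mem x hx =>
    obtain ⟨a, ha, b, hb, rfl⟩ := hx
    exact h a ha b hb
  | zero => simp
  | add x y _ _ hx hy =>
    rw [add_mul]
    exact add_mem hx hy
  | smul c x _ hx =>
    rw [smul_eq_mul, mul_assoc]
    exact S.mul_mem_left c hx

theorem InkIdeal_le_of_prod_mem (hn : 3 ≤ n) (o : Fin n) {W : Ideal (MvPolynomial (Fin n) K)}
    (hW : ∀ a b c, [o, a, b, c].Nodup → (X o - X a) * (X o - X b) * (X o - X c) ∈ W) :
    InkIdeal K n (n - 2) ≤ W := by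
  have hJ : planesIdeal K n ≤ W.comap (subVar K o) := by
    refine planesIdeal_le (by omega) fun a b c hab hac hbc => ?_
    rw [Ideal.mem_comap]
    simp only [map_mul, subVar_X]
    by_cases ha : a = o
    · simp [ha]
    by_cases hb : b = o
    · simp [hb]
    by_cases hc : c = o
    · simp [hc]
    rw [show (X a - X o) * (X b - X o) * (X c - X o) =
      -((X o - X a) * (X o - X b) * (X o - X c) : MvPolynomial (Fin n) K) by ring]
    exact neg_mem (hW a b c (by grind))
  intro f hf
  have hcoeff := (mem_InkIdeal_iff_coeff hn o).mp hf
  let ψ : Polynomial (MvPolynomial (Fin n) K) →ₐ[K] MvPolynomial (Fin n) K :=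
    Polynomial.eval₂AlgHom (subVar K o) (X o) (fun _ => Commute.all _ _)
  have hψ : ψ.comp (shiftVar K o) = AlgHom.id K _ := by
    ext k : 1
    simp [ψ]
  have h1 : ψ (shiftVar K o f) = f := DFunLike.congr_fun hψ f
  rw [← h1]
  change Polynomial.eval₂ (subVar K o : MvPolynomial (Fin n) K →+* MvPolynomial (Fin n) K)
    (X o) (shiftVar K o f) ∈ W
  rw [Polynomial.eval₂_eq_sum, Polynomial.sum_def]
  exact sum_mem fun d _ => W.mul_mem_right _ (hJ (hcoeff d))

theorem quarticProd_mem_PFIdeal_compl_singleton (o : Fin n) {i j k l m : Fin n}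
    (h : [i, j, k, l, m].Nodup) :
    quarticProd (X : Fin n → MvPolynomial (Fin n) K) i j k l m ∈ PFIdeal K {o}ᶜ := by
  have hF : ∀ a b : Fin n, a ≠ o → b ≠ o →
      (X a - X b : MvPolynomial (Fin n) K) ∈ PFIdeal K {o}ᶜ :=
    fun a b ha hb => sub_mem_PFIdeal (by simpa using ha) (by simpa using hb)
  rw [quarticProd]
  have : (i ≠ o ∧ k ≠ o) ∨ (i ≠ o ∧ l ≠ o) ∨ (j ≠ o ∧ m ≠ o) := by grind
  rcases this with h | h | h
  · exact Ideal.mul_mem_right _ _ (Ideal.mul_mem_right _ _ (Ideal.mul_mem_right _ _ (hF _ _ h.1 h.2)))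
  · exact Ideal.mul_mem_right _ _ (Ideal.mul_mem_right _ _ (Ideal.mul_mem_left _ _ (hF _ _ h.1 h.2)))
  · exact Ideal.mul_mem_right _ _ (Ideal.mul_mem_left _ _ (hF _ _ h.1 h.2))

theorem cubicProd_mem_PFIdeal_compl_singleton (o : Fin n) {i j k l m : Fin n}
    (h : [i, j, k, l, m].Nodup) :
    cubicProd (X : Fin n → MvPolynomial (Fin n) K) i j k l m ∈ PFIdeal K {o}ᶜ := by
  have hF : ∀ a b : Fin n, a ≠ o → b ≠ o →
      (X a - X b : MvPolynomial (Fin n) K) ∈ PFIdeal K {o}ᶜ :=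
    fun a b ha hb => sub_mem_PFIdeal (by simpa using ha) (by simpa using hb)
  rw [cubicProd]
  have : (i ≠ o ∧ l ≠ o) ∨ (i ≠ o ∧ m ≠ o) ∨ (j ≠ o ∧ k ≠ o) := by grind
  rcases this with h | h | h
  · exact Ideal.mul_mem_right _ _ (Ideal.mul_mem_right _ _ (hF _ _ h.1 h.2))
  · exact Ideal.mul_mem_right _ _ (Ideal.mul_mem_left _ _ (hF _ _ h.1 h.2))
  · exact Ideal.mul_mem_left _ _ (hF _ _ h.1 h.2)

theorem sub_mem_PFIdeal_compl_pair {p q a b : Fin n} (ha : a ≠ p ∧ a ≠ q) (hb : b ≠ p ∧ b ≠ q) :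
    (X a - X b : MvPolynomial (Fin n) K) ∈ PFIdeal K {p, q}ᶜ :=
  sub_mem_PFIdeal (by simpa using ha) (by simpa using hb)

theorem quarticProd_mem_PFIdeal_compl_pair {p q i j k l m : Fin n} (h : [i, j, k, l, m].Nodup)
    (hij : ¬ ((i = p ∨ i = q) ∧ (j = p ∨ j = q))) :
    quarticProd (X : Fin n → MvPolynomial (Fin n) K) i j k l m ∈ PFIdeal K {p, q}ᶜ := by
  rw [quarticProd]
  have : ((i ≠ p ∧ i ≠ q) ∧ k ≠ p ∧ k ≠ q) ∨ ((i ≠ p ∧ i ≠ q) ∧ l ≠ p ∧ l ≠ q) ∨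
      ((j ≠ p ∧ j ≠ q) ∧ m ≠ p ∧ m ≠ q) ∨ ((j ≠ p ∧ j ≠ q) ∧ l ≠ p ∧ l ≠ q) := by
    rw [nodup_five_iff] at h
    grind
  rcases this with h | h | h | h
  · exact Ideal.mul_mem_right _ _ (Ideal.mul_mem_right _ _ (Ideal.mul_mem_right _ _
      (sub_mem_PFIdeal_compl_pair h.1 h.2)))
  · exact Ideal.mul_mem_right _ _ (Ideal.mul_mem_right _ _ (Ideal.mul_mem_left _ _
      (sub_mem_PFIdeal_compl_pair h.1 h.2)))
  · exact Ideal.mul_mem_right _ _ (Ideal.mul_mem_left _ _ (sub_mem_PFIdeal_compl_pair h.1 h.2))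
  · exact Ideal.mul_mem_left _ _ (sub_mem_PFIdeal_compl_pair h.1 h.2)

theorem sub_mul_sub_mem_sup_span_sq {p q k l m : Fin n} (hk : k ≠ p ∧ k ≠ q) (hl : l ≠ p ∧ l ≠ q)
    (hm : m ≠ p ∧ m ≠ q) : ((X q - X l) * (X q - X m) : MvPolynomial (Fin n) K) ∈
      PFIdeal K {p, q}ᶜ ⊔ Ideal.span {(X q - X k) ^ 2} := by
  rw [show ((X q - X l) * (X q - X m) : MvPolynomial (Fin n) K) =
    ((X q - X k) * (X k - X m) + (X q - X m) * (X k - X l)) + (X q - X k) ^ 2 by ring]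
  exact Ideal.add_mem _ (Ideal.mem_sup_left (add_mem
    (Ideal.mul_mem_left _ _ (sub_mem_PFIdeal_compl_pair hk hm))
    (Ideal.mul_mem_left _ _ (sub_mem_PFIdeal_compl_pair hk hl))))
    (Ideal.mem_sup_right (Ideal.mem_span_singleton_self _))

theorem quarticProd_mem_sup_span_sq {p q r i j k l m : Fin n} (hpq : p ≠ q) (hr : r ≠ p ∧ r ≠ q)
    (h : [i, j, k, l, m].Nodup) : quarticProd (X : Fin n → MvPolynomial (Fin n) K) i j k l m ∈
      PFIdeal K {p, q}ᶜ ⊔ Ideal.span {(X q - X r) ^ 2} := by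
  by_cases hij : (i = p ∨ i = q) ∧ (j = p ∨ j = q)
  · have : j = q ∨ i = q := by grind
    rcases this with rfl | rfl
    · rw [quarticProd, mul_assoc]
      exact Ideal.mul_mem_left _ _ (sub_mul_sub_mem_sup_span_sq hr (by grind) (by grind))
    · rw [quarticProd, mul_assoc]
      exact Ideal.mul_mem_right _ _ (sub_mul_sub_mem_sup_span_sq hr (by grind) (by grind))
  · exact Ideal.mem_sup_left (quarticProd_mem_PFIdeal_compl_pair h hij)

theorem cubicProd_mem_sup_span_sq {p q r i j k l m : Fin n} (hpq : p ≠ q) (hr : r ≠ p ∧ r ≠ q)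
    (h : [i, j, k, l, m].Nodup) (hi : i = p → j ≠ q ∧ k ≠ q) :
    cubicProd (X : Fin n → MvPolynomial (Fin n) K) i j k l m ∈
      PFIdeal K {p, q}ᶜ ⊔ Ideal.span {(X q - X r) ^ 2} := by
  rw [cubicProd]
  have : ((i ≠ p ∧ i ≠ q) ∧ l ≠ p ∧ l ≠ q) ∨ ((i ≠ p ∧ i ≠ q) ∧ m ≠ p ∧ m ≠ q) ∨
      ((j ≠ p ∧ j ≠ q) ∧ k ≠ p ∧ k ≠ q) ∨ (i = q ∧ (l ≠ p ∧ l ≠ q) ∧ m ≠ p ∧ m ≠ q) := by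
    rw [nodup_five_iff] at h
    grind
  rcases this with h | h | h | ⟨rfl, h⟩
  · exact Ideal.mul_mem_right _ _ (Ideal.mul_mem_right _ _
      (Ideal.mem_sup_left (sub_mem_PFIdeal_compl_pair h.1 h.2)))
  · exact Ideal.mul_mem_right _ _ (Ideal.mul_mem_left _ _
      (Ideal.mem_sup_left (sub_mem_PFIdeal_compl_pair h.1 h.2)))
  · exact Ideal.mul_mem_left _ _ (Ideal.mem_sup_left (sub_mem_PFIdeal_compl_pair h.1 h.2))
  · exact Ideal.mul_mem_right _ _ (sub_mul_sub_mem_sup_span_sq hr h.1 h.2)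

theorem mem_PFIdeal_of_mul_cubicProd_mem {i j k l m : Fin n} (h : [i, j, k, l, m].Nodup)
    {r : MvPolynomial (Fin n) K}
    (hr : r * cubicProd X i j k l m ∈ PFIdeal K {i, j}ᶜ ⊔ Ideal.span {(X j - X k) ^ 2}) :
    r ∈ PFIdeal K {i}ᶜ := by
  obtain ⟨x, hx, z, hz, hxz⟩ := Submodule.mem_sup.mp hr
  obtain ⟨c, rfl⟩ := Ideal.mem_span_singleton'.mp hz
  have hne : ({i, j}ᶜ : Finset (Fin n)).Nonempty := ⟨k, by simp; grind⟩
  have hne' : ({i}ᶜ : Finset (Fin n)).Nonempty := ⟨k, by simp; grind⟩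
  have hprime := PFIdeal_isPrime (K := K) hne
  have hprime' := PFIdeal_isPrime (K := K) hne'
  have h1 : (X j - X k) * (r * ((X i - X l) * (X i - X m)) - c * (X j - X k)) ∈
      PFIdeal K {i, j}ᶜ := by
    rw [cubicProd] at hxz
    convert hx using 1
    linear_combination -hxz
  have h2 := (hprime.mem_or_mem h1).resolve_left fun h' => by
    have := ((sub_mem_PFIdeal_iff hne (by grind)).mp h').1
    simp at this
  have h3 : r * ((X i - X l) * (X i - X m)) ∈ PFIdeal K {i}ᶜ := by
    rw [← sub_add_cancel (r * ((X i - X l) * (X i - X m))) (c * (X j - X k))]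
    exact add_mem (PFIdeal_mono (by simp) h2)
      (Ideal.mul_mem_left _ _ (sub_mem_PFIdeal (by simp; grind) (by simp; grind)))
  have h4 : ∀ a, a ≠ i → (X i - X a : MvPolynomial (Fin n) K) ∉ PFIdeal K {i}ᶜ := by
    intro a ha h'
    have := ((sub_mem_PFIdeal_iff hne' ha.symm).mp h').1
    simp at this
  exact (hprime'.mem_or_mem h3).resolve_right fun h' =>
    (hprime'.mem_or_mem h').elim (h4 l (by grind)) (h4 m (by grind))

theorem mem_PFIdeal_of_mul_quarticProd_mem {i j k l m : Fin n} (h : [i, j, k, l, m].Nodup)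
    {r : MvPolynomial (Fin n) K} (hr : r * quarticProd X i j k l m ∈ PFIdeal K {i, j}ᶜ) :
    r ∈ PFIdeal K {i, j}ᶜ := by
  have hne : ({i, j}ᶜ : Finset (Fin n)).Nonempty := ⟨k, by simp; grind⟩
  have hprime := PFIdeal_isPrime (K := K) hne
  have hi : ∀ a, a ≠ i → (X i - X a : MvPolynomial (Fin n) K) ∉ PFIdeal K {i, j}ᶜ := by
    intro a ha h'
    have := ((sub_mem_PFIdeal_iff hne ha.symm).mp h').1
    simp at this
  have hj : ∀ a, a ≠ j → (X j - X a : MvPolynomial (Fin n) K) ∉ PFIdeal K {i, j}ᶜ := by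
    intro a ha h'
    have := ((sub_mem_PFIdeal_iff hne ha.symm).mp h').1
    simp at this
  rw [quarticProd, ← mul_assoc, ← mul_assoc, ← mul_assoc] at hr
  have h1 := (hprime.mem_or_mem hr).resolve_right (hj l (by grind))
  have h2 := (hprime.mem_or_mem h1).resolve_right (hj m (by grind))
  have h3 := (hprime.mem_or_mem h2).resolve_right (hi l (by grind))
  exact (hprime.mem_or_mem h3).resolve_right (hi k (by grind))

theorem mem_PFIdeal_of_mul_prod_mem {o k l m : Fin n} (h : [o, k, l, m].Nodup)
    {r : MvPolynomial (Fin n) K}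
    (hr : r * ((X o - X k) * (X o - X l) * (X o - X m)) ∈ PFIdeal K {o}ᶜ) :
    r ∈ PFIdeal K {o}ᶜ := by
  have hne : ({o}ᶜ : Finset (Fin n)).Nonempty := ⟨k, by simp; grind⟩
  have hprime := PFIdeal_isPrime (K := K) hne
  have ho : ∀ a, a ≠ o → (X o - X a : MvPolynomial (Fin n) K) ∉ PFIdeal K {o}ᶜ := by
    intro a ha h'
    have := ((sub_mem_PFIdeal_iff hne ha.symm).mp h').1
    simp at this
  rw [← mul_assoc, ← mul_assoc] at hr
  have h1 := (hprime.mem_or_mem hr).resolve_right (ho m (by grind))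
  have h2 := (hprime.mem_or_mem h1).resolve_right (ho l (by grind))
  exact (hprime.mem_or_mem h2).resolve_right (ho k (by grind))

theorem InkIdeal_eq_of_containsSpechtProducts (hn : 5 ≤ n) {S : Ideal (MvPolynomial (Fin n) K)}
    (hS : ContainsSpechtProducts X S) (hSI : S ≤ InkIdeal K n (n - 2)) :
    InkIdeal K n (n - 2) = S := by
  refine le_antisymm ?_ hSI
  have hI₂ : ∀ i j : Fin n, i ≠ j → InkIdeal K n (n - 2) ≤ PFIdeal K {i, j}ᶜ :=
    fun i j hij => InkIdeal_le_PFIdeal (by omega) (Finset.card_pair hij)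
  have hex : ∀ i j k : Fin n, i ≠ j → i ≠ k → j ≠ k → ∃ l m, [i, j, k, l, m].Nodup := by
    intro i j k hij hik hjk
    obtain ⟨l, hl⟩ := exists_fin_ne_three (by omega) i j k
    obtain ⟨m, hm⟩ := exists_fin_ne_four hn i j k l
    exact ⟨l, m, by grind⟩
  choose κ hκ _ using fun i : Fin n => exists_fin_ne_two (by omega) i i
  choose kU lU mU hnU using fun t : {t : Fin n × Fin n // t.1 < t.2} =>
    show ∃ k l m, [t.1.1, t.1.2, k, l, m].Nodup by
      obtain ⟨k, hk⟩ := exists_fin_ne_two (by omega) t.1.1 t.1.2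
      obtain ⟨l, m, h⟩ := hex t.1.1 t.1.2 k t.2.ne hk.1.symm hk.2.symm
      exact ⟨k, l, m, h⟩
  choose lV mV hnV using fun t : {t : Fin n × Fin n // t.2 ≠ t.1 ∧ t.2 ≠ κ t.1} =>
    hex t.1.1 t.1.2 (κ t.1.1) t.2.1.symm (hκ _).symm t.2.2
  let gU := fun t => quarticProd (X : Fin n → MvPolynomial (Fin n) K) t.1.1 t.1.2 (kU t) (lU t) (mU t)
  let gV := fun t => cubicProd (X : Fin n → MvPolynomial (Fin n) K) t.1.1 t.1.2 (κ t.1.1) (lV t) (mV t)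
  let U := S ⊔ Ideal.span (Set.range gU)
  let V := U ⊔ Ideal.span (Set.range gV)
  have hSU : S ≤ U := le_sup_left
  have hUV : U ≤ V := le_sup_left
  have hgU : ∀ t, gU t ∈ U := fun t => Ideal.mem_sup_right (Ideal.subset_span ⟨t, rfl⟩)
  have hgV : ∀ t, gV t ∈ V := fun t => Ideal.mem_sup_right (Ideal.subset_span ⟨t, rfl⟩)
  have hU : ∀ i j k l m, [i, j, k, l, m].Nodup → quarticProd X i j k l m ∈ U := by
    have key : ∀ i j k l m, i < j → [i, j, k, l, m].Nodup → quarticProd X i j k l m ∈ U := by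
      intro i j k l m hij h
      rw [← sub_add_cancel (quarticProd X i j k l m) (gU ⟨(i, j), hij⟩)]
      exact add_mem (hSU (hS.quarticProd_sub_mem (hnU ⟨(i, j), hij⟩) h)) (hgU _)
    intro i j k l m h
    rcases lt_trichotomy i j with hij | hij | hij
    · exact key i j k l m hij h
    · exact absurd hij (by grind)
    · rw [← quarticProd_swap]
      exact key j i m l k hij (by grind)
  have hV : ∀ i j k l m, [i, j, k, l, m].Nodup → cubicProd X i j k l m ∈ V := fun i j k l m h =>
    hS.cubicProd_mem (hSU.trans hUV) hκ
      (fun i j hi hj => ⟨_, _, hnV ⟨(i, j), hi, hj⟩, hgV ⟨(i, j), hi, hj⟩⟩) h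
  let o : Fin n := ⟨0, by omega⟩
  obtain ⟨a, hao, -⟩ := exists_fin_ne_two (by omega) o o
  obtain ⟨b, hbo, hba⟩ := exists_fin_ne_two (by omega) o a
  obtain ⟨c, p, h5⟩ := hex o a b hao.symm hbo.symm hba.symm
  have hIo : InkIdeal K n (n - 2) ≤ PFIdeal K {o}ᶜ :=
    (hI₂ o a hao.symm).trans (PFIdeal_mono (by simp))
  have hIV : InkIdeal K n (n - 2) ≤ V := by
    refine le_of_le_sup_span_range
      (g := fun _ : Unit => ((X o - X a) * (X o - X b) * (X o - X c) : MvPolynomial (Fin n) K))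
      (N := fun _ => PFIdeal K {o}ᶜ) (fun _ => hIo) (fun _ => ?_) (fun _ _ h => absurd rfl h)
      (fun _ r hr => ?_) ?_
    · refine sup_le (sup_le (hSI.trans hIo) (Ideal.span_le.mpr ?_)) (Ideal.span_le.mpr ?_)
      · rintro _ ⟨t, rfl⟩
        exact quarticProd_mem_PFIdeal_compl_singleton o (hnU t)
      · rintro _ ⟨t, rfl⟩
        exact cubicProd_mem_PFIdeal_compl_singleton o (hnV t)
    · refine mul_mem_of_mem_PFIdeal (fun d hd e he => ?_)
        (mem_PFIdeal_of_mul_prod_mem (by grind) hr)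
      exact sub_mul_prod_mem_of_cubicProd_mem hV h5 (by simpa using hd) (by simpa using he)
    · refine InkIdeal_le_of_prod_mem (by omega) o fun d e f hdef => ?_
      rw [← sub_add_cancel ((X o - X d) * (X o - X e) * (X o - X f))
        ((X o - X a) * (X o - X b) * (X o - X c))]
      exact add_mem (Ideal.mem_sup_left (prod_sub_mem_of_cubicProd_mem hV (by grind) hdef))
        (Ideal.mem_sup_right (Ideal.subset_span ⟨(), rfl⟩))
  have hIU : InkIdeal K n (n - 2) ≤ U := by
    refine le_of_le_sup_span_range (g := gV) (N := fun t =>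
      PFIdeal K {t.1.1, t.1.2}ᶜ ⊔ Ideal.span {(X t.1.2 - X (κ t.1.1)) ^ 2})
      (fun t => (hI₂ _ _ t.2.1.symm).trans le_sup_left) (fun t => ?_) (fun t t' ht => ?_)
      (fun t r hr => ?_) hIV
    · refine sup_le (hSI.trans ((hI₂ _ _ t.2.1.symm).trans le_sup_left)) (Ideal.span_le.mpr ?_)
      rintro _ ⟨t', rfl⟩
      exact quarticProd_mem_sup_span_sq t.2.1.symm ⟨hκ _, t.2.2.symm⟩ (hnU t')
    · refine cubicProd_mem_sup_span_sq t.2.1.symm ⟨hκ _, t.2.2.symm⟩ (hnV t') fun h1 =>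
        ⟨fun h2 => ht (Subtype.ext (Prod.ext h1 h2)), fun h2 => t.2.2 ?_⟩
      rw [← h2, h1]
    · refine mul_mem_of_mem_PFIdeal (fun d hd e he => ?_)
        (mem_PFIdeal_of_mul_cubicProd_mem (hnV t) hr)
      exact hS.sub_mul_cubicProd_mem hSU hU (hnV t) (by simpa using hd) (by simpa using he)
  refine le_of_le_sup_span_range (g := gU) (N := fun t => PFIdeal K {t.1.1, t.1.2}ᶜ)
    (fun t => hI₂ _ _ t.2.ne) (fun t => hSI.trans (hI₂ _ _ t.2.ne)) (fun t t' ht => ?_)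
    (fun t r hr => ?_) hIU
  · refine quarticProd_mem_PFIdeal_compl_pair (hnU t') fun ⟨h1, h2⟩ => ht ?_
    have h3 := t.2
    have h4 := t'.2
    refine Subtype.ext (Prod.ext ?_ ?_)
    · grind
    · grind
  · refine mul_mem_of_mem_PFIdeal (fun d hd e he => ?_)
      (mem_PFIdeal_of_mul_quarticProd_mem (hnU t) hr)
    exact hS.sub_mul_quarticProd_mem (hnU t) (by simpa using hd) (by simpa using he)

end InkIdealGenerators

section SpechtIdeals

variable {K : Type*} [Field K] {n : ℕ}

theorem IsTableau.comp_perm {parts : List ℕ} {T : Fin n → ℕ × ℕ} (hT : IsTableau parts T)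
    (σ : Equiv.Perm (Fin n)) : IsTableau parts (T ∘ σ) := by
  refine ⟨hT.1.comp σ.injective, fun i => hT.2.1 (σ i), fun r c hr hc => ?_⟩
  obtain ⟨i, hi⟩ := hT.2.2 r c hr hc
  exact ⟨σ.symm i, by simpa using hi⟩

theorem exists_perm_apply_eq {m : ℕ} (hm : m ≤ n) {l : List (Fin n)} (hl : l.Nodup)
    (hlm : l.length = m) :
    ∃ σ : Equiv.Perm (Fin n), ∀ (i : ℕ) (hi : i < l.length), (σ l[i] : ℕ) = i := by
  subst hlm
  let f : Fin l.length ↪ Fin n := ⟨l.get, List.nodup_iff_injective_get.mp hl⟩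
  obtain ⟨σ, hσ⟩ := (Equiv.Perm.isMultiplyPretransitive (Fin n) l.length).exists_smul_eq f
    (Fin.castLEEmb hm)
  refine ⟨σ, fun i hi => ?_⟩
  exact congrArg Fin.val (DFunLike.congr_fun hσ ⟨i, hi⟩)

theorem sub_dvd_spechtPoly {T : Fin n → ℕ × ℕ} {a b : Fin n} (hc : (T a).2 = (T b).2)
    (hr : (T a).1 < (T b).1) : (X a - X b : MvPolynomial (Fin n) K) ∣ spechtPoly K T :=
  Finset.dvd_prod_of_mem (fun p : Fin n × Fin n => (X p.1 - X p.2 : MvPolynomial (Fin n) K))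
    (a := (a, b)) (by simp [hc, hr])

theorem spechtIdeal_le_InkIdeal {parts : List ℕ} (hn : 2 ≤ n)
    (h : ∀ T : Fin n → ℕ × ℕ, IsTableau parts T → ∀ p q : Fin n, p ≠ q → ∃ a b,
      (a ≠ p ∧ a ≠ q) ∧ (b ≠ p ∧ b ≠ q) ∧ (T a).2 = (T b).2 ∧ (T a).1 < (T b).1) :
    spechtIdeal K n parts ≤ InkIdeal K n (n - 2) := by
  refine Ideal.span_le.mpr ?_
  rintro _ ⟨T, hT, rfl⟩
  refine (mem_InkIdeal_iff hn).mpr fun e he => ?_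
  obtain ⟨p, q, hpq, rfl⟩ := Finset.card_eq_two.mp he
  obtain ⟨a, b, ha, hb, hc, hr⟩ := h T hT p q hpq
  exact Ideal.mem_of_dvd _ (sub_dvd_spechtPoly hc hr) (sub_mem_PFIdeal_compl_pair ha hb)

theorem exists_isTableau_three_pairs (hn : 6 ≤ n) {a b c d e f : Fin n}
    (h : [a, b, c, d, e, f].Nodup) : ∃ T : Fin n → ℕ × ℕ, IsTableau [n - 3, 3] T ∧
      spechtPoly K T = (X a - X b) * (X c - X d) * (X e - X f) := by
  let T₀ : Fin n → ℕ × ℕ := fun k => if k.1 < 6 then (k.1 % 2, k.1 / 2) else (0, k.1 - 3)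
  have hT₀ : IsTableau [n - 3, 3] T₀ := by
    refine ⟨fun k l hkl => ?_, fun k => ?_, fun r c hr hc => ?_⟩
    · simp only [T₀] at hkl
      split_ifs at hkl <;> simp only [Prod.mk.injEq] at hkl <;> omega
    · have := k.2
      simp only [T₀]
      split_ifs with hk
      · rcases Nat.mod_two_eq_zero_or_one k.1 with h2 | h2 <;> simp [h2] <;> omega
      · simp
        omega
    · simp only [List.length_cons, List.length_nil] at hr
      interval_cases r
      · simp only [List.getD_cons_zero] at hc
        by_cases hc3 : c < 3
        · refine ⟨⟨2 * c, by omega⟩, ?_⟩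
          simp only [T₀]
          rw [if_pos (by omega)]
          ext <;> simp
        · refine ⟨⟨c + 3, by omega⟩, ?_⟩
          simp only [T₀]
          rw [if_neg (by omega)]
          ext <;> simp
      · simp at hc
        refine ⟨⟨2 * c + 1, by omega⟩, ?_⟩
        simp only [T₀]
        rw [if_pos (by omega)]
        ext <;> simp <;> omega
  obtain ⟨σ, hσ⟩ := exists_perm_apply_eq hn h rfl
  refine ⟨T₀ ∘ σ, hT₀.comp_perm σ, ?_⟩
  have ha : (σ a : ℕ) = 0 := hσ 0 (by simp)
  have hb : (σ b : ℕ) = 1 := hσ 1 (by simp)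
  have hc : (σ c : ℕ) = 2 := hσ 2 (by simp)
  have hd : (σ d : ℕ) = 3 := hσ 3 (by simp)
  have he : (σ e : ℕ) = 4 := hσ 4 (by simp)
  have hf : (σ f : ℕ) = 5 := hσ 5 (by simp)
  have heq : ∀ p q : Fin n, p = q ↔ (σ p : ℕ) = σ q := fun p q => by
    rw [← Fin.ext_iff, σ.apply_eq_iff_eq]
  have hfilter : Finset.univ.filter (fun p : Fin n × Fin n =>
      ((T₀ ∘ σ) p.1).2 = ((T₀ ∘ σ) p.2).2 ∧ ((T₀ ∘ σ) p.1).1 < ((T₀ ∘ σ) p.2).1) =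
      {(a, b), (c, d), (e, f)} := by
    ext ⟨p, q⟩
    simp only [Finset.mem_filter_univ, Function.comp_apply, T₀, Finset.mem_insert,
      Finset.mem_singleton, Prod.mk.injEq, heq, ha, hb, hc, hd, he, hf]
    split_ifs <;> simp only <;> omega
  rw [spechtPoly, hfilter, Finset.prod_insert, Finset.prod_insert, Finset.prod_singleton, mul_assoc]
  all_goals simp [heq, ha, hb, hc, hd, he, hf]

theorem exists_isTableau_triple_pair {a b c d e : Fin 5}
    (h : [a, b, c, d, e].Nodup) : ∃ T : Fin 5 → ℕ × ℕ, IsTableau [2, 2, 1] T ∧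
      spechtPoly K T = (X a - X b) * (X a - X c) * (X b - X c) * (X d - X e) := by
  let T₀ : Fin 5 → ℕ × ℕ := fun k => (k.1 % 3, k.1 / 3)
  have hT₀ : IsTableau [2, 2, 1] T₀ := by
    refine ⟨fun k l hkl => ?_, fun k => ?_, fun r c hr hc => ?_⟩
    · simp only [T₀, Prod.mk.injEq] at hkl
      omega
    · fin_cases k <;> simp [T₀]
    · simp only [List.length_cons, List.length_nil] at hr
      have hc' : 3 * c + r < 5 := by
        interval_cases r <;> simp at hc <;> omega
      refine ⟨⟨3 * c + r, hc'⟩, ?_⟩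
      simp only [T₀, Prod.mk.injEq]
      omega
  obtain ⟨σ, hσ⟩ := exists_perm_apply_eq le_rfl h rfl
  refine ⟨T₀ ∘ σ, hT₀.comp_perm σ, ?_⟩
  have ha : (σ a : ℕ) = 0 := hσ 0 (by simp)
  have hb : (σ b : ℕ) = 1 := hσ 1 (by simp)
  have hc : (σ c : ℕ) = 2 := hσ 2 (by simp)
  have hd : (σ d : ℕ) = 3 := hσ 3 (by simp)
  have he : (σ e : ℕ) = 4 := hσ 4 (by simp)
  have heq : ∀ p q : Fin 5, p = q ↔ (σ p : ℕ) = σ q := fun p q => by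
    rw [← Fin.ext_iff, σ.apply_eq_iff_eq]
  have hfilter : Finset.univ.filter (fun p : Fin 5 × Fin 5 =>
      ((T₀ ∘ σ) p.1).2 = ((T₀ ∘ σ) p.2).2 ∧ ((T₀ ∘ σ) p.1).1 < ((T₀ ∘ σ) p.2).1) =
      {(a, b), (a, c), (b, c), (d, e)} := by
    ext ⟨p, q⟩
    simp only [Finset.mem_filter_univ, Function.comp_apply, T₀, Finset.mem_insert,
      Finset.mem_singleton, Prod.mk.injEq, heq, ha, hb, hc, hd, he]
    omega
  rw [spechtPoly, hfilter, Finset.prod_insert, Finset.prod_insert, Finset.prod_insert,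
    Finset.prod_singleton, mul_assoc, mul_assoc]
  all_goals simp [heq, ha, hb, hc, hd, he]

theorem InkIdeal_eq_spechtIdeal (hn : 6 ≤ n) :
    InkIdeal K n (n - 2) = spechtIdeal K n [n - 3, 3] := by
  have h3 : ∀ a b c d e f : Fin n, [a, b, c, d, e, f].Nodup →
      (X a - X b) * (X c - X d) * (X e - X f) ∈ spechtIdeal K n [n - 3, 3] := by
    intro a b c d e f h
    obtain ⟨T, hT, h⟩ := exists_isTableau_three_pairs (K := K) hn h
    exact Ideal.subset_span ⟨T, hT, h.symm⟩
  refine InkIdeal_eq_of_containsSpechtProducts (by omega) ⟨h3, fun a b c d e h => ?_⟩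
    (spechtIdeal_le_InkIdeal (by omega) fun T hT p q hpq => ?_)
  · obtain ⟨g, hg⟩ := exists_fin_notMem (s := {a, b, c, d, e}) (Finset.card_le_five.trans_lt hn)
    simp only [Finset.mem_insert, Finset.mem_singleton, not_or] at hg
    rw [nodup_five_iff] at h
    rw [show (X a - X b) * (X a - X c) * (X b - X c) * (X d - X e) =
      (X a - X b) * ((X a - X c) * (X b - X g) * (X d - X e)) +
      (X a - X c) * ((X a - X b) * (X g - X c) * (X d - X e) : MvPolynomial (Fin n) K) by ring]
    exact add_mem (Ideal.mul_mem_left _ _ (h3 _ _ _ _ _ _ (by grind only [nodup_six_iff])))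
      (Ideal.mul_mem_left _ _ (h3 _ _ _ _ _ _ (by grind only [nodup_six_iff])))
  · have hbox : ∀ r c, r < 2 → c < 3 → ∃ i, T i = (r, c) := fun r c hr hc =>
      hT.2.2 r c (by simpa using hr) (by interval_cases r <;> simp <;> omega)
    choose i hi using hbox
    by_contra! hc
    have key : ∀ c (h : c < 3), (i 0 c (by omega) h = p ∨ i 0 c (by omega) h = q) ∨
        (i 1 c (by omega) h = p ∨ i 1 c (by omega) h = q) := by
      intro c h
      have := hc (i 0 c (by omega) h) (i 1 c (by omega) h)
      simp only [hi] at this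
      by_contra! hcon
      exact absurd (this ⟨hcon.1.1, hcon.1.2⟩ ⟨hcon.2.1, hcon.2.2⟩ trivial) (by norm_num)
    have key' : ∀ c, c < 3 → c = (T p).2 ∨ c = (T q).2 := by
      intro c h
      rcases key c h with (h1 | h1) | (h1 | h1)
      · left; rw [← h1, hi]
      · right; rw [← h1, hi]
      · left; rw [← h1, hi]
      · right; rw [← h1, hi]
    have h0 := key' 0 (by omega)
    have h1 := key' 1 (by omega)
    have h2 := key' 2 (by omega)
    omega

theorem InkIdeal_five_eq_spechtIdeal : InkIdeal K 5 3 = spechtIdeal K 5 [2, 2, 1] := by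
  refine InkIdeal_eq_of_containsSpechtProducts le_rfl ⟨fun a b c d e f h => ?_,
    fun a b c d e h => ?_⟩ (spechtIdeal_le_InkIdeal (by omega) fun T hT p q hpq => ?_)
  · exact absurd h.length_le_card (by simp)
  · obtain ⟨T, hT, h⟩ := exists_isTableau_triple_pair (K := K) h
    exact Ideal.subset_span ⟨T, hT, h.symm⟩
  · obtain ⟨a, ha⟩ := hT.2.2 0 0 (by simp) (by simp)
    obtain ⟨b, hb⟩ := hT.2.2 1 0 (by simp) (by simp)
    obtain ⟨c, hc⟩ := hT.2.2 2 0 (by simp) (by simp)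
    obtain ⟨d, hd⟩ := hT.2.2 0 1 (by simp) (by simp)
    obtain ⟨e, he⟩ := hT.2.2 1 1 (by simp) (by simp)
    by_contra! hcon
    have h1 := hcon a b
    have h2 := hcon a c
    have h3 := hcon b c
    have h4 := hcon d e
    simp only [ha, hb, hc, hd, he] at h1 h2 h3 h4
    have hne : ∀ x y, T x ≠ T y → x ≠ y := fun x y h hxy => h (congrArg T hxy)
    have h5 : [a, b, c, d, e].Nodup := by
      rw [nodup_five_iff]
      refine ⟨⟨?_, ?_, ?_, ?_⟩, ⟨?_, ?_, ?_⟩, ⟨?_, ?_⟩, ?_⟩ <;> apply hne <;>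
        simp [ha, hb, hc, hd, he]
    rw [nodup_five_iff] at h5
    norm_num at h1 h2 h3 h4
    grind

theorem isCohenMacaulayRing_quotient_InkIdeal_iff (hn : 5 ≤ n) :
    IsCohenMacaulayRing (MvPolynomial (Fin n) K ⧸ InkIdeal K n (n - 2)) ↔ ringChar K ≠ 2 := by
  have hchar : ringChar K = 2 ↔ (2 : K) = 0 := by
    constructor
    · intro h
      have := ringChar.Nat.cast_ringChar (R := K)
      rw [h] at this
      exact_mod_cast this
    · intro h
      have h2 : ringChar K ∣ 2 := ringChar.dvd (by exact_mod_cast h)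
      exact ((Nat.dvd_prime Nat.prime_two).mp h2).resolve_left (CharP.ringChar_ne_one)
  refine ⟨fun h hc => ?_, fun h => ?_⟩
  · exact not_isCohenMacaulayRing_quotient_InkIdeal (hchar.mp hc) hn h
  · exact isCohenMacaulayRing_quotient_InkIdeal (fun h2 => h (hchar.mpr h2)) hn

end SpechtIdeals

/-- Theorem 5.3: for `n ≥ 5`, the ring `R/I_{n,n-2}` is Cohen–Macaulay if and only if
`char K ≠ 2`.  Consequently, for `n ≥ 6` the ring `R/I^Sp_{(n-3, 3)}` is Cohen–Macaulay
if and only if `char K ≠ 2`, and the same holds for `R/I^Sp_{(2, 2, 1)}` (with `n = 5`). -/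
theorem Ink_CM_iff_char_ne_two {K : Type*} [Field K] (n : ℕ) :
    (5 ≤ n →
      (IsCohenMacaulayRing (MvPolynomial (Fin n) K ⧸ InkIdeal K n (n - 2)) ↔
        ringChar K ≠ 2)) ∧
    (6 ≤ n →
      (IsCohenMacaulayRing (MvPolynomial (Fin n) K ⧸ spechtIdeal K n [n - 3, 3]) ↔
        ringChar K ≠ 2)) ∧
    (IsCohenMacaulayRing (MvPolynomial (Fin 5) K ⧸ spechtIdeal K 5 [2, 2, 1]) ↔
      ringChar K ≠ 2) := by
  refine ⟨isCohenMacaulayRing_quotient_InkIdeal_iff, fun hn => ?_, ?_⟩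
  · rw [← InkIdeal_eq_spechtIdeal hn]
    exact isCohenMacaulayRing_quotient_InkIdeal_iff (by omega)
  · rw [← InkIdeal_five_eq_spechtIdeal]
    exact isCohenMacaulayRing_quotient_InkIdeal_iff le_rfl
end
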